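/- Assume 0 < γ ≤ 2 and (H1), and let f be a conservative mild solution of the Boltzmann–Fermi–Dirac equation with initial datum f₀ ∈ L¹₂(ℝ³). Then: (creation) for every s ≥ 2 there exists a constant C_{1,s} ≥ 0 such that ∫_{ℝ³} f(t,v)|v|^s dv ≤ C_{1,s} · max{t^{(2−s)/γ}, 1} for all t > 0; (propagation) if in addition ‖f₀‖_{1,s} < ∞ for some s > 2, then there exists a constant C_{2,s} ≥ 0 such that ∫_{ℝ³} f(t,v)|v|^s dv ≤ C_{2,s} for all t ≥ 0. -/

import Mathlib

noncomputable section

open MeasureTheory Real Set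
open scoped RealInnerProductSpace

/-- `ℝ³` as a Euclidean space. -/
abbrev R3 : Type := EuclideanSpace ℝ (Fin 3)

/-- The unit sphere `𝕊²` in `ℝ³`. -/
abbrev S2 : Type := Metric.sphere (0 : R3) 1

/-- The surface measure on the unit sphere in `ℝ³` (total mass `4π`). -/
def sphMeasure : Measure S2 := Measure.toSphere (volume : Measure R3)

/-- Post-collision velocity `v' = (v+v_*)/2 + (|v-v_*|/2)σ`. -/
def vOut (v w : R3) (σ : S2) : R3 := (2⁻¹ : ℝ) • (v + w) + (‖v - w‖ / 2) • (σ : R3)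

/-- Post-collision velocity `v'_* = (v+v_*)/2 - (|v-v_*|/2)σ`. -/
def vOutStar (v w : R3) (σ : S2) : R3 := (2⁻¹ : ℝ) • (v + w) - (‖v - w‖ / 2) • (σ : R3)

/-- `cos θ = ((v - v_*)/|v - v_*|) · σ`. -/
def cosAngle (v w : R3) (σ : S2) : ℝ := ⟪‖v - w‖⁻¹ • (v - w), (σ : R3)⟫

/-- The collision kernel `B(v - v_*, σ) = |v - v_*|^γ b(cos θ)`. -/
def Bker (γ : ℝ) (b : ℝ → ℝ) (v w : R3) (σ : S2) : ℝ := ‖v - w‖ ^ γ * b (cosAngle v w σ)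

/-- Grad's angular cutoff assumption (H1), with the standing assumptions on `b`:
`b` is measurable, nonnegative, symmetric (`b(cos(π-θ)) = b(cos θ)`), and
`0 < C_b = 2π∫₀^π b(cos θ) sin θ dθ < ∞`. -/
structure GradCutoff (b : ℝ → ℝ) : Prop where
  measurable : Measurable b
  nonneg : ∀ x : ℝ, 0 ≤ b x
  symm : ∀ θ : ℝ, b (Real.cos (π - θ)) = b (Real.cos θ)
  integrable : IntervalIntegrable (fun θ : ℝ => b (Real.cos θ) * Real.sin θ) volume 0 π
  pos : 0 < ∫ θ in (0:ℝ)..π, b (Real.cos θ) * Real.sin θ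

/-- `C_b = 2π ∫₀^π b(cos θ) sin θ dθ`. -/
def Cb (b : ℝ → ℝ) : ℝ := 2 * π * ∫ θ in (0:ℝ)..π, b (Real.cos θ) * Real.sin θ

/-- `C_{b,2} = 2π ∫₀^π b(cos θ) sin³ θ dθ`. -/
def Cb2 (b : ℝ → ℝ) : ℝ := 2 * π * ∫ θ in (0:ℝ)..π, b (Real.cos θ) * Real.sin θ ^ 3

/-- `φ(ε) = ∫_{𝕊²} b(cos θ)(1_{0<θ<ε} + 1_{π-ε<θ<π}) dσ`,
written via the polar-angle parametrization of the sphere. -/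
def phiAng (b : ℝ → ℝ) (ε : ℝ) : ℝ :=
  2 * π * ((∫ θ in (0:ℝ)..ε, b (Real.cos θ) * Real.sin θ)
    + ∫ θ in (π - ε)..π, b (Real.cos θ) * Real.sin θ)

/-- Weighted `L¹` norm `‖f‖_{1,s} = ∫ |f(v)| (1+|v|²)^{s/2} dv`. -/
def wnorm (s : ℝ) (f : R3 → ℝ) : ℝ := ∫ v : R3, |f v| * (1 + ‖v‖ ^ 2) ^ (s / 2)

/-- Membership in the weighted space `L¹_s`. -/
def MemL1s (s : ℝ) (f : R3 → ℝ) : Prop :=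
  Integrable (fun v : R3 => |f v| * (1 + ‖v‖ ^ 2) ^ (s / 2))

/-- The Boltzmann–Fermi–Dirac collision operator `Q_FD(f,f)`. -/
def QFD (γ : ℝ) (b : ℝ → ℝ) (f : R3 → ℝ) (v : R3) : ℝ :=
  ∫ w : R3, ∫ σ : S2, Bker γ b v w σ *
      (f (vOut v w σ) * f (vOutStar v w σ) * (1 - f v) * (1 - f w)
        - f v * f w * (1 - f (vOut v w σ)) * (1 - f (vOutStar v w σ))) ∂sphMeasure

/-- `Q₁(f₁,f₂,f₃)(v) = ∫∫ B f₁(v') f₂(v'_*) f₃(v_*) dσ dv_*`. -/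
def Q1 (γ : ℝ) (b : ℝ → ℝ) (f₁ f₂ f₃ : R3 → ℝ) (v : R3) : ℝ :=
  ∫ w : R3, ∫ σ : S2, Bker γ b v w σ *
      (f₁ (vOut v w σ) * f₂ (vOutStar v w σ) * f₃ w) ∂sphMeasure

/-- `L_FD(f, 1-f, 1-f)(v) = ∫∫ B f(v_*)(1-f(v'))(1-f(v'_*)) dσ dv_*`. -/
def LFD (γ : ℝ) (b : ℝ → ℝ) (f : R3 → ℝ) (v : R3) : ℝ :=
  ∫ w : R3, ∫ σ : S2, Bker γ b v w σ *
      (f w * (1 - f (vOut v w σ)) * (1 - f (vOutStar v w σ))) ∂sphMeasure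

/-- The Fermi–Dirac entropy `S(f)` (with `0·ln 0 = 0`, as `Real.log 0 = 0`). -/
def entropy (f : R3 → ℝ) : ℝ :=
  -∫ v : R3, (f v * Real.log (f v) + (1 - f v) * Real.log (1 - f v))

/-- A conservative mild solution of the Boltzmann–Fermi–Dirac equation with
initial datum `f₀`. -/
structure IsFDSolution (γ : ℝ) (b : ℝ → ℝ) (f₀ : R3 → ℝ) (f : ℝ → R3 → ℝ) : Prop where
  measurable : ∀ t : ℝ, Measurable (f t)
  nonneg : ∀ t : ℝ, 0 ≤ t → ∀ v : R3, 0 ≤ f t v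
  le_one : ∀ t : ℝ, 0 ≤ t → ∀ v : R3, f t v ≤ 1
  memL12 : ∀ t : ℝ, 0 ≤ t → MemL1s 2 (f t)
  contL12 : ∀ t : ℝ, 0 ≤ t → ∀ ε : ℝ, 0 < ε → ∃ δ > 0, ∀ s : ℝ, 0 ≤ s →
      |s - t| < δ → wnorm 2 (fun v => f s v - f t v) < ε
  mild : ∃ Z : Set R3, volume Z = 0 ∧ ∀ t : ℝ, 0 ≤ t → ∀ v : R3, v ∉ Z →
      f t v = f₀ v + ∫ τ in (0:ℝ)..t, QFD γ b (f τ) v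
  mass : ∀ t : ℝ, 0 ≤ t → ∫ v : R3, f t v = ∫ v : R3, f₀ v
  momentum : ∀ t : ℝ, 0 ≤ t → ∫ v : R3, f t v • v = ∫ v : R3, f₀ v • v
  energy : ∀ t : ℝ, 0 ≤ t → ∫ v : R3, f t v * ‖v‖ ^ 2 = ∫ v : R3, f₀ v * ‖v‖ ^ 2

open scoped ENNReal

instance instFiniteSph : IsFiniteMeasure sphMeasure := by unfold sphMeasure; infer_instance

lemma finrank_R3 : Module.finrank ℝ R3 = 3 := by simp

lemma norm_S2 (σ : S2) : ‖(σ : R3)‖ = 1 := by simp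

/-- A fixed point of the sphere. -/
def e0 : S2 := ⟨EuclideanSpace.single 0 1, by simp⟩

/-- Normalisation of a vector. -/
def nrm (z : R3) : S2 := ⟨if z = 0 then (e0 : R3) else ‖z‖⁻¹ • z, by
  split_ifs with h
  · exact e0.2
  · simp [norm_smul, h]⟩

lemma nrm_coe {z : R3} (h : z ≠ 0) : (nrm z : R3) = ‖z‖⁻¹ • z := by simp [nrm, h]

lemma nrm_smul {r : ℝ} (hr : 0 < r) (ω : S2) : nrm (r • (ω : R3)) = ω := by
  have h : (ω : R3) ≠ 0 := by
    intro h; have := norm_S2 ω; rw [h] at this; simp at this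
  apply Subtype.ext
  rw [nrm_coe (by simp [hr.ne', h]), norm_smul, norm_S2, smul_smul]
  simp [abs_of_pos hr, hr.ne']

lemma measurable_nrm : Measurable nrm := by
  apply Measurable.subtype_mk
  apply Measurable.ite (measurableSet_eq) measurable_const
  fun_prop

/-- Polar coordinates in `ℝ³`. -/
lemma lintegral_polar (G : R3 → ℝ≥0∞) :
    ∫⁻ z, G z = ∫⁻ p : S2 × Ioi (0:ℝ), G ((p.2:ℝ) • (p.1:R3))
      ∂(sphMeasure.prod (Measure.volumeIoiPow 2)) := by
  have h := (volume : Measure R3).measurePreserving_homeomorphUnitSphereProd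
  rw [finrank_R3] at h
  have h2 := h.lintegral_comp_emb (Homeomorph.measurableEmbedding _)
    (fun p => G ((p.2:ℝ) • (p.1:R3)))
  unfold sphMeasure
  rw [← h2]
  have h3 : ∀ a : ({(0)}ᶜ : Set R3), G (((homeomorphUnitSphereProd R3 a).2:ℝ) •
      ((homeomorphUnitSphereProd R3 a).1:R3)) = G a := by
    intro a
    rw [← homeomorphUnitSphereProd_symm_apply_coe]; simp
  simp_rw [h3]
  rw [lintegral_subtype_comap (measurableSet_singleton _).compl G, restrict_compl_singleton]

/-- The exchange of directions. -/
def Smap (p : R3 × S2) : R3 × S2 := (‖p.1‖ • (p.2 : R3), nrm p.1)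

lemma measurable_Smap : Measurable Smap := by
  unfold Smap
  have := measurable_nrm
  fun_prop

lemma Smap_preserving : MeasurePreserving Smap ((volume : Measure R3).prod sphMeasure)
    ((volume : Measure R3).prod sphMeasure) := by
  refine ⟨measurable_Smap, ?_⟩
  have key : ∀ F : R3 × S2 → ℝ≥0∞, Measurable F →
      ∫⁻ p, F (Smap p) ∂((volume : Measure R3).prod sphMeasure)
        = ∫⁻ p, F p ∂((volume : Measure R3).prod sphMeasure) := by
    intro F hF
    have hFS : Measurable fun p => F (Smap p) := hF.comp measurable_Smap
    rw [lintegral_prod _ hFS.aemeasurable, lintegral_prod _ hF.aemeasurable,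
      lintegral_polar, lintegral_polar]
    have e1 : ∀ (p : S2 × Ioi (0:ℝ)) (σ : S2), Smap ((p.2:ℝ) • (p.1:R3), σ)
        = ((p.2:ℝ) • (σ:R3), p.1) := by
      intro p σ
      have hp : (0:ℝ) < p.2 := p.2.2
      simp [Smap, norm_smul, nrm_smul hp, abs_of_pos hp]
    simp_rw [e1]
    rw [lintegral_prod, lintegral_prod]
    · simp only
      have m1 : Measurable (fun q : (S2 × Ioi (0:ℝ)) × S2 => F ((q.1.2:ℝ) • (q.2:R3), q.1.1)) := by
        fun_prop
      have m2 : Measurable (fun q : (S2 × Ioi (0:ℝ)) × S2 => F ((q.1.2:ℝ) • (q.1.1:R3), q.2)) := by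
        fun_prop
      have s1 : ∀ ω : S2, ∫⁻ y : Ioi (0:ℝ), ∫⁻ σ : S2, F ((y:ℝ) • (σ:R3), ω) ∂sphMeasure
          ∂(Measure.volumeIoiPow 2) = ∫⁻ σ : S2, ∫⁻ y : Ioi (0:ℝ), F ((y:ℝ) • (σ:R3), ω)
          ∂(Measure.volumeIoiPow 2) ∂sphMeasure := by
        intro ω
        rw [lintegral_lintegral_swap]
        apply Measurable.aemeasurable
        unfold Function.uncurry
        fun_prop
      simp_rw [s1]
      rw [lintegral_lintegral_swap]
      · congr 1; ext σ
        rw [lintegral_lintegral_swap]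
        apply Measurable.aemeasurable
        unfold Function.uncurry
        fun_prop
      · apply Measurable.aemeasurable
        have : Measurable (fun q : (S2 × S2) × Ioi (0:ℝ) => F ((q.2:ℝ) • (q.1.2:R3), q.1.1)) := by
          fun_prop
        exact this.lintegral_prod_right'
    · apply Measurable.aemeasurable
      have m2 : Measurable (fun q : (S2 × Ioi (0:ℝ)) × S2 => F ((q.1.2:ℝ) • (q.1.1:R3), q.2)) := by
        fun_prop
      exact m2.lintegral_prod_right'
    · apply Measurable.aemeasurable
      have m1 : Measurable (fun q : (S2 × Ioi (0:ℝ)) × S2 => F ((q.1.2:ℝ) • (q.2:R3), q.1.1)) := by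
        fun_prop
      exact m1.lintegral_prod_right'
  ext s hs
  have := key (s.indicator 1) (measurable_one.indicator hs)
  rw [lintegral_indicator_one hs] at this
  rw [← this, Measure.map_apply measurable_Smap hs, ← lintegral_indicator_one (measurable_Smap hs)]
  rfl

/-- The collision transformation. -/
def Tmap (p : R3 × (R3 × S2)) : R3 × (R3 × S2) :=
  (vOut p.1 p.2.1 p.2.2, (vOutStar p.1 p.2.1 p.2.2, nrm (p.1 - p.2.1)))

/-- The reference measure on the collision space. -/
def Pm : Measure (R3 × (R3 × S2)) := (volume : Measure R3).prod ((volume : Measure R3).prod sphMeasure)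

instance instSFinitePm : SigmaFinite Pm := by
  unfold Pm
  haveI : SigmaFinite sphMeasure := IsFiniteMeasure.toSigmaFinite _
  exact Measure.prod.instSigmaFinite

lemma shear_preserving (c : ℝ) : MeasurePreserving (fun p : R3 × R3 => (p.1, p.2 + c • p.1))
    (volume.prod volume) (volume.prod volume) := by
  apply MeasurePreserving.skew_product (MeasurePreserving.id _)
    (g := fun (z w : R3) => w + c • z)
  · unfold Function.uncurry; fun_prop
  · filter_upwards with z
    exact map_add_right_eq_self _ _

lemma cm_preserving : MeasurePreserving (fun p : R3 × R3 => ((2⁻¹ : ℝ) • (p.1 + p.2), p.1 - p.2))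
    (volume.prod volume) (volume.prod volume) := by
  have h := Measure.measurePreserving_swap.comp ((shear_preserving 2⁻¹).comp
    (measurePreserving_sub_prod (volume : Measure R3) volume))
  convert h using 2
  rename_i p
  simp only [Function.comp, Prod.swap]
  congr 1
  module

lemma cm_inv_preserving : MeasurePreserving
    (fun p : R3 × R3 => (p.1 + (2⁻¹ : ℝ) • p.2, p.1 - (2⁻¹ : ℝ) • p.2))
    (volume.prod volume) (volume.prod volume) := by
  have h := (measurePreserving_add_prod (volume : Measure R3) volume).comp
    ((shear_preserving (-2⁻¹)).comp Measure.measurePreserving_swap)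
  convert h using 2
  rename_i p
  simp only [Function.comp, Prod.swap]
  congr 1 <;> module

lemma measurable_Tmap : Measurable Tmap := by
  unfold Tmap vOut vOutStar
  have := measurable_nrm
  fun_prop

lemma Tmap_preserving : MeasurePreserving Tmap Pm Pm := by
  have hA := (measurePreserving_prodAssoc (volume : Measure R3) volume sphMeasure).comp
    ((cm_preserving.prod (MeasurePreserving.id sphMeasure)).comp
      (measurePreserving_prodAssoc (volume : Measure R3) volume sphMeasure).symm)
  have hB := (measurePreserving_prodAssoc (volume : Measure R3) volume sphMeasure).comp
    ((cm_inv_preserving.prod (MeasurePreserving.id sphMeasure)).comp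
      (measurePreserving_prodAssoc (volume : Measure R3) volume sphMeasure).symm)
  have h := hB.comp (((MeasurePreserving.id (volume : Measure R3)).prod Smap_preserving).comp hA)
  unfold Pm
  convert h using 1
  funext p
  obtain ⟨v, w, σ⟩ := p
  simp only [Tmap, vOut, vOutStar, Function.comp, MeasurableEquiv.prodAssoc, Smap, Prod.map, id,
    MeasurableEquiv.symm, Equiv.prodAssoc, MeasurableEquiv.coe_mk, Equiv.coe_fn_mk,
    Equiv.symm, Equiv.coe_fn_symm_mk, smul_smul]
  simp only [div_eq_inv_mul]

/-- Exchange of the particles. -/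
def Wmap (p : R3 × (R3 × S2)) : R3 × (R3 × S2) := (p.2.1, (p.1, p.2.2))

lemma Wmap_preserving : MeasurePreserving Wmap Pm Pm := by
  have h := (measurePreserving_prodAssoc (volume : Measure R3) volume sphMeasure).comp
    ((Measure.measurePreserving_swap.prod (MeasurePreserving.id sphMeasure)).comp
      (measurePreserving_prodAssoc (volume : Measure R3) volume sphMeasure).symm)
  exact h

lemma vOut_sub (v w : R3) (σ : S2) : vOut v w σ - vOutStar v w σ = ‖v - w‖ • (σ : R3) := by
  simp only [vOut, vOutStar]; module

lemma vOut_add (v w : R3) (σ : S2) : vOut v w σ + vOutStar v w σ = v + w := by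
  simp only [vOut, vOutStar]; module

lemma norm_vOut_sub (v w : R3) (σ : S2) : ‖vOut v w σ - vOutStar v w σ‖ = ‖v - w‖ := by
  rw [vOut_sub, norm_smul, norm_S2]; simp

lemma vOut_def' (v w : R3) (σ : S2) :
    vOut v w σ = (2⁻¹ : ℝ) • (v + w) + (‖v - w‖ / 2) • (σ : R3) := rfl

lemma vOutStar_def' (v w : R3) (σ : S2) :
    vOutStar v w σ = (2⁻¹ : ℝ) • (v + w) - (‖v - w‖ / 2) • (σ : R3) := rfl

lemma vOut_T {v w : R3} (h : v ≠ w) (σ : S2) :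
    vOut (vOut v w σ) (vOutStar v w σ) (nrm (v - w)) = v := by
  have h' : v - w ≠ 0 := sub_ne_zero.2 h
  have hn : ‖v - w‖ ≠ 0 := norm_ne_zero_iff.2 h'
  rw [vOut_def' (vOut v w σ), vOut_add, norm_vOut_sub, nrm_coe h', smul_smul,
    show ‖v - w‖ / 2 * ‖v - w‖⁻¹ = 2⁻¹ by field_simp]
  module

lemma vOutStar_T {v w : R3} (h : v ≠ w) (σ : S2) :
    vOutStar (vOut v w σ) (vOutStar v w σ) (nrm (v - w)) = w := by
  have h' : v - w ≠ 0 := sub_ne_zero.2 h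
  have hn : ‖v - w‖ ≠ 0 := norm_ne_zero_iff.2 h'
  rw [vOutStar_def' (vOut v w σ), vOut_add, norm_vOut_sub, nrm_coe h', smul_smul,
    show ‖v - w‖ / 2 * ‖v - w‖⁻¹ = 2⁻¹ by field_simp]
  module

lemma cosAngle_T {v w : R3} (h : v ≠ w) (σ : S2) :
    cosAngle (vOut v w σ) (vOutStar v w σ) (nrm (v - w)) = cosAngle v w σ := by
  have h' : v - w ≠ 0 := sub_ne_zero.2 h
  have hn : ‖v - w‖ ≠ 0 := norm_ne_zero_iff.2 h'
  unfold cosAngle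
  rw [norm_vOut_sub, vOut_sub, nrm_coe h', smul_smul, inv_mul_cancel₀ hn, one_smul,
    real_inner_comm]

lemma Bker_T (γ : ℝ) (b : ℝ → ℝ) {v w : R3} (h : v ≠ w) (σ : S2) :
    Bker γ b (vOut v w σ) (vOutStar v w σ) (nrm (v - w)) = Bker γ b v w σ := by
  unfold Bker
  rw [cosAngle_T h, norm_vOut_sub]

lemma vOut_comm (v w : R3) (σ : S2) : vOut w v σ = vOut v w σ := by
  unfold vOut; rw [add_comm w v, norm_sub_rev w v]

lemma vOutStar_comm (v w : R3) (σ : S2) : vOutStar w v σ = vOutStar v w σ := by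
  unfold vOutStar; rw [add_comm w v, norm_sub_rev w v]

lemma cosAngle_comm (v w : R3) (σ : S2) : cosAngle w v σ = - cosAngle v w σ := by
  unfold cosAngle; rw [norm_sub_rev w v, ← inner_neg_left, ← smul_neg, neg_sub]

lemma cosAngle_eq {v w : R3} (h : v ≠ w) (σ : S2) :
    cosAngle v w σ = ⟪(nrm (v - w) : R3), (σ : R3)⟫ := by
  rw [nrm_coe (sub_ne_zero.2 h)]; rfl

lemma inner_S2_abs (k σ : S2) : |⟪(k : R3), (σ : R3)⟫| ≤ 1 := by
  have := abs_real_inner_le_norm (k : R3) (σ : R3)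
  rwa [norm_S2, norm_S2, one_mul] at this

lemma b_neg {b : ℝ → ℝ} (hb : GradCutoff b) {x : ℝ} (hx : |x| ≤ 1) : b (-x) = b x := by
  have := hb.symm (Real.arccos x)
  rw [abs_le] at hx
  rwa [Real.cos_pi_sub, Real.cos_arccos hx.1 hx.2] at this

lemma cosAngle_abs (v w : R3) (σ : S2) : |cosAngle v w σ| ≤ 1 := by
  by_cases h : v = w
  · simp [cosAngle, h]
  · rw [cosAngle_eq h]; exact inner_S2_abs _ _

lemma Bker_comm (γ : ℝ) {b : ℝ → ℝ} (hb : GradCutoff b) (v w : R3) (σ : S2) :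
    Bker γ b w v σ = Bker γ b v w σ := by
  unfold Bker
  rw [cosAngle_comm, b_neg hb (cosAngle_abs _ _ _), norm_sub_rev]

lemma Bker_nonneg (γ : ℝ) {b : ℝ → ℝ} (hb : GradCutoff b) (v w : R3) (σ : S2) :
    0 ≤ Bker γ b v w σ := mul_nonneg (Real.rpow_nonneg (norm_nonneg _) _) (hb.nonneg _)

lemma measurable_cosAngle : Measurable (fun p : R3 × (R3 × S2) => cosAngle p.1 p.2.1 p.2.2) := by
  unfold cosAngle; fun_prop

lemma measurable_Bker (γ : ℝ) {b : ℝ → ℝ} (hb : GradCutoff b) :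
    Measurable (fun p : R3 × (R3 × S2) => Bker γ b p.1 p.2.1 p.2.2) := by
  unfold Bker
  have h1 := hb.measurable.comp measurable_cosAngle
  have h2 : Measurable (fun p : R3 × (R3 × S2) => ‖p.1 - p.2.1‖ ^ γ) := by fun_prop
  exact h2.mul h1

lemma ae_ne (v : R3) : ∀ᵐ w : R3, v ≠ w := by
  have : (volume : Measure R3) {v} = 0 := measure_singleton v
  rw [ae_iff]
  convert this using 2
  ext w; simp [eq_comm]

lemma Pm_ae_ne : ∀ᵐ p ∂Pm, p.1 ≠ p.2.1 := by
  unfold Pm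
  have hm : MeasurableSet {p : R3 × (R3 × S2) | p.1 ≠ p.2.1} :=
    (measurableSet_eq_fun (by fun_prop) (by fun_prop)).compl
  rw [Measure.ae_prod_iff_ae_ae hm]
  filter_upwards with v
  have hm2 : MeasurableSet {p : R3 × S2 | v ≠ p.1} :=
    (measurableSet_eq_fun (by fun_prop) (by fun_prop)).compl
  rw [Measure.ae_prod_iff_ae_ae hm2]
  filter_upwards [ae_ne v] with w hw
  simp [hw]

/-- Splitting of `ℝ³` in coordinates. -/
lemma split_preserving : MeasurePreserving (fun x : R3 => (x 0, (x 1, x 2)))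
    (volume : Measure R3) ((volume : Measure ℝ).prod ((volume : Measure ℝ).prod volume)) := by
  have h1 := PiLp.volume_preserving_ofLp (Fin 3)
  have h2 := volume_preserving_piFinSuccAbove (fun _ : Fin 3 => ℝ) 0
  have h3 := volume_preserving_piFinTwo (fun _ : Fin 2 => ℝ)
  have h := (((MeasurePreserving.id (volume : Measure ℝ)).prod h3).comp h2).comp h1
  exact h

lemma norm_R3_sq (x : R3) : ‖x‖ ^ 2 = x 0 ^ 2 + (x 1 ^ 2 + x 2 ^ 2) := by
  rw [EuclideanSpace.norm_sq_eq, Fin.sum_univ_three]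
  simp only [Real.norm_eq_abs, sq_abs]; ring

lemma lintegral_polar2 (f : ℝ × ℝ → ℝ≥0∞) (hf : Measurable f) : ∫⁻ p, f p = 
    ∫⁻ r in Ioi (0:ℝ), ∫⁻ θ in Ioo (-π) π, ENNReal.ofReal r * f (r * cos θ, r * sin θ) := by
  rw [← lintegral_comp_polarCoord_symm]
  simp only [polarCoord_target, polarCoord_symm_apply, smul_eq_mul]
  rw [Measure.volume_eq_prod, ← Measure.prod_restrict, lintegral_prod]
  apply Measurable.aemeasurable
  fun_prop

lemma zonal_e0_aux (g : ℝ → ℝ≥0∞) (hg : Measurable g) :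
    ∫⁻ x : R3, (if ‖x‖ < 1 then g (x 0 / ‖x‖) else 0) =
      ENNReal.ofReal (2 * π) * (∫⁻ r in Ioi (0:ℝ), ENNReal.ofReal (r ^ 2) * (if r < 1 then 1 else 0)) *
        ∫⁻ θ in Ioo 0 π, g (cos θ) * ENNReal.ofReal (sin θ) := by
  let N : ℝ × ℝ × ℝ → ℝ := fun p => √ (p.1 ^ 2 + (p.2.1 ^ 2 + p.2.2 ^ 2))
  have hN : Measurable N := by fun_prop
  let G : ℝ × ℝ × ℝ → ℝ≥0∞ := fun p => if N p < 1 then g (p.1 / N p) else 0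
  have hG : Measurable G := by
    apply Measurable.ite (measurableSet_lt hN measurable_const) _ measurable_const
    fun_prop
  have h1 : ∫⁻ x : R3, (if ‖x‖ < 1 then g (x 0 / ‖x‖) else 0) = ∫⁻ p, G p := by
    rw [Measure.volume_eq_prod, Measure.volume_eq_prod, ← split_preserving.lintegral_comp hG]
    congr 1; ext x
    simp only [G, N]
    rw [← norm_R3_sq, Real.sqrt_sq (norm_nonneg _)]
  let n : ℝ × ℝ → ℝ := fun p => √ (p.1 ^ 2 + p.2 ^ 2)
  let H : ℝ × ℝ → ℝ≥0∞ := fun p => if 0 < p.2 then ENNReal.ofReal (2 * π) * (ENNReal.ofReal p.2 * 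
    (if n p < 1 then g (p.1 / n p) else 0)) else 0
  have hn : Measurable n := by fun_prop
  have hH : Measurable H := by
    apply Measurable.ite (measurableSet_lt measurable_const (by fun_prop)) _ measurable_const
    have : Measurable fun a => if n a < 1 then g (a.1 / n a) else 0 := 
      Measurable.ite (measurableSet_lt hn measurable_const) (by fun_prop) measurable_const
    fun_prop
  have h2 : ∫⁻ p, G p = ∫⁻ p, H p := by
    rw [Measure.volume_eq_prod, lintegral_prod _ hG.aemeasurable, 
      Measure.volume_eq_prod, lintegral_prod _ hH.aemeasurable]
    congr 1; ext u
    rw [← Measure.volume_eq_prod, lintegral_polar2 _ (by fun_prop)]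
    have : ∀ r : ℝ, H (u, r) = (Ioi (0:ℝ)).indicator (fun r => ENNReal.ofReal (2 * π) * 
      (ENNReal.ofReal r * (if n (u, r) < 1 then g (u / n (u, r)) else 0))) r := by
      intro r; simp [H, indicator]
    simp_rw [this]
    rw [lintegral_indicator measurableSet_Ioi]
    congr 1; ext r
    have e : ∀ θ, G (u, (r * cos θ, r * sin θ)) = (if n (u, r) < 1 then g (u / n (u, r)) else 0) := by
      intro θ
      have : N (u, (r * cos θ, r * sin θ)) = n (u, r) := by
        simp only [N, n]; congr 2
        have := Real.sin_sq_add_cos_sq θ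
        linear_combination r ^ 2 * this
      simp only [G, this]
    simp_rw [e]
    rw [setLIntegral_const, Real.volume_Ioo, mul_comm]
    congr 2; ring
  rw [h1, h2, lintegral_polar2 _ hH]
  have h3 : ∀ r ∈ Ioi (0:ℝ), ∫⁻ θ in Ioo (-π) π, ENNReal.ofReal r * H (r * cos θ, r * sin θ)
     = ENNReal.ofReal (2 * π) * (ENNReal.ofReal (r ^ 2) * (if r < 1 then 1 else 0)) *
        ∫⁻ θ in Ioo 0 π, g (cos θ) * ENNReal.ofReal (sin θ) := by
    intro r hr
    have hr' : (0:ℝ) < r := hr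
    rw [← lintegral_const_mul _ (by fun_prop), ← lintegral_indicator measurableSet_Ioo,
      ← lintegral_indicator measurableSet_Ioo]
    congr 1; ext θ
    have hnn : n (r * cos θ, r * sin θ) = r := by
      simp only [n]
      rw [show (r * cos θ) ^ 2 + (r * sin θ) ^ 2 = r ^ 2 by
        linear_combination r ^ 2 * Real.sin_sq_add_cos_sq θ, Real.sqrt_sq hr'.le]
    have hc : r * cos θ / r = cos θ := by field_simp
    by_cases hθ : θ ∈ Ioo 0 π
    · have hs : 0 < sin θ := Real.sin_pos_of_pos_of_lt_pi hθ.1 hθ.2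
      have hθ' : θ ∈ Ioo (-π) π := ⟨by linarith [hθ.1, Real.pi_pos], hθ.2⟩
      simp only [indicator_of_mem hθ, indicator_of_mem hθ', H, hnn, hc, mul_pos hr' hs, if_true]
      rw [ENNReal.ofReal_mul hr'.le, ENNReal.ofReal_pow hr'.le]
      split_ifs
      · ring
      · simp
    · rw [indicator_of_notMem hθ]
      by_cases hθ' : θ ∈ Ioo (-π) π
      · have : θ ≤ 0 := by
          by_contra h; exact hθ ⟨not_le.1 h, hθ'.2⟩
        have hs : sin θ ≤ 0 := Real.sin_nonpos_of_nonpos_of_neg_pi_le this hθ'.1.le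
        rw [indicator_of_mem hθ']
        have : ¬ (0 < r * sin θ) := not_lt.2 (mul_nonpos_of_nonneg_of_nonpos hr'.le hs)
        simp [H, this]
      · rw [indicator_of_notMem hθ']
  rw [setLIntegral_congr_fun measurableSet_Ioi h3, lintegral_mul_const, lintegral_const_mul]
  · apply Measurable.mul (by fun_prop)
    exact Measurable.ite measurableSet_Iio measurable_const measurable_const
  · apply Measurable.const_mul
    apply Measurable.mul (by fun_prop)
    exact Measurable.ite measurableSet_Iio measurable_const measurable_const

lemma third_integral : ∫⁻ r in Ioi (0:ℝ), ENNReal.ofReal (r ^ 2) * (if r < 1 then 1 else 0)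
    = ENNReal.ofReal (1/3) := by
  have : ∀ r : ℝ, ENNReal.ofReal (r ^ 2) * (if r < 1 then 1 else 0) =
      (Iio (1:ℝ)).indicator (fun r => ENNReal.ofReal (r ^ 2)) r := by
    intro r; simp [indicator]
  simp_rw [this]
  rw [lintegral_indicator measurableSet_Iio, Measure.restrict_restrict measurableSet_Iio,
    inter_comm, Ioi_inter_Iio, ← ofReal_integral_eq_lintegral_ofReal]
  · rw [← integral_Ioc_eq_integral_Ioo, ← intervalIntegral.integral_of_le zero_le_one, integral_pow]
    norm_num
  · exact (continuous_pow 2).integrableOn_Icc.mono_set Ioo_subset_Icc_self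
  · filter_upwards with r using sq_nonneg r

/-- The zonal measure. -/
def zon (g : ℝ → ℝ≥0∞) : ℝ≥0∞ :=
  ENNReal.ofReal (2 * π) * ∫⁻ θ in Ioo 0 π, g (cos θ) * ENNReal.ofReal (sin θ)

lemma zonal (k : S2) (g : ℝ → ℝ≥0∞) (hg : Measurable g) :
    ∫⁻ σ : S2, g ⟪(k : R3), (σ : R3)⟫ ∂sphMeasure = zon g := by
  have hvol : (Measure.volumeIoiPow 2) {r : Ioi (0:ℝ) | (r:ℝ) < 1} = ENNReal.ofReal (1/3) := by
    have := Measure.volumeIoiPow_apply_Iio 2 ⟨1, by simp⟩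
    norm_num at this
    exact this
  have hA : ∫⁻ x : R3, (if ‖x‖ < 1 then g (⟪(k : R3), x⟫ / ‖x‖) else 0)
      = (∫⁻ σ : S2, g ⟪(k : R3), (σ : R3)⟫ ∂sphMeasure) * ENNReal.ofReal (1/3) := by
    rw [lintegral_polar]
    have e : ∀ p : S2 × Ioi (0:ℝ), (if ‖(p.2:ℝ) • (p.1:R3)‖ < 1 then
        g (⟪(k : R3), (p.2:ℝ) • (p.1:R3)⟫ / ‖(p.2:ℝ) • (p.1:R3)‖) else 0) =
        g ⟪(k : R3), (p.1 : R3)⟫ * ({r : Ioi (0:ℝ) | (r:ℝ) < 1}.indicator 1 p.2) := by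
      intro p
      have hp : (0:ℝ) < p.2 := p.2.2
      rw [norm_smul, norm_S2, real_inner_smul_right, Real.norm_eq_abs, abs_of_pos hp, mul_one,
        mul_div_cancel_left₀ _ hp.ne']
      simp [indicator]
    simp_rw [e]
    have ms : MeasurableSet {r : Ioi (0:ℝ) | (r:ℝ) < 1} :=
      measurableSet_lt (by fun_prop) (by fun_prop)
    rw [lintegral_prod_mul (f := fun σ : S2 => g ⟪(k : R3), (σ : R3)⟫)
      (g := {r : Ioi (0:ℝ) | (r:ℝ) < 1}.indicator 1), lintegral_indicator_one ms, hvol]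
    · fun_prop
    · exact (measurable_one.indicator ms).aemeasurable
  have hB : ∫⁻ x : R3, (if ‖x‖ < 1 then g (⟪(k : R3), x⟫ / ‖x‖) else 0) =
     ∫⁻ x : R3, (if ‖x‖ < 1 then g (x 0 / ‖x‖) else 0) := by
    let ρ := (ℝ ∙ ((k : R3) - (e0 : R3)))ᗮ.reflection
    have hρ : ρ (k : R3) = e0 := Submodule.reflection_sub (by rw [norm_S2, norm_S2])
    have hm := ρ.measurePreserving
    have hmeas : Measurable fun x : R3 => (if ‖x‖ < 1 then g (x 0 / ‖x‖) else 0) := by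
      apply Measurable.ite (measurableSet_lt (by fun_prop) (by fun_prop)) _ measurable_const
      fun_prop
    rw [← hm.lintegral_comp hmeas]
    congr 1; ext x
    have : (ρ x) 0 = ⟪(k : R3), x⟫ := by
      rw [← ρ.inner_map_map, hρ]
      simp [e0, EuclideanSpace.inner_single_left]
    rw [ρ.norm_map, this]
  have h3 := hA.symm.trans (hB.trans (zonal_e0_aux g hg))
  rw [third_integral] at h3
  have h0 : ENNReal.ofReal (1/3) ≠ 0 := by simp
  rw [mul_right_comm] at h3
  exact (ENNReal.mul_left_inj h0 ENNReal.ofReal_ne_top).1 h3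

lemma zon_b_lt_top {b : ℝ → ℝ} (hb : GradCutoff b) : zon (fun c => ENNReal.ofReal (b c)) < ∞ := by
  unfold zon
  apply ENNReal.mul_lt_top ENNReal.ofReal_lt_top
  have h := hb.integrable
  rw [intervalIntegrable_iff_integrableOn_Ioo_of_le Real.pi_pos.le] at h
  have h2 := h.lintegral_lt_top
  simpa only [ENNReal.ofReal_mul (hb.nonneg _)] using h2

lemma zon_b_pos {b : ℝ → ℝ} (hb : GradCutoff b) : 0 < zon (fun c => ENNReal.ofReal (b c)) := by
  unfold zon
  apply ENNReal.mul_pos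
  · simp [Real.pi_pos]
  · have h := hb.integrable
    have hp := hb.pos
    rw [intervalIntegrable_iff_integrableOn_Ioo_of_le Real.pi_pos.le] at h
    rw [intervalIntegral.integral_of_le Real.pi_pos.le, integral_Ioc_eq_integral_Ioo,
      integral_eq_lintegral_of_nonneg_ae _ h.1] at hp
    · intro h0
      have e : ∫⁻ θ in Ioo 0 π, ENNReal.ofReal (b (cos θ) * sin θ) = 0 := by
        rw [← h0]; congr 1; ext θ
        rw [ENNReal.ofReal_mul (hb.nonneg _)]
      rw [e] at hp; simp at hp
    · filter_upwards [ae_restrict_mem measurableSet_Ioo] with θ hθ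
      exact mul_nonneg (hb.nonneg _) (Real.sin_pos_of_pos_of_lt_pi hθ.1 hθ.2).le

lemma zon_mono {g h : ℝ → ℝ≥0∞} (H : ∀ c, g c ≤ h c) : zon g ≤ zon h := by
  unfold zon; gcongr; exact H _

/-- A bounded, angularly truncated part of `b`. -/
def btr (b : ℝ → ℝ) (δ N : ℝ) (c : ℝ) : ℝ≥0∞ :=
  if δ ≤ 1 - c ^ 2 then ENNReal.ofReal (min (b c) N) else 0

lemma measurable_btr {b : ℝ → ℝ} (hb : Measurable b) (δ N : ℝ) : Measurable (btr b δ N) := by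
  unfold btr
  apply Measurable.ite (measurableSet_le (by fun_prop) (by fun_prop)) _ measurable_const
  fun_prop

lemma exists_btr {b : ℝ → ℝ} (hb : GradCutoff b) : ∃ δ N : ℝ, 0 < δ ∧ δ ≤ 1 ∧ 0 ≤ N ∧
    0 < zon (btr b δ N) := by
  by_contra! hcon
  have hm : ∀ n : ℕ, Measurable (btr b (1 / ((n:ℝ) + 1)) n) :=
    fun n => measurable_btr hb.measurable _ _
  have h0 : ∀ n : ℕ, zon (btr b (1 / ((n:ℝ) + 1)) n) = 0 := by
    intro n
    have hn : (0:ℝ) ≤ n := Nat.cast_nonneg n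
    refine le_antisymm (hcon _ _ (by positivity) ?_ (Nat.cast_nonneg n)) zero_le
    rw [div_le_one (by positivity)]; linarith
  have h1 : ∀ n : ℕ, ∀ᵐ θ ∂(volume.restrict (Ioo 0 π)),
      btr b (1 / ((n:ℝ) + 1)) n (cos θ) * ENNReal.ofReal (sin θ) = 0 := by
    intro n
    have := h0 n
    unfold zon at this
    rw [mul_eq_zero] at this
    rcases this with h | h
    · simp at h; linarith [Real.pi_pos]
    · rw [lintegral_eq_zero_iff] at h
      · exact h
      · have := hm n
        fun_prop
  rw [← ae_all_iff] at h1
  have h2 : zon (fun c => ENNReal.ofReal (b c)) = 0 := by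
    unfold zon
    rw [mul_eq_zero]; right
    rw [lintegral_eq_zero_iff]
    · filter_upwards [h1, ae_restrict_mem measurableSet_Ioo] with θ hθ hm
      have hs := Real.sin_pos_of_pos_of_lt_pi hm.1 hm.2
      obtain ⟨n, hn⟩ := exists_nat_ge (max (b (cos θ)) (1 / sin θ ^ 2))
      have := hθ n
      have hs2 : 0 < sin θ ^ 2 := by positivity
      have hc : 1 / ((n:ℝ) + 1) ≤ 1 - cos θ ^ 2 := by
        rw [← Real.sin_sq, div_le_iff₀ (by positivity)]
        have h5 : 1 / sin θ ^ 2 ≤ n := (le_max_right _ _).trans hn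
        rw [div_le_iff₀ hs2] at h5
        nlinarith
      rw [btr, if_pos hc, min_eq_left ((le_max_left _ _).trans hn)] at this
      exact this
    · have := hb.measurable
      fun_prop
  exact (zon_b_pos hb).ne' h2

lemma zon_cap (ε : ℝ≥0∞) (hε : 0 < ε) : ∃ η : ℝ, 0 < η ∧
    zon ({c : ℝ | 1 - c ^ 2 ≤ η}.indicator 1) ≤ ε := by
  let f : ℝ → ℝ := fun c => 1 - c ^ 2
  let κ := sphMeasure.map (fun σ : S2 => ⟪(e0 : R3), (σ : R3)⟫)
  have hms : ∀ η : ℝ, MeasurableSet {c : ℝ | 1 - c ^ 2 ≤ η} :=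
    fun η => measurableSet_le (by fun_prop) (by fun_prop)
  have hk : ∀ η, zon ({c : ℝ | 1 - c ^ 2 ≤ η}.indicator 1) = κ {c : ℝ | 1 - c ^ 2 ≤ η} := by
    intro η
    rw [← zonal e0 _ (measurable_one.indicator (hms η)), ← lintegral_indicator_one (hms η)]
    rw [lintegral_map (measurable_one.indicator (hms η)) (by fun_prop)]
  have h0 : κ (⋂ n : ℕ, {c : ℝ | 1 - c ^ 2 ≤ 1 / ((n:ℝ) + 1)}) = 0 := by
    have : (⋂ n : ℕ, {c : ℝ | 1 - c ^ 2 ≤ 1 / ((n:ℝ) + 1)}) ⊆ {c : ℝ | 1 - c ^ 2 ≤ 0} := by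
      intro c hc
      simp only [mem_iInter, mem_ofPred_eq] at hc ⊢
      exact ge_of_tendsto' tendsto_one_div_add_atTop_nhds_zero_nat hc
    refine measure_mono_null this ?_
    rw [← hk]
    unfold zon
    rw [mul_eq_zero]; right
    rw [lintegral_eq_zero_iff]
    · filter_upwards [ae_restrict_mem measurableSet_Ioo] with θ hθ
      have hs := Real.sin_pos_of_pos_of_lt_pi hθ.1 hθ.2
      have : ¬ (1 - cos θ ^ 2 ≤ 0) := by
        rw [← Real.sin_sq]; have : 0 < sin θ ^ 2 := by positivity
        linarith
      rw [indicator_of_notMem (by exact this)]; simp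
    · have := (measurable_one (α := ℝ≥0∞)).indicator (hms 0)
      fun_prop
  have ht : Filter.Tendsto (fun n : ℕ => κ {c : ℝ | 1 - c ^ 2 ≤ 1 / ((n:ℝ) + 1)}) Filter.atTop
      (nhds 0) := by
    rw [← h0]
    apply tendsto_measure_iInter_atTop (fun n => (hms _).nullMeasurableSet)
    · intro i j hij c hc
      simp only [mem_ofPred_eq] at hc ⊢
      refine hc.trans ?_
      apply one_div_le_one_div_of_le (by positivity)
      have : (i:ℝ) ≤ j := Nat.cast_le.2 hij
      linarith
    · exact ⟨0, measure_ne_top _ _⟩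
  obtain ⟨n, hn⟩ := ((ENNReal.tendsto_nhds_zero.1 ht) ε hε).exists
  exact ⟨1 / ((n:ℝ) + 1), by positivity, by rw [hk]; exact hn⟩

lemma prim_cont_of {φ q : ℝ → ℝ} {a s : ℝ} (hφ : ∀ t, 0 ≤ t → φ t = a + ∫ τ in (0:ℝ)..t, q τ)
    (hs : 0 ≤ s) (hi : IntervalIntegrable q volume 0 s) : ContinuousOn φ (Icc 0 s) := by
  have h1 : ContinuousOn (fun t => ∫ τ in (0:ℝ)..t, q τ) (Icc 0 s) := by
    have := intervalIntegral.continuousOn_primitive_interval (μ := volume) (f := q) (a := 0) (b := s)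
      (by rw [uIcc_of_le hs]; rwa [integrableOn_Icc_iff_integrableOn_Ioc, 
            ← intervalIntegrable_iff_integrableOn_Ioc_of_le hs])
    rwa [uIcc_of_le hs] at this
  exact (continuousOn_const.add h1).congr (fun t ht => hφ t ht.1)

lemma prim_const_of {φ q : ℝ → ℝ} {a s t : ℝ} (hφ : ∀ t, 0 ≤ t → φ t = a + ∫ τ in (0:ℝ)..t, q τ)
    (hs : 0 ≤ s) (hi : ¬ IntervalIntegrable q volume 0 s) (hst : s ≤ t) : φ t = a := by
  have : ¬ IntervalIntegrable q volume 0 t := by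
    intro h; apply hi
    apply h.mono_set
    rw [uIcc_of_le hs, uIcc_of_le (hs.trans hst)]
    exact Icc_subset_Icc_right hst
  rw [hφ t (hs.trans hst), intervalIntegral.integral_undef this, add_zero]

lemma prim_onesided {φ q : ℝ → ℝ} {a : ℝ} (hφ : ∀ t, 0 ≤ t → φ t = a + ∫ τ in (0:ℝ)..t, q τ)
    {t : ℝ} (ht : 0 < t) : ContinuousWithinAt φ (Iic t) t ∨ ContinuousWithinAt φ (Ici t) t := by
  by_cases h : IntervalIntegrable q volume 0 t
  · left
    have := (prim_cont_of hφ ht.le h) t ⟨ht.le, le_rfl⟩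
    refine this.mono_of_mem_nhdsWithin ?_
    exact Icc_mem_nhdsLE ht
  · right
    apply (continuousWithinAt_const (b := a)).congr
    · intro s hs; exact prim_const_of hφ ht.le h hs
    · exact prim_const_of hφ ht.le h le_rfl

lemma prim_subsingleton {φ q : ℝ → ℝ} {a : ℝ} (hφ : ∀ t, 0 ≤ t → φ t = a + ∫ τ in (0:ℝ)..t, q τ) :
    {t : ℝ | 0 < t ∧ ¬ ContinuousAt φ t}.Subsingleton := by
  have key : ∀ t₁ t₂ : ℝ, 0 < t₁ → t₁ < t₂ → ¬ ContinuousAt φ t₁ → ContinuousAt φ t₂ := by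
    intro t₁ t₂ h1 h12 hn
    obtain ⟨m, hm1, hm2⟩ := exists_between h12
    have hm0 : 0 ≤ m := (h1.trans hm1).le
    have hi : ¬ IntervalIntegrable q volume 0 m := by
      intro h
      exact hn ((prim_cont_of hφ hm0 h).continuousAt (Icc_mem_nhds h1 hm1))
    have : φ =ᶠ[nhds t₂] fun _ => a := by
      filter_upwards [Ioi_mem_nhds hm2] with x hx using prim_const_of hφ hm0 hi hx.le
    exact continuousAt_const.congr this.symm
  intro t₁ h1 t₂ h2
  rcases lt_trichotomy t₁ t₂ with h | h | h
  · exact absurd (key _ _ h1.1 h h1.2) h2.2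
  · exact h
  · exact absurd (key _ _ h2.1 h h2.2) h1.2

/-- Approximation times: right for even, left for odd index. -/
def apt (k : ℕ) (t : ℝ) : ℝ := if Even k then ((⌊((k:ℝ) + 1) * t⌋₊ : ℝ) + 1) / ((k:ℝ) + 1)
  else (⌊((k:ℝ) + 1) * t⌋₊ : ℝ) / ((k:ℝ) + 1)

lemma apt_bound (k : ℕ) {t : ℝ} (ht : 0 ≤ t) : |apt k t - t| ≤ 1 / ((k:ℝ) + 1) := by
  have hk : (0:ℝ) < (k:ℝ) + 1 := by positivity
  have h1 := Nat.floor_le (mul_nonneg hk.le ht)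
  have h2 := (Nat.lt_floor_add_one (((k:ℝ) + 1) * t)).le
  have e : t = (((k:ℝ) + 1) * t) / ((k:ℝ) + 1) := by field_simp
  unfold apt
  split_ifs
  · rw [show ((⌊((k:ℝ) + 1) * t⌋₊ : ℝ) + 1) / ((k:ℝ) + 1) - t =
      ((⌊((k:ℝ) + 1) * t⌋₊ : ℝ) + 1 - ((k:ℝ) + 1) * t) / ((k:ℝ) + 1) by field_simp, abs_div,
      abs_of_pos hk]
    gcongr
    rw [abs_le]; constructor <;> linarith
  · rw [show (⌊((k:ℝ) + 1) * t⌋₊ : ℝ) / ((k:ℝ) + 1) - t =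
      ((⌊((k:ℝ) + 1) * t⌋₊ : ℝ) - ((k:ℝ) + 1) * t) / ((k:ℝ) + 1) by field_simp, abs_div,
      abs_of_pos hk]
    gcongr
    rw [abs_le]; constructor <;> linarith

lemma apt_even {k : ℕ} (hk' : Even k) {t : ℝ} : t ≤ apt k t := by
  have hk : (0:ℝ) < (k:ℝ) + 1 := by positivity
  have h2 := (Nat.lt_floor_add_one (((k:ℝ) + 1) * t)).le
  rw [apt, if_pos hk', le_div_iff₀ hk]; linarith

lemma apt_odd {k : ℕ} (hk' : ¬ Even k) {t : ℝ} (ht : 0 ≤ t) : apt k t ≤ t := by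
  have hk : (0:ℝ) < (k:ℝ) + 1 := by positivity
  have h1 := Nat.floor_le (mul_nonneg hk.le ht)
  rw [apt, if_neg hk', div_le_iff₀ hk]; linarith

lemma apt_tendsto {t : ℝ} (ht : 0 ≤ t) : Filter.Tendsto (fun k => apt k t) Filter.atTop (nhds t) := by
  rw [tendsto_iff_norm_sub_tendsto_zero]
  exact squeeze_zero (fun _ => norm_nonneg _) (fun k => apt_bound k ht)
    tendsto_one_div_add_atTop_nhds_zero_nat

lemma measurable_apt_comp {f : ℝ → R3 → ℝ} (hf : ∀ t, Measurable (f t)) (k : ℕ) :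
    Measurable (fun p : ℝ × R3 => f (apt k p.1) p.2) := by
  have h0 : ∀ c d : ℝ, Measurable (fun q : ℕ × R3 => f (((q.1:ℝ) + c) / d) q.2) := by
    intro c d
    exact measurable_from_prod_countable_right (fun n => hf (((n:ℝ) + c) / d))
  have h1 : Measurable (fun p : ℝ × R3 => (⌊((k:ℝ) + 1) * p.1⌋₊, p.2)) := by
    apply Measurable.prodMk _ measurable_snd
    exact Nat.measurable_floor.comp (by fun_prop)
  unfold apt
  split_ifs
  · exact (h0 1 _).comp h1
  · have := (h0 0 ((k:ℝ) + 1)).comp h1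
    simpa [Function.comp_def] using this

lemma joint_aemeasurable {f Q : ℝ → R3 → ℝ} {f₀ : R3 → ℝ} {Z : Set R3}
    (hf : ∀ t, Measurable (f t)) (hZ : volume Z = 0)
    (hmild : ∀ t : ℝ, 0 ≤ t → ∀ v : R3, v ∉ Z → f t v = f₀ v + ∫ τ in (0:ℝ)..t, Q τ v) :
    AEMeasurable (fun p : ℝ × R3 => f p.1 p.2) ((volume.restrict (Ioi 0)).prod volume) := by
  let h : ℕ → ℝ × R3 → ℝ := fun k p => f (apt k p.1) p.2
  have hh : ∀ k, Measurable (h k) := fun k => measurable_apt_comp hf k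
  let G : Set (ℝ × R3) := {p | ∃ l, Filter.Tendsto (fun k => h k p) Filter.atTop (nhds l)}
  have hG : MeasurableSet G := measurableSet_exists_tendsto hh
  have hv : ∀ v ∉ Z, ∀ t, 0 ≤ t → (fun t => f t v) t = f₀ v + ∫ τ in (0:ℝ)..t, Q τ v := 
    fun v hv t ht => hmild t ht v hv
  have haeZ : ∀ᵐ v : R3, v ∉ Z := measure_eq_zero_iff_ae_notMem.1 hZ
  have hGae : ∀ᵐ p ∂((volume.restrict (Ioi (0:ℝ))).prod (volume : Measure R3)), p ∈ G := by
    have h2 : ∀ᵐ q ∂((volume : Measure R3).prod (volume.restrict (Ioi (0:ℝ)))), q.swap ∈ G := by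
      rw [Measure.ae_prod_iff_ae_ae (measurable_swap hG)]
      filter_upwards [haeZ] with v hvZ
      have hc := (prim_subsingleton (hv v hvZ)).countable
      have : ∀ᵐ t : ℝ, t ∉ {t : ℝ | 0 < t ∧ ¬ ContinuousAt (fun t => f t v) t} :=
        hc.ae_notMem _
      filter_upwards [ae_restrict_of_ae this, ae_restrict_mem measurableSet_Ioi] with t ht ht0
      have hct : ContinuousAt (fun t => f t v) t := by
        by_contra hcon; exact ht ⟨ht0, hcon⟩
      exact ⟨f t v, hct.tendsto.comp (apt_tendsto (le_of_lt ht0))⟩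
    exact (Measure.measurePreserving_swap (μ := volume.restrict (Ioi (0:ℝ)))
      (ν := (volume : Measure R3))).quasiMeasurePreserving.ae h2
  refine aemeasurable_of_tendsto_metrizable_ae' (f := h) (fun k => (hh k).aemeasurable) ?_
  have e1 : ∀ᵐ p ∂((volume.restrict (Ioi (0:ℝ))).prod (volume : Measure R3)), 0 < p.1 :=
    Measure.quasiMeasurePreserving_fst.ae (ae_restrict_mem measurableSet_Ioi)
  have e2 : ∀ᵐ p ∂((volume.restrict (Ioi (0:ℝ))).prod (volume : Measure R3)), p.2 ∉ Z :=
    Measure.quasiMeasurePreserving_snd.ae haeZ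
  filter_upwards [hGae, e1, e2] with p ⟨l, hl⟩ hp0 hpZ
  suffices l = f p.1 p.2 by rw [← this]; exact hl
  have ev : Filter.Tendsto (fun n : ℕ => 2 * n) Filter.atTop Filter.atTop :=
    Filter.tendsto_atTop_mono (fun n => by simp only [id]; omega) Filter.tendsto_id
  have od : Filter.Tendsto (fun n : ℕ => 2 * n + 1) Filter.atTop Filter.atTop :=
    Filter.tendsto_atTop_mono (fun n => by simp only [id]; omega) Filter.tendsto_id
  rcases prim_onesided (hv p.2 hpZ) hp0 with hc | hc
  · refine tendsto_nhds_unique (hl.comp od) ?_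
    have hc' : Filter.Tendsto (fun t => f t p.2) _ (nhds (f p.1 p.2)) := hc
    have := hc'.comp (tendsto_nhdsWithin_iff.2 ⟨(apt_tendsto hp0.le).comp od, ?_⟩)
    · exact this
    filter_upwards with n
    exact apt_odd (by simp) hp0.le
  · refine tendsto_nhds_unique (hl.comp ev) ?_
    have hc' : Filter.Tendsto (fun t => f t p.2) _ (nhds (f p.1 p.2)) := hc
    have := hc'.comp (tendsto_nhdsWithin_iff.2 ⟨(apt_tendsto hp0.le).comp ev, ?_⟩)
    · exact this
    filter_upwards with n
    exact apt_even (by simp)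

/-- Kernel as an extended nonnegative function on the collision space. -/
def BE (γ : ℝ) (b : ℝ → ℝ) (p : R3 × (R3 × S2)) : ℝ≥0∞ := ENNReal.ofReal (Bker γ b p.1 p.2.1 p.2.2)

/-- post-collisional velocity on the collision space -/
def vo (p : R3 × (R3 × S2)) : R3 := vOut p.1 p.2.1 p.2.2

/-- post-collisional velocity on the collision space -/
def vs (p : R3 × (R3 × S2)) : R3 := vOutStar p.1 p.2.1 p.2.2

/-- loss product -/
def FL (h : R3 → ℝ) (p : R3 × (R3 × S2)) : ℝ := h p.1 * h p.2.1 * (1 - h (vo p)) * (1 - h (vs p))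

/-- gain product -/
def FG (h : R3 → ℝ) (p : R3 × (R3 × S2)) : ℝ := h (vo p) * h (vs p) * (1 - h p.1) * (1 - h p.2.1)

lemma measurable_vo : Measurable vo := by unfold vo vOut; fun_prop

lemma measurable_vs : Measurable vs := by unfold vs vOutStar; fun_prop

lemma measurable_BE (γ : ℝ) {b : ℝ → ℝ} (hb : GradCutoff b) : Measurable (BE γ b) :=
  (measurable_Bker γ hb).ennreal_ofReal

lemma measurable_FL {h : R3 → ℝ} (hh : Measurable h) : Measurable (FL h) := by
  have := measurable_vo
  have := measurable_vs
  unfold FL; fun_prop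

lemma measurable_FG {h : R3 → ℝ} (hh : Measurable h) : Measurable (FG h) := by
  have := measurable_vo
  have := measurable_vs
  unfold FG; fun_prop

lemma FL_T (h : R3 → ℝ) {p : R3 × (R3 × S2)} (hp : p.1 ≠ p.2.1) : FL h (Tmap p) = FG h p := by
  have e1 : vo (Tmap p) = p.1 := vOut_T hp _
  have e2 : vs (Tmap p) = p.2.1 := vOutStar_T hp _
  unfold FL FG; rw [e1, e2]; rfl

lemma BE_T (γ : ℝ) (b : ℝ → ℝ) {p : R3 × (R3 × S2)} (hp : p.1 ≠ p.2.1) :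
    BE γ b (Tmap p) = BE γ b p := by
  unfold BE; congr 1; exact Bker_T γ b hp _

lemma BE_W (γ : ℝ) {b : ℝ → ℝ} (hb : GradCutoff b) (p : R3 × (R3 × S2)) :
    BE γ b (Wmap p) = BE γ b p := by
  unfold BE; congr 1; exact Bker_comm γ hb _ _ _

lemma vo_W (p : R3 × (R3 × S2)) : vo (Wmap p) = vo p := vOut_comm _ _ _
lemma vs_W (p : R3 × (R3 × S2)) : vs (Wmap p) = vs p := vOutStar_comm _ _ _

lemma FL_W (h : R3 → ℝ) (p : R3 × (R3 × S2)) : FL h (Wmap p) = FL h p := by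
  unfold FL; rw [vo_W, vs_W]; simp only [Wmap]; ring

lemma FG_W (h : R3 → ℝ) (p : R3 × (R3 × S2)) : FG h (Wmap p) = FG h p := by
  unfold FG; rw [vo_W, vs_W]; simp only [Wmap]; ring

lemma K_gain1 {γ : ℝ} {b : ℝ → ℝ} (hb : GradCutoff b) {h : R3 → ℝ} (hh : Measurable h)
    {χ : R3 → ℝ≥0∞} (hχ : Measurable χ) : ∫⁻ p, BE γ b p * ENNReal.ofReal (FG h p) * χ p.1 ∂Pm
    = ∫⁻ p, BE γ b p * ENNReal.ofReal (FL h p) * χ (vo p) ∂Pm := by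
  have m1 := measurable_BE γ hb
  have m2 := measurable_FL hh
  have m3 := measurable_vo
  have m : Measurable fun p => BE γ b p * ENNReal.ofReal (FL h p) * χ (vo p) := by fun_prop
  rw [← Tmap_preserving.lintegral_comp m]
  apply lintegral_congr_ae
  filter_upwards [Pm_ae_ne] with p hp
  rw [FL_T h hp, BE_T γ b hp, show vo (Tmap p) = p.1 from vOut_T hp _]

lemma K_gain2 {γ : ℝ} {b : ℝ → ℝ} (hb : GradCutoff b) {h : R3 → ℝ} (hh : Measurable h)
    {χ : R3 → ℝ≥0∞} (hχ : Measurable χ) : ∫⁻ p, BE γ b p * ENNReal.ofReal (FG h p) * χ p.2.1 ∂Pm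
    = ∫⁻ p, BE γ b p * ENNReal.ofReal (FL h p) * χ (vs p) ∂Pm := by
  have m1 := measurable_BE γ hb
  have m2 := measurable_FL hh
  have m3 := measurable_vs
  have m : Measurable fun p => BE γ b p * ENNReal.ofReal (FL h p) * χ (vs p) := by fun_prop
  rw [← Tmap_preserving.lintegral_comp m]
  apply lintegral_congr_ae
  filter_upwards [Pm_ae_ne] with p hp
  rw [FL_T h hp, BE_T γ b hp, show vs (Tmap p) = p.2.1 from vOutStar_T hp _]

lemma K_gain_symm {γ : ℝ} {b : ℝ → ℝ} (hb : GradCutoff b) {h : R3 → ℝ} (hh : Measurable h)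
    {χ : R3 → ℝ≥0∞} (hχ : Measurable χ) : ∫⁻ p, BE γ b p * ENNReal.ofReal (FG h p) * χ p.1 ∂Pm
    = ∫⁻ p, BE γ b p * ENNReal.ofReal (FG h p) * χ p.2.1 ∂Pm := by
  have m1 := measurable_BE γ hb
  have m2 := measurable_FG hh
  rw [← Wmap_preserving.lintegral_comp (by fun_prop)]
  apply lintegral_congr
  intro p
  rw [FG_W h, BE_W γ hb]; rfl

lemma K_loss_symm {γ : ℝ} {b : ℝ → ℝ} (hb : GradCutoff b) {h : R3 → ℝ} (hh : Measurable h)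
    {χ : R3 → ℝ≥0∞} (hχ : Measurable χ) : ∫⁻ p, BE γ b p * ENNReal.ofReal (FL h p) * χ p.1 ∂Pm
    = ∫⁻ p, BE γ b p * ENNReal.ofReal (FL h p) * χ p.2.1 ∂Pm := by
  have m1 := measurable_BE γ hb
  have m2 := measurable_FL hh
  rw [← Wmap_preserving.lintegral_comp (by fun_prop)]
  apply lintegral_congr
  intro p
  rw [FL_W h, BE_W γ hb]; rfl

/-- doubled gain integral -/
lemma K_gain_double {γ : ℝ} {b : ℝ → ℝ} (hb : GradCutoff b) {h : R3 → ℝ} (hh : Measurable h)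
    {χ : R3 → ℝ≥0∞} (hχ : Measurable χ) : 2 * ∫⁻ p, BE γ b p * ENNReal.ofReal (FG h p) * χ p.1 ∂Pm
    = ∫⁻ p, BE γ b p * ENNReal.ofReal (FL h p) * (χ (vo p) + χ (vs p)) ∂Pm := by
  have m1 := measurable_BE γ hb
  have m2 := measurable_FL hh
  have m3 := measurable_vo
  have m4 := measurable_vs
  simp_rw [mul_add]
  rw [lintegral_add_left (by fun_prop), two_mul, ← K_gain1 hb hh hχ, ← K_gain2 hb hh hχ,
    ← K_gain_symm hb hh hχ]

lemma K_loss_double {γ : ℝ} {b : ℝ → ℝ} (hb : GradCutoff b) {h : R3 → ℝ} (hh : Measurable h)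
    {χ : R3 → ℝ≥0∞} (hχ : Measurable χ) : 2 * ∫⁻ p, BE γ b p * ENNReal.ofReal (FL h p) * χ p.1 ∂Pm
    = ∫⁻ p, BE γ b p * ENNReal.ofReal (FL h p) * (χ p.1 + χ p.2.1) ∂Pm := by
  have m1 := measurable_BE γ hb
  have m2 := measurable_FL hh
  simp_rw [mul_add]
  rw [lintegral_add_left (by fun_prop), two_mul]
  conv_lhs => rw [K_loss_symm hb hh hχ]
  conv_rhs => rw [K_loss_symm hb hh hχ]

/-- Angular integration of the kernel. -/
lemma angular {g : ℝ → ℝ≥0∞} (hg : Measurable g) {v w : R3} (h : v ≠ w) :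
    ∫⁻ σ : S2, g (cosAngle v w σ) ∂sphMeasure = zon g := by
  rw [← zonal (nrm (v - w)) g hg]
  congr 1; ext σ; rw [cosAngle_eq h]

lemma norm_sub_rpow_le {γ : ℝ} (h0 : 0 < γ) (h2 : γ ≤ 2) (v w : R3) :
    ‖v - w‖ ^ γ ≤ 2 * ((1 + ‖v‖ ^ 2) * (1 + ‖w‖ ^ 2)) := by
  have h1 : ‖v - w‖ ≤ ‖v‖ + ‖w‖ := norm_sub_le _ _
  have hv := norm_nonneg v
  have hw := norm_nonneg w
  have h3 : ‖v - w‖ ^ 2 ≤ 2 * (‖v‖ ^ 2 + ‖w‖ ^ 2) := by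
    nlinarith [norm_nonneg (v - w), sq_nonneg (‖v‖ - ‖w‖)]
  have h4 : ‖v - w‖ ^ γ ≤ 1 + ‖v - w‖ ^ 2 := by
    rcases le_total ‖v - w‖ 1 with h | h
    · have := Real.rpow_le_one (norm_nonneg _) h h0.le
      nlinarith [sq_nonneg ‖v - w‖]
    · have := Real.rpow_le_rpow_of_exponent_le h h2
      rw [Real.rpow_two] at this; linarith
  nlinarith [mul_nonneg (sq_nonneg ‖v‖) (sq_nonneg ‖w‖), sq_nonneg ‖v‖, sq_nonneg ‖w‖]

/-- moments as extended nonnegative reals -/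
def Mq (q : ℝ) (h : R3 → ℝ) : ℝ≥0∞ := ∫⁻ v, ENNReal.ofReal (h v) * ENNReal.ofReal (‖v‖ ^ q)

lemma FL_le {h : R3 → ℝ} (h0 : ∀ v, 0 ≤ h v) (h1 : ∀ v, h v ≤ 1) (p : R3 × (R3 × S2)) :
    FL h p ≤ h p.1 * h p.2.1 := by
  unfold FL
  have := mul_nonneg (h0 p.1) (h0 p.2.1)
  have a1 : 1 - h (vo p) ≤ 1 := by linarith [h0 (vo p)]
  have a2 : 1 - h (vs p) ≤ 1 := by linarith [h0 (vs p)]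
  have a3 : 0 ≤ 1 - h (vo p) := by linarith [h1 (vo p)]
  have a4 : 0 ≤ 1 - h (vs p) := by linarith [h1 (vs p)]
  calc _ ≤ h p.1 * h p.2.1 * 1 * 1 := by gcongr
    _ = _ := by ring

lemma FL_nonneg {h : R3 → ℝ} (h0 : ∀ v, 0 ≤ h v) (h1 : ∀ v, h v ≤ 1) (p : R3 × (R3 × S2)) :
    0 ≤ FL h p := by
  unfold FL
  have := mul_nonneg (h0 p.1) (h0 p.2.1)
  have a3 : 0 ≤ 1 - h (vo p) := by linarith [h1 (vo p)]
  have a4 : 0 ≤ 1 - h (vs p) := by linarith [h1 (vs p)]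
  positivity

lemma FG_nonneg {h : R3 → ℝ} (h0 : ∀ v, 0 ≤ h v) (h1 : ∀ v, h v ≤ 1) (p : R3 × (R3 × S2)) :
    0 ≤ FG h p := by
  unfold FG
  have := mul_nonneg (h0 (vo p)) (h0 (vs p))
  have a3 : 0 ≤ 1 - h p.1 := by linarith [h1 p.1]
  have a4 : 0 ≤ 1 - h p.2.1 := by linarith [h1 p.2.1]
  positivity

/-- Upper bound for the loss integral against a weight depending on `(v,w)`. -/
lemma K_upper {γ : ℝ} {b : ℝ → ℝ} (hb : GradCutoff b)
    {h : R3 → ℝ} (hh : Measurable h) (h0 : ∀ v, 0 ≤ h v) (h1 : ∀ v, h v ≤ 1)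
    {φ : R3 → R3 → ℝ≥0∞} (hφ : Measurable (fun q : R3 × R3 => φ q.1 q.2)) :
    ∫⁻ p, BE γ b p * ENNReal.ofReal (FL h p) * φ p.1 p.2.1 ∂Pm ≤
      zon (fun c => ENNReal.ofReal (b c)) * ∫⁻ v, ∫⁻ w, ENNReal.ofReal (‖v - w‖ ^ γ) *
        (ENNReal.ofReal (h v) * ENNReal.ofReal (h w)) * φ v w := by
  have m1 := measurable_BE γ hb
  have m2 := measurable_FL hh
  have mb := hb.measurable
  calc ∫⁻ p, BE γ b p * ENNReal.ofReal (FL h p) * φ p.1 p.2.1 ∂Pm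
      ≤ ∫⁻ p, BE γ b p * (ENNReal.ofReal (h p.1) * ENNReal.ofReal (h p.2.1)) * φ p.1 p.2.1 ∂Pm := by
        gcongr with p
        rw [← ENNReal.ofReal_mul (h0 _)]
        exact ENNReal.ofReal_le_ofReal (FL_le h0 h1 p)
    _ = ∫⁻ v, ∫⁻ w, ∫⁻ σ, BE γ b (v, (w, σ)) * (ENNReal.ofReal (h v) * ENNReal.ofReal (h w))
          * φ v w ∂sphMeasure := by
        have m3 : Measurable fun p : R3 × (R3 × S2) => φ p.1 p.2.1 :=
          hφ.comp (by fun_prop : Measurable fun p : R3 × (R3 × S2) => (p.1, p.2.1))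
        unfold Pm
        rw [lintegral_prod _ (by fun_prop)]
        congr 1; ext v
        rw [lintegral_prod _ (by fun_prop)]
    _ = ∫⁻ v, ∫⁻ w, zon (fun c => ENNReal.ofReal (b c)) * (ENNReal.ofReal (‖v - w‖ ^ γ) *
        (ENNReal.ofReal (h v) * ENNReal.ofReal (h w)) * φ v w) := by
        congr 1; ext v
        apply lintegral_congr_ae
        filter_upwards [ae_ne v] with w hw
        have e : ∀ σ, BE γ b (v, (w, σ)) * (ENNReal.ofReal (h v) * ENNReal.ofReal (h w)) * φ v w
          = ENNReal.ofReal (b (cosAngle v w σ)) * (ENNReal.ofReal (‖v - w‖ ^ γ) *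
          (ENNReal.ofReal (h v) * ENNReal.ofReal (h w)) * φ v w) := by
          intro σ
          simp only [BE, Bker]
          rw [ENNReal.ofReal_mul (by positivity)]; ring
        simp_rw [e]
        rw [lintegral_mul_const]
        · rw [angular (g := fun c => ENNReal.ofReal (b c)) (by fun_prop) hw]
        · have : Measurable (fun σ => cosAngle v w σ) := by unfold cosAngle; fun_prop
          fun_prop
    _ = _ := by
        have e : ∀ v, ∫⁻ w, zon (fun c => ENNReal.ofReal (b c)) * (ENNReal.ofReal (‖v - w‖ ^ γ) *
          (ENNReal.ofReal (h v) * ENNReal.ofReal (h w)) * φ v w) =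
          zon (fun c => ENNReal.ofReal (b c)) * ∫⁻ w, (ENNReal.ofReal (‖v - w‖ ^ γ) *
          (ENNReal.ofReal (h v) * ENNReal.ofReal (h w)) * φ v w) := by
          intro v
          rw [lintegral_const_mul' _ _ (zon_b_lt_top hb).ne]
        simp_rw [e]
        rw [lintegral_const_mul' _ _ (zon_b_lt_top hb).ne]

lemma lint_one_add {h : R3 → ℝ} (hh : Measurable h) :
    ∫⁻ v, ENNReal.ofReal (h v) * ENNReal.ofReal (1 + ‖v‖ ^ 2) = Mq 0 h + Mq 2 h := by
  unfold Mq
  rw [← lintegral_add_left (by fun_prop)]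
  congr 1; ext v
  rw [← mul_add, Real.rpow_zero, ← ENNReal.ofReal_add (by norm_num) (by positivity)]
  norm_num

lemma K_one_lt_top {γ : ℝ} (hγ0 : 0 < γ) (hγ2 : γ ≤ 2) {b : ℝ → ℝ} (hb : GradCutoff b)
    {h : R3 → ℝ} (hh : Measurable h) (h0 : ∀ v, 0 ≤ h v) (h1 : ∀ v, h v ≤ 1) :
    ∫⁻ p, BE γ b p * ENNReal.ofReal (FL h p) ∂Pm ≤
      zon (fun c => ENNReal.ofReal (b c)) * (2 * ((Mq 0 h + Mq 2 h) * (Mq 0 h + Mq 2 h))) := by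
  have := K_upper (γ := γ) hb hh h0 h1 (φ := fun _ _ => 1) measurable_const
  simp only [mul_one] at this
  refine this.trans ?_
  gcongr
  rw [← lint_one_add hh, ← lintegral_mul_const _ (by fun_prop), ← lintegral_const_mul _ (by fun_prop)]
  refine lintegral_mono fun v => ?_
  rw [← lintegral_const_mul _ (by fun_prop), ← lintegral_const_mul _ (by fun_prop)]
  refine lintegral_mono fun w => ?_
  have hk := norm_sub_rpow_le hγ0 hγ2 v w
  have h2 : (2 : ℝ≥0∞) = ENNReal.ofReal 2 := by simp
  have : ENNReal.ofReal (‖v - w‖ ^ γ) ≤ ENNReal.ofReal 2 *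
      (ENNReal.ofReal (1 + ‖v‖ ^ 2) * ENNReal.ofReal (1 + ‖w‖ ^ 2)) := by
    rw [← ENNReal.ofReal_mul (by positivity), ← ENNReal.ofReal_mul (by norm_num)]
    exact ENNReal.ofReal_le_ofReal hk
  calc _ ≤ ENNReal.ofReal 2 * (ENNReal.ofReal (1 + ‖v‖ ^ 2) * ENNReal.ofReal (1 + ‖w‖ ^ 2)) *
        (ENNReal.ofReal (h v) * ENNReal.ofReal (h w)) := by gcongr
    _ = _ := by simp only [ENNReal.ofReal_ofNat]; ring

lemma swap3_preserving {α β δ : Type*} [MeasurableSpace α] [MeasurableSpace β] [MeasurableSpace δ]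
    (μ : Measure α) (ν : Measure β) (ρ : Measure δ) [SFinite μ] [SFinite ν] [SFinite ρ] :
    MeasurePreserving (fun p : α × (β × δ) => (p.2.1, (p.1, p.2.2)))
      (μ.prod (ν.prod ρ)) (ν.prod (μ.prod ρ)) := by
  have h := (measurePreserving_prodAssoc ν μ ρ).comp
    ((Measure.measurePreserving_swap.prod (MeasurePreserving.id ρ)).comp
      (measurePreserving_prodAssoc μ ν ρ).symm)
  exact h

lemma quasi_snd_map {α β δ : Type*} [MeasurableSpace α] [MeasurableSpace β] [MeasurableSpace δ]
    (μ : Measure α) {ν : Measure β} {ρ : Measure δ} [SFinite μ] [SFinite ν] [SFinite ρ]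
    {θ : β → δ} (hθ : Measure.QuasiMeasurePreserving θ ν ρ) :
    Measure.QuasiMeasurePreserving (fun p : α × β => (p.1, θ p.2)) (μ.prod ν) (μ.prod ρ) :=
  MeasureTheory.QuasiMeasurePreserving.prodMap (Measure.QuasiMeasurePreserving.id μ) hθ

lemma quasi_p1 : Measure.QuasiMeasurePreserving (fun p : R3 × (R3 × S2) => p.1) Pm volume :=
  Measure.quasiMeasurePreserving_fst

lemma quasi_p2 : Measure.QuasiMeasurePreserving (fun p : R3 × (R3 × S2) => p.2.1) Pm volume :=
  (Measure.quasiMeasurePreserving_fst (μ := (volume : Measure R3)) (ν := sphMeasure)).comp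
    Measure.quasiMeasurePreserving_snd

lemma quasi_vo : Measure.QuasiMeasurePreserving vo Pm volume :=
  quasi_p1.comp Tmap_preserving.quasiMeasurePreserving

lemma quasi_vs : Measure.QuasiMeasurePreserving vs Pm volume :=
  quasi_p2.comp Tmap_preserving.quasiMeasurePreserving

lemma integrable_of_mem {f : R3 → ℝ} (hf : Measurable f) (h : MemL1s 2 f) : Integrable f := by
  refine Integrable.mono' h hf.aestronglyMeasurable ?_
  filter_upwards with v
  rw [Real.norm_eq_abs]
  have : (1:ℝ) ≤ (1 + ‖v‖ ^ 2) ^ ((2:ℝ) / 2) := by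
    norm_num
  exact le_mul_of_one_le_right (abs_nonneg _) this

lemma integrable2_of_mem {f : R3 → ℝ} (hf : Measurable f) (h : MemL1s 2 f) :
    Integrable (fun v => f v * ‖v‖ ^ 2) := by
  refine Integrable.mono' h (by fun_prop) ?_
  filter_upwards with v
  rw [Real.norm_eq_abs, abs_mul, abs_of_nonneg (by positivity : 0 ≤ ‖v‖ ^ 2)]
  have : ‖v‖ ^ 2 ≤ (1 + ‖v‖ ^ 2) ^ ((2:ℝ) / 2) := by
    norm_num
  gcongr

lemma Mq0_eq {f : R3 → ℝ} (hf : Measurable f) (h0 : ∀ v, 0 ≤ f v) (h : MemL1s 2 f) :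
    Mq 0 f = ENNReal.ofReal (∫ v, f v) := by
  rw [ofReal_integral_eq_lintegral_ofReal (integrable_of_mem hf h) (ae_of_all _ h0)]
  simp [Mq]

lemma Mq2_eq {f : R3 → ℝ} (hf : Measurable f) (h0 : ∀ v, 0 ≤ f v) (h : MemL1s 2 f) :
    Mq 2 f = ENNReal.ofReal (∫ v, f v * ‖v‖ ^ 2) := by
  rw [ofReal_integral_eq_lintegral_ofReal (integrable2_of_mem hf h)
    (ae_of_all _ fun v => mul_nonneg (h0 v) (by positivity))]
  simp only [Mq]
  congr 1; ext v
  rw [ENNReal.ofReal_mul (h0 v)]; norm_num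

lemma Mq_congr {f g : R3 → ℝ} (h : f =ᵐ[volume] g) (q : ℝ) : Mq q f = Mq q g := by
  unfold Mq
  apply lintegral_congr_ae
  filter_upwards [h] with v hv
  rw [hv]

lemma measurable_Mq {g : ℝ → R3 → ℝ} (hg : Measurable (fun p : ℝ × R3 => g p.1 p.2)) (q : ℝ) :
    Measurable (fun τ => Mq q (g τ)) := by
  unfold Mq
  have : Measurable (fun p : ℝ × R3 => ENNReal.ofReal (g p.1 p.2) * ENNReal.ofReal (‖p.2‖ ^ q)) := by
    fun_prop
  exact this.lintegral_prod_right'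

lemma rep_exists {γ : ℝ} {b : ℝ → ℝ} {f₀ : R3 → ℝ} {f : ℝ → R3 → ℝ} (hf : IsFDSolution γ b f₀ f) :
    ∃ g : ℝ → R3 → ℝ, Measurable (fun p : ℝ × R3 => g p.1 p.2) ∧ (∀ τ v, 0 ≤ g τ v) ∧
      (∀ τ v, g τ v ≤ 1) ∧ (∀ τ, Mq 0 (g τ) = Mq 0 (f 0)) ∧ (∀ τ, Mq 2 (g τ) = Mq 2 (f 0)) ∧
      (∀ᵐ τ ∂(volume.restrict (Ioi (0:ℝ))), f τ =ᵐ[volume] g τ) ∧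
      (∀ᵐ v : R3, ∀ t, 0 ≤ t → f t v = f 0 v + ∫ τ in (0:ℝ)..t, QFD γ b (g τ) v) := by
  obtain ⟨Z, hZ, hmild⟩ := hf.mild
  have hj := joint_aemeasurable hf.measurable hZ hmild
  set φ := hj.mk with hφdef
  have hφm : Measurable φ := hj.measurable_mk
  have hφe := hj.ae_eq_mk
  let g0 : ℝ → R3 → ℝ := fun τ v => max 0 (min 1 (φ (τ, v)))
  have hg0m : Measurable (fun p : ℝ × R3 => g0 p.1 p.2) := by
    simp only [g0]; fun_prop
  let good : Set ℝ := {τ | Mq 0 (g0 τ) = Mq 0 (f 0)} ∩ {τ | Mq 2 (g0 τ) = Mq 2 (f 0)}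
  have hgood : MeasurableSet good :=
    (measurableSet_eq_fun (measurable_Mq hg0m 0) measurable_const).inter
      (measurableSet_eq_fun (measurable_Mq hg0m 2) measurable_const)
  have hm0 : ∀ t, 0 ≤ t → Mq 0 (f t) = Mq 0 (f 0) := by
    intro t ht
    rw [Mq0_eq (hf.measurable t) (hf.nonneg t ht) (hf.memL12 t ht),
      Mq0_eq (hf.measurable 0) (hf.nonneg 0 le_rfl) (hf.memL12 0 le_rfl), hf.mass t ht,
      hf.mass 0 le_rfl]
  have hm2 : ∀ t, 0 ≤ t → Mq 2 (f t) = Mq 2 (f 0) := by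
    intro t ht
    rw [Mq2_eq (hf.measurable t) (hf.nonneg t ht) (hf.memL12 t ht),
      Mq2_eq (hf.measurable 0) (hf.nonneg 0 le_rfl) (hf.memL12 0 le_rfl), hf.energy t ht,
      hf.energy 0 le_rfl]
  have hae0 : ∀ᵐ τ ∂(volume.restrict (Ioi (0:ℝ))), f τ =ᵐ[volume] g0 τ := by
    filter_upwards [Measure.ae_ae_of_ae_prod hφe, ae_restrict_mem measurableSet_Ioi] with τ hτ hτ0
    filter_upwards [hτ] with v hv
    have hv' : f τ v = φ (τ, v) := hv
    simp only [g0]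
    rw [← hv', min_eq_right (hf.le_one τ (le_of_lt hτ0) v), max_eq_right (hf.nonneg τ (le_of_lt hτ0) v)]
  have haeg : ∀ᵐ τ ∂(volume.restrict (Ioi (0:ℝ))), τ ∈ good := by
    filter_upwards [hae0, ae_restrict_mem measurableSet_Ioi] with τ hτ hτ0
    exact ⟨by rw [mem_ofPred_eq, ← Mq_congr hτ, hm0 τ (le_of_lt hτ0)],
      by rw [mem_ofPred_eq, ← Mq_congr hτ, hm2 τ (le_of_lt hτ0)]⟩
  classical
  let g : ℝ → R3 → ℝ := fun τ v => if τ ∈ good then g0 τ v else f 0 v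
  have hgm : Measurable (fun p : ℝ × R3 => g p.1 p.2) := by
    apply Measurable.ite (measurable_fst hgood) hg0m ((hf.measurable 0).comp measurable_snd)
  have hgg0 : ∀ τ ∈ good, g τ = g0 τ := by
    intro τ hτ; funext v; simp only [g, if_pos hτ]
  have hgf0 : ∀ τ ∉ good, g τ = f 0 := by
    intro τ hτ; funext v; simp only [g, if_neg hτ]
  have hae : ∀ᵐ τ ∂(volume.restrict (Ioi (0:ℝ))), f τ =ᵐ[volume] g τ := by
    filter_upwards [hae0, haeg] with τ h1 h2
    rw [hgg0 τ h2]; exact h1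
  refine ⟨g, hgm, ?_, ?_, ?_, ?_, hae, ?_⟩
  · intro τ v
    by_cases h : τ ∈ good
    · rw [hgg0 τ h]; exact le_max_left _ _
    · rw [hgf0 τ h]; exact hf.nonneg 0 le_rfl v
  · intro τ v
    by_cases h : τ ∈ good
    · rw [hgg0 τ h]; exact max_le zero_le_one (min_le_left _ _)
    · rw [hgf0 τ h]; exact hf.le_one 0 le_rfl v
  · intro τ
    by_cases h : τ ∈ good
    · rw [hgg0 τ h]; exact h.1
    · rw [hgf0 τ h]
  · intro τ
    by_cases h : τ ∈ good
    · rw [hgg0 τ h]; exact h.2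
    · rw [hgf0 τ h]
  · have hjoint : ∀ᵐ p ∂((volume.restrict (Ioi (0:ℝ))).prod (volume : Measure R3)),
        f p.1 p.2 = g p.1 p.2 := by
      filter_upwards [hφe, Measure.quasiMeasurePreserving_fst.ae haeg,
        Measure.quasiMeasurePreserving_fst.ae (ae_restrict_mem measurableSet_Ioi)] with p h1 h2 h3
      rw [hgg0 p.1 h2]
      have hv' : f p.1 p.2 = φ (p.1, p.2) := h1
      simp only [g0]
      rw [← hv', min_eq_right (hf.le_one p.1 (le_of_lt h3) p.2),
        max_eq_right (hf.nonneg p.1 (le_of_lt h3) p.2)]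
    have a1 := (quasi_snd_map (volume.restrict (Ioi (0:ℝ))) quasi_p1).ae hjoint
    have a2 := (quasi_snd_map (volume.restrict (Ioi (0:ℝ))) quasi_p2).ae hjoint
    have a3 := (quasi_snd_map (volume.restrict (Ioi (0:ℝ))) quasi_vo).ae hjoint
    have a4 := (quasi_snd_map (volume.restrict (Ioi (0:ℝ))) quasi_vs).ae hjoint
    have a5 := a1.and (a2.and (a3.and a4))
    have a6 := (swap3_preserving (volume : Measure R3) (volume.restrict (Ioi (0:ℝ)))
      ((volume : Measure R3).prod sphMeasure)).quasiMeasurePreserving.ae a5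
    have a7 := Measure.ae_ae_of_ae_prod a6
    have aeZ : ∀ᵐ v : R3, v ∉ Z := measure_eq_zero_iff_ae_notMem.1 hZ
    filter_upwards [a7, aeZ] with v hv hvZ t ht
    rw [hmild t ht v hvZ, hmild 0 le_rfl v hvZ, intervalIntegral.integral_same, add_zero]
    congr 1
    rw [intervalIntegral.integral_of_le ht, intervalIntegral.integral_of_le ht]
    apply integral_congr_ae
    have b1 := Measure.ae_ae_of_ae_prod hv
    have b2 := ae_restrict_of_ae_restrict_of_subset (Ioc_subset_Ioi_self : Ioc (0:ℝ) t ⊆ Ioi 0) b1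
    filter_upwards [b2] with τ hτ
    have b3 := Measure.ae_ae_of_ae_prod hτ
    unfold QFD
    apply integral_congr_ae
    filter_upwards [b3] with w hw
    apply integral_congr_ae
    filter_upwards [hw] with σ hσ
    obtain ⟨c1, c2, c3, c4⟩ := hσ
    simp only [vo, vs] at c1 c2 c3 c4
    rw [c1, c2, c3, c4]

/-- Measure on the time-velocity-collision space. -/
def Lam (t : ℝ) : Measure (R3 × (ℝ × (R3 × S2))) :=
  (volume : Measure R3).prod ((volume.restrict (Ioc 0 t)).prod ((volume : Measure R3).prod sphMeasure))

lemma lintegral_Lam (t : ℝ) {H : R3 × (ℝ × (R3 × S2)) → ℝ≥0∞} (hH : Measurable H) :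
    ∫⁻ q, H q ∂(Lam t) = ∫⁻ τ in Ioc 0 t, ∫⁻ p, H (p.1, (τ, p.2)) ∂Pm := by
  have h : MeasurePreserving (fun p : ℝ × (R3 × (R3 × S2)) => (p.2.1, (p.1, p.2.2)))
      ((volume.restrict (Ioc (0:ℝ) t)).prod Pm) (Lam t) :=
    swap3_preserving (volume.restrict (Ioc (0:ℝ) t)) (volume : Measure R3)
    ((volume : Measure R3).prod sphMeasure)
  rw [← h.lintegral_comp hH]
  exact lintegral_prod _ (hH.comp h.measurable).aemeasurable

lemma measurable_FLg {g : ℝ → R3 → ℝ} (hg : Measurable (fun p : ℝ × R3 => g p.1 p.2)) :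
    Measurable (fun q : ℝ × (R3 × (R3 × S2)) => FL (g q.1) q.2) := by
  have e : ∀ θ : R3 × (R3 × S2) → R3, Measurable θ →
      Measurable (fun q : ℝ × (R3 × (R3 × S2)) => g q.1 (θ q.2)) := by
    intro θ hθ
    exact hg.comp (by fun_prop : Measurable fun q : ℝ × (R3 × (R3 × S2)) => (q.1, θ q.2))
  have h1 := e (fun p => p.1) (by fun_prop)
  have h2 := e (fun p => p.2.1) (by fun_prop)
  have h3 := e vo measurable_vo
  have h4 := e vs measurable_vs
  exact ((h1.mul h2).mul (measurable_const.sub h3)).mul (measurable_const.sub h4)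

lemma measurable_FGg {g : ℝ → R3 → ℝ} (hg : Measurable (fun p : ℝ × R3 => g p.1 p.2)) :
    Measurable (fun q : ℝ × (R3 × (R3 × S2)) => FG (g q.1) q.2) := by
  have e : ∀ θ : R3 × (R3 × S2) → R3, Measurable θ →
      Measurable (fun q : ℝ × (R3 × (R3 × S2)) => g q.1 (θ q.2)) := by
    intro θ hθ
    exact hg.comp (by fun_prop : Measurable fun q : ℝ × (R3 × (R3 × S2)) => (q.1, θ q.2))
  have h1 := e (fun p => p.1) (by fun_prop)
  have h2 := e (fun p => p.2.1) (by fun_prop)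
  have h3 := e vo measurable_vo
  have h4 := e vs measurable_vs
  exact ((h3.mul h4).mul (measurable_const.sub h1)).mul (measurable_const.sub h2)

/-- Generic finiteness and integrability. -/
lemma Lam_integrable {γ : ℝ} {b : ℝ → ℝ} (hb : GradCutoff b) {t : ℝ}
    {χ : R3 → ℝ} (hχ : Measurable χ) (hχ0 : ∀ v, 0 ≤ χ v)
    {Φ : ℝ → R3 × (R3 × S2) → ℝ} (hΦ : Measurable (fun q : ℝ × (R3 × (R3 × S2)) => Φ q.1 q.2))
    (hΦ0 : ∀ τ p, 0 ≤ Φ τ p) {C : ℝ≥0∞} (hC : C < ∞)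
    (hfin : ∀ τ, ∫⁻ p, BE γ b p * ENNReal.ofReal (Φ τ p) * ENNReal.ofReal (χ p.1) ∂Pm ≤ C) :
    (∫⁻ τ in Ioc 0 t, ∫⁻ p, BE γ b p * ENNReal.ofReal (Φ τ p) * ENNReal.ofReal (χ p.1) ∂Pm) < ∞ ∧
    Integrable (fun q : R3 × (ℝ × (R3 × S2)) => Bker γ b q.1 q.2.2.1 q.2.2.2 *
      Φ q.2.1 (q.1, q.2.2) * χ q.1) (Lam t) ∧
    ∫ q : R3 × (ℝ × (R3 × S2)), Bker γ b q.1 q.2.2.1 q.2.2.2 *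
      Φ q.2.1 (q.1, q.2.2) * χ q.1 ∂(Lam t) =
    (∫⁻ τ in Ioc 0 t, ∫⁻ p, BE γ b p * ENNReal.ofReal (Φ τ p) * ENNReal.ofReal (χ p.1) ∂Pm).toReal := by
  have mB := measurable_Bker γ hb
  have hlt : (∫⁻ τ in Ioc 0 t, ∫⁻ p, BE γ b p * ENNReal.ofReal (Φ τ p) *
      ENNReal.ofReal (χ p.1) ∂Pm) < ∞ := by
    calc _ ≤ ∫⁻ τ in Ioc 0 t, C := lintegral_mono fun τ => hfin τ
      _ = C * volume (Ioc 0 t) := by rw [setLIntegral_const]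
      _ < ∞ := ENNReal.mul_lt_top hC (by rw [Real.volume_Ioc]; exact ENNReal.ofReal_lt_top)
  have hm : Measurable (fun q : R3 × (ℝ × (R3 × S2)) => Bker γ b q.1 q.2.2.1 q.2.2.2 *
      Φ q.2.1 (q.1, q.2.2) * χ q.1) := by
    have hφ : Measurable (fun q : R3 × (ℝ × (R3 × S2)) => (q.1, q.2.2)) :=
      measurable_fst.prodMk (measurable_snd.comp measurable_snd)
    have hψ : Measurable (fun q : R3 × (ℝ × (R3 × S2)) => (q.2.1, (q.1, q.2.2))) :=
      (measurable_fst.comp measurable_snd).prodMk hφ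
    have m1 := mB.comp hφ
    have m2 := hΦ.comp hψ
    simp only [Function.comp_def] at m1 m2
    exact (m1.mul m2).mul (hχ.comp measurable_fst)
  have h0 : ∀ q : R3 × (ℝ × (R3 × S2)), 0 ≤ Bker γ b q.1 q.2.2.1 q.2.2.2 *
      Φ q.2.1 (q.1, q.2.2) * χ q.1 := fun q =>
    mul_nonneg (mul_nonneg (Bker_nonneg γ hb _ _ _) (hΦ0 _ _)) (hχ0 _)
  have he : ∫⁻ q, ENNReal.ofReal (Bker γ b q.1 q.2.2.1 q.2.2.2 *
      Φ q.2.1 (q.1, q.2.2) * χ q.1) ∂(Lam t) =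
      ∫⁻ τ in Ioc 0 t, ∫⁻ p, BE γ b p * ENNReal.ofReal (Φ τ p) * ENNReal.ofReal (χ p.1) ∂Pm := by
    rw [lintegral_Lam t hm.ennreal_ofReal]
    congr 1; ext τ
    congr 1; ext p
    rw [ENNReal.ofReal_mul (mul_nonneg (Bker_nonneg γ hb _ _ _) (hΦ0 _ _)),
      ENNReal.ofReal_mul (Bker_nonneg γ hb _ _ _)]
    rfl
  refine ⟨hlt, ⟨hm.aestronglyMeasurable, ?_⟩, ?_⟩
  · rw [hasFiniteIntegral_iff_ofReal (ae_of_all _ h0), he]; exact hlt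
  · rw [integral_eq_lintegral_of_nonneg_ae (ae_of_all _ h0) hm.aestronglyMeasurable, he]

lemma weak_bochner {γ : ℝ} {b : ℝ → ℝ} {t : ℝ} (ht : 0 ≤ t) {g : ℝ → R3 → ℝ}
    {χ : R3 → ℝ} {f₁ f₂ : R3 → ℝ}
    (hmild : ∀ᵐ v : R3, f₂ v = f₁ v + ∫ τ in (0:ℝ)..t, QFD γ b (g τ) v)
    (hi : Integrable (fun q : R3 × (ℝ × (R3 × S2)) => Bker γ b q.1 q.2.2.1 q.2.2.2 *
      (FG (g q.2.1) (q.1, q.2.2) - FL (g q.2.1) (q.1, q.2.2)) * χ q.1) (Lam t)) :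
    ∫ v, (f₂ v - f₁ v) * χ v = ∫ q : R3 × (ℝ × (R3 × S2)), Bker γ b q.1 q.2.2.1 q.2.2.2 *
      (FG (g q.2.1) (q.1, q.2.2) - FL (g q.2.1) (q.1, q.2.2)) * χ q.1 ∂(Lam t) := by
  unfold Lam at hi ⊢
  rw [integral_prod _ hi]
  apply integral_congr_ae
  filter_upwards [hmild, hi.prod_right_ae] with v hv hiv
  rw [integral_prod _ hiv]
  have : (f₂ v - f₁ v) * χ v = ∫ τ in Ioc 0 t, QFD γ b (g τ) v * χ v := by
    rw [integral_mul_const, ← intervalIntegral.integral_of_le ht, hv]; ring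
  rw [this]
  apply integral_congr_ae
  filter_upwards [hiv.prod_right_ae] with τ hiτ
  rw [integral_prod _ hiτ]
  unfold QFD
  rw [← integral_mul_const]
  congr 1; ext w
  rw [← integral_mul_const]
  congr 1

lemma weak_ennreal {γ : ℝ} (hγ0 : 0 < γ) (hγ2 : γ ≤ 2) {b : ℝ → ℝ} (hb : GradCutoff b)
    {t : ℝ} (ht : 0 ≤ t) {g : ℝ → R3 → ℝ}
    (hg : Measurable (fun p : ℝ × R3 => g p.1 p.2)) (hg0 : ∀ τ v, 0 ≤ g τ v)
    (hg1 : ∀ τ v, g τ v ≤ 1) {m E : ℝ≥0∞} (hm : m < ∞) (hE : E < ∞)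
    (hgm : ∀ τ, Mq 0 (g τ) = m) (hgE : ∀ τ, Mq 2 (g τ) = E)
    {χ : R3 → ℝ} (hχ : Measurable χ) (hχ0 : ∀ v, 0 ≤ χ v) {a : ℝ} (hχa : ∀ v, χ v ≤ a)
    {f₁ f₂ : R3 → ℝ} (i1 : Integrable f₁) (i2 : Integrable f₂) (n1 : ∀ v, 0 ≤ f₁ v) (n2 : ∀ v, 0 ≤ f₂ v)
    (hmild : ∀ᵐ v : R3, f₂ v = f₁ v + ∫ τ in (0:ℝ)..t, QFD γ b (g τ) v) :
    (∫⁻ v, ENNReal.ofReal (f₂ v) * ENNReal.ofReal (χ v)) +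
      (∫⁻ τ in Ioc 0 t, ∫⁻ p, BE γ b p * ENNReal.ofReal (FL (g τ) p) * ENNReal.ofReal (χ p.1) ∂Pm) =
    (∫⁻ v, ENNReal.ofReal (f₁ v) * ENNReal.ofReal (χ v)) +
      (∫⁻ τ in Ioc 0 t, ∫⁻ p, BE γ b p * ENNReal.ofReal (FG (g τ) p) * ENNReal.ofReal (χ p.1) ∂Pm) ∧
    (∫⁻ τ in Ioc 0 t, ∫⁻ p, BE γ b p * ENNReal.ofReal (FL (g τ) p) * ENNReal.ofReal (χ p.1) ∂Pm) < ∞ ∧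
    (∫⁻ τ in Ioc 0 t, ∫⁻ p, BE γ b p * ENNReal.ofReal (FG (g τ) p) * ENNReal.ofReal (χ p.1) ∂Pm) < ∞ ∧
    (∫⁻ v, ENNReal.ofReal (f₁ v) * ENNReal.ofReal (χ v)) < ∞ := by
  have hgτ : ∀ τ, Measurable (g τ) := fun τ => hg.comp (by fun_prop : Measurable fun v => (τ, v))
  set D := zon (fun c => ENNReal.ofReal (b c)) * (2 * ((m + E) * (m + E))) with hD
  have hDlt : D < ∞ := by
    have hmE : m + E < ∞ := ENNReal.add_lt_top.2 ⟨hm, hE⟩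
    exact ENNReal.mul_lt_top (zon_b_lt_top hb)
      (ENNReal.mul_lt_top (by simp) (ENNReal.mul_lt_top hmE hmE))
  have hK : ∀ τ, ∀ ψ : R3 × (R3 × S2) → ℝ≥0∞, (∀ p, ψ p ≤ ENNReal.ofReal a) →
      ∫⁻ p, BE γ b p * ENNReal.ofReal (FL (g τ) p) * ψ p ∂Pm ≤ D * ENNReal.ofReal a := by
    intro τ ψ hψ
    calc _ ≤ ∫⁻ p, BE γ b p * ENNReal.ofReal (FL (g τ) p) * ENNReal.ofReal a ∂Pm := by
          refine lintegral_mono fun p => ?_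
          have := hψ p
          gcongr
      _ = (∫⁻ p, BE γ b p * ENNReal.ofReal (FL (g τ) p) ∂Pm) * ENNReal.ofReal a := by
          rw [lintegral_mul_const' _ _ ENNReal.ofReal_ne_top]
      _ ≤ _ := by
          gcongr
          have := K_one_lt_top hγ0 hγ2 hb (hgτ τ) (hg0 τ) (hg1 τ)
          rwa [hgm, hgE] at this
  have hDa : D * ENNReal.ofReal a < ∞ := ENNReal.mul_lt_top hDlt ENNReal.ofReal_lt_top
  obtain ⟨l1, l2, l3⟩ := Lam_integrable (t := t) hb hχ hχ0 (Φ := fun τ p => FL (g τ) p)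
    (measurable_FLg hg) (fun τ p => FL_nonneg (hg0 τ) (hg1 τ) p) hDa
    (fun τ => hK τ _ fun p => ENNReal.ofReal_le_ofReal (hχa _))
  obtain ⟨k1, k2, k3⟩ := Lam_integrable (t := t) hb hχ hχ0 (Φ := fun τ p => FG (g τ) p)
    (measurable_FGg hg) (fun τ p => FG_nonneg (hg0 τ) (hg1 τ) p) hDa
    (fun τ => by
      rw [K_gain1 (χ := fun v => ENNReal.ofReal (χ v)) hb (hgτ τ) (by fun_prop)]
      exact hK τ _ fun p => ENNReal.ofReal_le_ofReal (hχa _))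
  have hsub : (fun q : R3 × (ℝ × (R3 × S2)) => Bker γ b q.1 q.2.2.1 q.2.2.2 *
      (FG (g q.2.1) (q.1, q.2.2) - FL (g q.2.1) (q.1, q.2.2)) * χ q.1) =
      fun q => Bker γ b q.1 q.2.2.1 q.2.2.2 * FG (g q.2.1) (q.1, q.2.2) * χ q.1 -
       Bker γ b q.1 q.2.2.1 q.2.2.2 * FL (g q.2.1) (q.1, q.2.2) * χ q.1 := by
    funext q; ring
  have hi := k2.sub l2
  have hw := weak_bochner ht hmild (χ := χ) (by rw [hsub]; exact hi)
  rw [hsub, integral_sub k2 l2, k3, l3] at hw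
  have bd : ∀ f : R3 → ℝ, Integrable f → Integrable (fun v => f v * χ v) := by
    intro f hf
    refine hf.mul_bdd (c := a) hχ.aestronglyMeasurable ?_
    filter_upwards with v
    rw [Real.norm_eq_abs, abs_of_nonneg (hχ0 v)]; exact hχa v
  have conv : ∀ f : R3 → ℝ, Integrable f → (∀ v, 0 ≤ f v) → 
      (∫⁻ v, ENNReal.ofReal (f v) * ENNReal.ofReal (χ v)) = ENNReal.ofReal (∫ v, f v * χ v) := by
    intro f hf hf0
    rw [ofReal_integral_eq_lintegral_ofReal (bd f hf) (ae_of_all _ fun v => mul_nonneg (hf0 v) (hχ0 v))]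
    congr 1; ext v; rw [ENNReal.ofReal_mul (hf0 v)]
  have pos : ∀ f : R3 → ℝ, (∀ v, 0 ≤ f v) → 0 ≤ ∫ v, f v * χ v := fun f hf0 =>
    integral_nonneg fun v => mul_nonneg (hf0 v) (hχ0 v)
  refine ⟨?_, l1, k1, by rw [conv f₁ i1 n1]; exact ENNReal.ofReal_lt_top⟩
  rw [conv f₁ i1 n1, conv f₂ i2 n2, ← ENNReal.ofReal_toReal l1.ne, ← ENNReal.ofReal_toReal k1.ne,
    ← ENNReal.ofReal_add (pos _ n2) ENNReal.toReal_nonneg, ← ENNReal.ofReal_add (pos _ n1) ENNReal.toReal_nonneg]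
  congr 1
  have e : ∫ v, (f₂ v - f₁ v) * χ v = (∫ v, f₂ v * χ v) - ∫ v, f₁ v * χ v := by
    simp_rw [sub_mul]
    exact integral_sub (bd _ i2) (bd _ i1)
  rw [e] at hw
  linarith

/-- A solution `f` together with a jointly measurable representative `g`. -/
structure BRep (γ : ℝ) (b : ℝ → ℝ) (f g : ℝ → R3 → ℝ) (m E : ℝ≥0∞) : Prop where
  γ0 : 0 < γ
  γ2 : γ ≤ 2
  hb : GradCutoff b
  hg : Measurable (fun p : ℝ × R3 => g p.1 p.2)
  hg0 : ∀ τ v, 0 ≤ g τ v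
  hg1 : ∀ τ v, g τ v ≤ 1
  gm : ∀ τ, Mq 0 (g τ) = m
  gE : ∀ τ, Mq 2 (g τ) = E
  mlt : m < ∞
  Elt : E < ∞
  fmeas : ∀ t, Measurable (f t)
  fint : ∀ t, 0 ≤ t → Integrable (f t)
  f0 : ∀ t, 0 ≤ t → ∀ v, 0 ≤ f t v
  fm : ∀ t, 0 ≤ t → Mq 0 (f t) = m
  fE : ∀ t, 0 ≤ t → Mq 2 (f t) = E
  fg : ∀ᵐ τ ∂(volume.restrict (Ioi (0:ℝ))), f τ =ᵐ[volume] g τ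
  mild : ∀ᵐ v : R3, ∀ t, 0 ≤ t → f t v = f 0 v + ∫ τ in (0:ℝ)..t, QFD γ b (g τ) v

lemma BRep.mk' {γ : ℝ} (hγ0 : 0 < γ) (hγ2 : γ ≤ 2) {b : ℝ → ℝ} (hb : GradCutoff b)
    {f₀ : R3 → ℝ} {f : ℝ → R3 → ℝ} (hf : IsFDSolution γ b f₀ f) :
    ∃ g, BRep γ b f g (Mq 0 (f 0)) (Mq 2 (f 0)) := by
  obtain ⟨g, h1, h2, h3, h4, h5, h6, h7⟩ := rep_exists hf
  have a := fun t (ht : 0 ≤ t) => Mq0_eq (hf.measurable t) (hf.nonneg t ht) (hf.memL12 t ht)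
  have a' := fun t (ht : 0 ≤ t) => Mq2_eq (hf.measurable t) (hf.nonneg t ht) (hf.memL12 t ht)
  exact ⟨g, hγ0, hγ2, hb, h1, h2, h3, h4, h5, by rw [a 0 le_rfl]; exact ENNReal.ofReal_lt_top,
    by rw [a' 0 le_rfl]; exact ENNReal.ofReal_lt_top, hf.measurable,
    fun t ht => integrable_of_mem (hf.measurable t) (hf.memL12 t ht), hf.nonneg,
    fun t ht => by rw [a t ht, a 0 le_rfl, hf.mass t ht, hf.mass 0 le_rfl],
    fun t ht => by rw [a' t ht, a' 0 le_rfl, hf.energy t ht, hf.energy 0 le_rfl], h6, h7⟩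

/-- Collision functional. -/
def Kg (γ : ℝ) (b : ℝ → ℝ) (h : R3 → ℝ) (ψ : R3 × (R3 × S2) → ℝ≥0∞) : ℝ≥0∞ :=
  ∫⁻ p, BE γ b p * ENNReal.ofReal (FL h p) * ψ p ∂Pm

lemma Kg_mono (γ : ℝ) (b : ℝ → ℝ) (h : R3 → ℝ) {ψ φ : R3 × (R3 × S2) → ℝ≥0∞} (hh : ∀ p, ψ p ≤ φ p) :
    Kg γ b h ψ ≤ Kg γ b h φ := lintegral_mono fun p => by
  have := hh p
  gcongr

lemma measurable_Kg {γ : ℝ} {b : ℝ → ℝ} (hb : GradCutoff b) {g : ℝ → R3 → ℝ}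
    (hg : Measurable (fun p : ℝ × R3 => g p.1 p.2)) {ψ : R3 × (R3 × S2) → ℝ≥0∞} (hψ : Measurable ψ) :
    Measurable (fun τ => Kg γ b (g τ) ψ) := by
  have m1 := (measurable_BE γ hb).comp (measurable_snd : Measurable fun q : ℝ × (R3 × (R3 × S2)) => q.2)
  have m2 := (measurable_FLg hg).ennreal_ofReal
  have m3 := hψ.comp (measurable_snd : Measurable fun q : ℝ × (R3 × (R3 × S2)) => q.2)
  exact ((m1.mul m2).mul m3).lintegral_prod_right'

lemma Kg_add {γ : ℝ} {b : ℝ → ℝ} (hb : GradCutoff b) {h : R3 → ℝ}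
    (hh : Measurable h) {ψ φ : R3 × (R3 × S2) → ℝ≥0∞} (hψ : Measurable ψ) :
    Kg γ b h (fun p => ψ p + φ p) = Kg γ b h ψ + Kg γ b h φ := by
  unfold Kg
  simp_rw [mul_add]
  exact lintegral_add_left (((measurable_BE γ hb).mul (measurable_FL hh).ennreal_ofReal).mul hψ) _

lemma Kg_tsum {γ : ℝ} {b : ℝ → ℝ} (hb : GradCutoff b) {h : R3 → ℝ}
    (hh : Measurable h) {ψ : ℕ → R3 × (R3 × S2) → ℝ≥0∞} (hψ : ∀ n, Measurable (ψ n)) (c : ℕ → ℝ≥0∞) :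
    Kg γ b h (fun p => ∑' n, c n * ψ n p) = ∑' n, c n * Kg γ b h (ψ n) := by
  have e : ∀ n, Measurable (fun p => BE γ b p * ENNReal.ofReal (FL h p) * ψ n p) := fun n =>
    ((measurable_BE γ hb).mul (measurable_FL hh).ennreal_ofReal).mul (hψ n)
  unfold Kg
  simp_rw [← lintegral_const_mul _ (e _)]
  rw [← lintegral_tsum (fun n => ((e n).const_mul _).aemeasurable)]
  congr 1; ext p
  rw [← ENNReal.tsum_mul_left]
  congr 1; ext n; ring

/-- truncated energy -/
def chi (a : ℝ) (v : R3) : ℝ := min (‖v‖ ^ 2) a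

lemma measurable_chi (a : ℝ) : Measurable (chi a) := by unfold chi; fun_prop

lemma BRep.gτ {γ : ℝ} {b : ℝ → ℝ} {f g : ℝ → R3 → ℝ} {m E : ℝ≥0∞} (H : BRep γ b f g m E) (τ : ℝ) :
    Measurable (g τ) := H.hg.comp (by fun_prop : Measurable fun v => (τ, v))

lemma weak0 {γ : ℝ} {b : ℝ → ℝ} {f g : ℝ → R3 → ℝ} {m E : ℝ≥0∞} (H : BRep γ b f g m E)
    {t : ℝ} (ht : 0 ≤ t) {a : ℝ} (ha : 0 ≤ a) :
    2 * (∫⁻ v, ENNReal.ofReal (f t v) * ENNReal.ofReal (chi a v)) +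
      (∫⁻ τ in Ioc 0 t, Kg γ b (g τ) fun p => ENNReal.ofReal (chi a p.1) + ENNReal.ofReal (chi a p.2.1)) =
    2 * (∫⁻ v, ENNReal.ofReal (f 0 v) * ENNReal.ofReal (chi a v)) +
      (∫⁻ τ in Ioc 0 t, Kg γ b (g τ) fun p => ENNReal.ofReal (chi a (vo p)) + ENNReal.ofReal (chi a (vs p))) ∧
    (∫⁻ τ in Ioc 0 t, Kg γ b (g τ) fun p => ENNReal.ofReal (chi a p.1) + ENNReal.ofReal (chi a p.2.1)) < ∞ ∧
    (∫⁻ τ in Ioc 0 t, Kg γ b (g τ) fun p => ENNReal.ofReal (chi a (vo p)) + ENNReal.ofReal (chi a (vs p))) < ∞ := by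
  have mc := (measurable_chi a).ennreal_ofReal
  obtain ⟨w1, w2, w3, w4⟩ := weak_ennreal H.γ0 H.γ2 H.hb ht H.hg H.hg0 H.hg1 H.mlt H.Elt H.gm H.gE
    (measurable_chi a) (fun v => le_min (by positivity) ha) (fun v => min_le_right _ _)
    (H.fint 0 le_rfl) (H.fint t ht) (H.f0 0 le_rfl) (H.f0 t ht)
    (by filter_upwards [H.mild] with v hv using hv t ht)
  have eL : (∫⁻ τ in Ioc 0 t, Kg γ b (g τ) fun p => ENNReal.ofReal (chi a p.1) + ENNReal.ofReal (chi a p.2.1)) =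
    2 * ∫⁻ τ in Ioc 0 t, ∫⁻ p, BE γ b p * ENNReal.ofReal (FL (g τ) p) * ENNReal.ofReal (chi a p.1) ∂Pm := by
    rw [← lintegral_const_mul' _ _ (by simp)]
    congr 1; ext τ
    exact (K_loss_double H.hb (H.gτ τ) mc).symm
  have eG : (∫⁻ τ in Ioc 0 t, Kg γ b (g τ) fun p => ENNReal.ofReal (chi a (vo p)) + ENNReal.ofReal (chi a (vs p))) =
    2 * ∫⁻ τ in Ioc 0 t, ∫⁻ p, BE γ b p * ENNReal.ofReal (FG (g τ) p) * ENNReal.ofReal (chi a p.1) ∂Pm := by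
    rw [← lintegral_const_mul' _ _ (by simp)]
    congr 1; ext τ
    exact (K_gain_double H.hb (H.gτ τ) mc).symm
  rw [eL, eG]
  refine ⟨?_, ENNReal.mul_lt_top (by simp) w2, ENNReal.mul_lt_top (by simp) w3⟩
  rw [← mul_add, w1, mul_add]

lemma lint_split {t0 t : ℝ} (h0 : 0 ≤ t0) (h : t0 ≤ t) (F : ℝ → ℝ≥0∞) :
    ∫⁻ τ in Ioc 0 t, F τ = (∫⁻ τ in Ioc 0 t0, F τ) + ∫⁻ τ in Ioc t0 t, F τ := by
  rw [← Ioc_union_Ioc_eq_Ioc h0 h, lintegral_union measurableSet_Ioc]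
  exact Set.Ioc_disjoint_Ioc_of_le le_rfl

lemma weak1 {γ : ℝ} {b : ℝ → ℝ} {f g : ℝ → R3 → ℝ} {m E : ℝ≥0∞} (H : BRep γ b f g m E)
    {t0 t : ℝ} (ht0 : 0 ≤ t0) (ht : t0 ≤ t) {a : ℝ} (ha : 0 ≤ a)
    {L G : R3 × (R3 × S2) → ℝ≥0∞}
    (hLG : ∀ p, ENNReal.ofReal (chi a p.1) + ENNReal.ofReal (chi a p.2.1) + L p ≤
      ENNReal.ofReal (chi a (vo p)) + ENNReal.ofReal (chi a (vs p)) + G p) :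
    2 * (∫⁻ v, ENNReal.ofReal (f t0 v) * ENNReal.ofReal (chi a v)) + (∫⁻ τ in Ioc t0 t, Kg γ b (g τ) L) ≤
    2 * (∫⁻ v, ENNReal.ofReal (f t v) * ENNReal.ofReal (chi a v)) + (∫⁻ τ in Ioc t0 t, Kg γ b (g τ) G) := by
  have mc := (measurable_chi a).ennreal_ofReal
  obtain ⟨u1, u2, u3⟩ := weak0 H ht0 ha
  obtain ⟨w1, w2, w3⟩ := weak0 H (ht0.trans ht) ha
  rw [lint_split ht0 ht] at w1 w2 w3
  rw [lint_split ht0 ht] at w1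
  have mL : Measurable (fun p : R3 × (R3 × S2) => ENNReal.ofReal (chi a p.1) + ENNReal.ofReal (chi a p.2.1)) :=
    (mc.comp measurable_fst).add (mc.comp (measurable_fst.comp measurable_snd))
  have mG : Measurable (fun p : R3 × (R3 × S2) => ENNReal.ofReal (chi a (vo p)) + ENNReal.ofReal (chi a (vs p))) :=
    (mc.comp measurable_vo).add (mc.comp measurable_vs)
  have key : (∫⁻ τ in Ioc t0 t, Kg γ b (g τ) fun p => ENNReal.ofReal (chi a p.1) + ENNReal.ofReal (chi a p.2.1)) +
      (∫⁻ τ in Ioc t0 t, Kg γ b (g τ) L) ≤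
      (∫⁻ τ in Ioc t0 t, Kg γ b (g τ) fun p => ENNReal.ofReal (chi a (vo p)) + ENNReal.ofReal (chi a (vs p))) +
      (∫⁻ τ in Ioc t0 t, Kg γ b (g τ) G) := by
    rw [← lintegral_add_left (measurable_Kg H.hb H.hg mL), ← lintegral_add_left (measurable_Kg H.hb H.hg mG)]
    refine lintegral_mono fun τ => ?_
    rw [← Kg_add H.hb (H.gτ τ) mL, ← Kg_add H.hb (H.gτ τ) mG]
    exact Kg_mono _ _ _ hLG
  generalize (∫⁻ v, ENNReal.ofReal (f t0 v) * ENNReal.ofReal (chi a v)) = A0 at *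
  generalize (∫⁻ v, ENNReal.ofReal (f t v) * ENNReal.ofReal (chi a v)) = A1 at *
  generalize (∫⁻ v, ENNReal.ofReal (f 0 v) * ENNReal.ofReal (chi a v)) = A at *
  generalize (∫⁻ τ in Ioc t0 t, Kg γ b (g τ) L) = l at *
  generalize (∫⁻ τ in Ioc t0 t, Kg γ b (g τ) G) = k at *
  generalize (∫⁻ τ in Ioc t0 t, Kg γ b (g τ) fun p => ENNReal.ofReal (chi a p.1) + ENNReal.ofReal (chi a p.2.1)) = LL at *
  generalize (∫⁻ τ in Ioc t0 t, Kg γ b (g τ) fun p => ENNReal.ofReal (chi a (vo p)) + ENNReal.ofReal (chi a (vs p))) = GG at *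
  generalize (∫⁻ τ in Ioc 0 t0, Kg γ b (g τ) fun p => ENNReal.ofReal (chi a p.1) + ENNReal.ofReal (chi a p.2.1)) = L0 at *
  generalize (∫⁻ τ in Ioc 0 t0, Kg γ b (g τ) fun p => ENNReal.ofReal (chi a (vo p)) + ENNReal.ofReal (chi a (vs p))) = G0 at *
  have hGG : GG ≠ ∞ := (lt_of_le_of_lt le_add_self w3).ne
  have hs : L0 + GG ≠ ∞ := ENNReal.add_ne_top.2 ⟨u2.ne, hGG⟩
  refine (ENNReal.add_le_add_iff_left hs).1 ?_
  calc L0 + GG + (2 * A0 + l) = (2 * A0 + L0) + GG + l := by ring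
    _ = (2 * A + (G0 + GG)) + l := by rw [u1]; ring
    _ = 2 * A1 + L0 + (LL + l) := by rw [← w1]; ring
    _ ≤ 2 * A1 + L0 + (GG + k) := by gcongr
    _ = _ := by ring

lemma weak2 {γ : ℝ} {b : ℝ → ℝ} {f g : ℝ → R3 → ℝ} {m E : ℝ≥0∞} (H : BRep γ b f g m E)
    {t0 t : ℝ} (ht0 : 0 ≤ t0) (ht : t0 ≤ t) {a : ℝ} (ha : 0 ≤ a)
    {L G : R3 × (R3 × S2) → ℝ≥0∞}
    (hLG : ∀ p, ENNReal.ofReal (chi a p.1) + ENNReal.ofReal (chi a p.2.1) + L p ≤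
      ENNReal.ofReal (chi a (vo p)) + ENNReal.ofReal (chi a (vs p)) + G p) :
    2 * (∫⁻ v, ENNReal.ofReal (f t v) * ENNReal.ofReal (‖v‖ ^ 2 - a)) + (∫⁻ τ in Ioc t0 t, Kg γ b (g τ) L) ≤
    2 * (∫⁻ v, ENNReal.ofReal (f t0 v) * ENNReal.ofReal (‖v‖ ^ 2 - a)) + (∫⁻ τ in Ioc t0 t, Kg γ b (g τ) G) := by
  have h := weak1 H ht0 ht ha hLG
  have e : ∀ t, 0 ≤ t → (∫⁻ v, ENNReal.ofReal (f t v) * ENNReal.ofReal (chi a v)) +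
      (∫⁻ v, ENNReal.ofReal (f t v) * ENNReal.ofReal (‖v‖ ^ 2 - a)) = E := by
    intro t ht
    have mf := H.fmeas t
    have mc := measurable_chi a
    rw [← H.fE t ht, Mq, ← lintegral_add_left (by fun_prop)]
    congr 1; ext v
    rw [← mul_add]
    congr 1
    unfold chi
    have e2 : ‖v‖ ^ (2:ℝ) = ‖v‖ ^ 2 := by norm_num
    rw [e2]
    rcases le_total (‖v‖ ^ 2) a with h | h
    · rw [min_eq_left h, ENNReal.ofReal_of_nonpos (sub_nonpos.2 h), add_zero]
    · rw [min_eq_right h, ← ENNReal.ofReal_add ha (sub_nonneg.2 h)]; congr 1; ring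
  have e0 := e t0 ht0
  have e1 := e t (ht0.trans ht)
  have hE := H.Elt.ne
  generalize (∫⁻ v, ENNReal.ofReal (f t0 v) * ENNReal.ofReal (chi a v)) = A0 at *
  generalize (∫⁻ v, ENNReal.ofReal (f t v) * ENNReal.ofReal (chi a v)) = A1 at *
  generalize (∫⁻ v, ENNReal.ofReal (f t0 v) * ENNReal.ofReal (‖v‖ ^ 2 - a)) = T0 at *
  generalize (∫⁻ v, ENNReal.ofReal (f t v) * ENNReal.ofReal (‖v‖ ^ 2 - a)) = T1 at *
  generalize (∫⁻ τ in Ioc t0 t, Kg γ b (g τ) L) = l at *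
  generalize (∫⁻ τ in Ioc t0 t, Kg γ b (g τ) G) = k at *
  refine (ENNReal.add_le_add_iff_left (a := 2 * E) (ENNReal.mul_ne_top (by simp) hE)).1 ?_
  calc 2 * E + (2 * T1 + l) = (2 * A0 + l) + 2 * T0 + 2 * T1 := by rw [← e0]; ring
    _ ≤ (2 * A1 + k) + 2 * T0 + 2 * T1 := by gcongr
    _ = _ := by rw [← e1]; ring

lemma ptwA {x y x' y' a : ℝ} (hx : 0 ≤ x) (hy : 0 ≤ y) (hx' : 0 ≤ x') (hy' : 0 ≤ y') (ha : 0 ≤ a)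
    (h : x' + y' = x + y) :
    min x a + min y a ≤ min x' a + min y' a + (if a < x + y then min x y else 0) := by
  split_ifs with hc
  · rcases le_total x y with h1 | h1 <;> rcases le_total x' a with h2 | h2 <;>
    rcases le_total y' a with h3 | h3 <;> rcases le_total x a with h4 | h4 <;>
    rcases le_total y a with h5 | h5 <;> simp [*] <;> linarith
  · push Not at hc
    rw [min_eq_left (by linarith : x ≤ a), min_eq_left (by linarith : y ≤ a),
      min_eq_left (by linarith : x' ≤ a), min_eq_left (by linarith : y' ≤ a)]
    linarith

lemma ptwB {x y x' y' a δ : ℝ} (hx : 0 ≤ x) (hy : 0 ≤ y) (hyx : y ≤ x / 8) 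
    (hδ : δ ≤ 1 / 8) (h1 : x' ≤ (1 - δ) * x) (h2 : y' ≤ (1 - δ) * x)
    (h : x' + y' = x + y) (ha1 : x / 4 < a) (ha2 : a ≤ x / 2) :
    min x a + min y a + δ * x ≤ min x' a + min y' a := by
  rw [min_eq_right (by linarith : a ≤ x), min_eq_left (by linarith : y ≤ a)]
  rcases le_total x' a with h3 | h3 <;> rcases le_total y' a with h4 | h4
  · rw [min_eq_left h3, min_eq_left h4]; nlinarith
  · rw [min_eq_left h3, min_eq_right h4]; nlinarith
  · rw [min_eq_right h3, min_eq_left h4]; nlinarith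
  · rw [min_eq_right h3, min_eq_right h4]; nlinarith

lemma energy_cons (v w : R3) (σ : S2) : ‖vOut v w σ‖ ^ 2 + ‖vOutStar v w σ‖ ^ 2 = ‖v‖ ^ 2 + ‖w‖ ^ 2 := by
  have p1 := parallelogram_law_with_norm ℝ (vOut v w σ) (vOutStar v w σ)
  have p2 := parallelogram_law_with_norm ℝ v w
  rw [vOut_add, norm_vOut_sub] at p1
  nlinarith

lemma inner_eq_cos (v w : R3) (σ : S2) : ⟪v - w, (σ : R3)⟫ = ‖v - w‖ * cosAngle v w σ := by
  unfold cosAngle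
  rw [inner_smul_left]
  rcases eq_or_ne v w with h | h
  · simp [h]
  · have : ‖v - w‖ ≠ 0 := by simpa [sub_eq_zero] using h
    simp only [conj_trivial]; field_simp

lemma vOut_sq_le {v w : R3} {σ : S2} {R δ : ℝ} (hδ0 : 0 < δ) (hδ1 : δ ≤ 1) (hw : ‖w‖ ≤ R)
    (hv : R ≤ δ / 32 * ‖v‖) (hc : δ ≤ 1 - cosAngle v w σ ^ 2) :
    ‖vOut v w σ‖ ^ 2 ≤ (1 - δ / 8) * ‖v‖ ^ 2 ∧ ‖vOutStar v w σ‖ ^ 2 ≤ (1 - δ / 8) * ‖v‖ ^ 2 := by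
  have hσ := norm_S2 σ
  have iσ : ⟪(σ : R3), (σ : R3)⟫ = 1 := by rw [real_inner_self_eq_norm_sq, hσ]; norm_num
  have hz := inner_eq_cos v w σ
  have hws : |⟪w, (σ : R3)⟫| ≤ R := (abs_real_inner_le_norm _ _).trans (by rw [hσ, mul_one]; exact hw)
  have hz2 : ‖v - w‖ ^ 2 = ‖v‖ ^ 2 - 2 * ⟪v, w⟫ + ‖w‖ ^ 2 := norm_sub_sq_real v w
  have hz3 : ‖v - w‖ ≤ ‖v‖ + R := (norm_sub_le v w).trans (by linarith)
  have e1 : ‖vOut v w σ‖ ^ 2 = (‖v‖ ^ 2 + ‖w‖ ^ 2) / 2 + ‖v - w‖ ^ 2 * cosAngle v w σ / 2 +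
      ‖v - w‖ * ⟪w, (σ : R3)⟫ := by
    have : vOut v w σ = (2⁻¹ : ℝ) • ((v + w) + ‖v - w‖ • (σ : R3)) := by rw [vOut]; module
    rw [this, norm_smul, mul_pow, norm_add_sq_real, norm_add_sq_real, norm_smul, inner_smul_right, hσ,
      inner_add_left]
    rw [inner_sub_left] at hz
    have : ⟪v, (σ : R3)⟫ = ‖v - w‖ * cosAngle v w σ + ⟪w, (σ : R3)⟫ := by linarith
    rw [this]
    norm_num
    nlinarith
  have e2 : ‖vOutStar v w σ‖ ^ 2 = (‖v‖ ^ 2 + ‖w‖ ^ 2) / 2 - ‖v - w‖ ^ 2 * cosAngle v w σ / 2 -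
      ‖v - w‖ * ⟪w, (σ : R3)⟫ := by
    have := energy_cons v w σ
    linarith
  have hcc : |cosAngle v w σ| ≤ 1 - δ / 2 := by
    apply abs_le_of_sq_le_sq
    · nlinarith
    · linarith
  rw [abs_le] at hcc hws
  have n1 := norm_nonneg v
  have n2 := norm_nonneg w
  have n3 := norm_nonneg (v - w)
  have b1 : ‖v - w‖ ^ 2 ≤ (‖v‖ + R) ^ 2 := pow_le_pow_left₀ n3 hz3 2
  have b2 : ‖w‖ ^ 2 ≤ R ^ 2 := pow_le_pow_left₀ n2 hw 2
  have R0 : 0 ≤ R := n2.trans hw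
  have q : ∀ c i : ℝ, c ≤ 1 - δ / 2 → i ≤ R → (‖v‖ ^ 2 + ‖w‖ ^ 2) / 2 + ‖v - w‖ ^ 2 * c / 2 +
      ‖v - w‖ * i ≤ (1 - δ / 8) * ‖v‖ ^ 2 := by
    intro c i hc hi
    have t1 : ‖v - w‖ ^ 2 * c ≤ (‖v‖ + R) ^ 2 * (1 - δ / 2) :=
      (mul_le_mul_of_nonneg_left hc (by positivity)).trans
        (mul_le_mul_of_nonneg_right b1 (by linarith))
    have t2 : ‖v - w‖ * i ≤ (‖v‖ + R) * R :=
      (mul_le_mul_of_nonneg_left hi n3).trans (mul_le_mul_of_nonneg_right hz3 R0)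
    have t3 : R * ‖v‖ ≤ δ / 32 * ‖v‖ ^ 2 := by nlinarith
    have t4 : R ^ 2 ≤ δ / 32 * ‖v‖ ^ 2 := by
      have : R ≤ ‖v‖ := hv.trans (by nlinarith)
      nlinarith
    have t5 : (‖v‖ + R) ^ 2 * (1 - δ / 2) ≤ ‖v‖ ^ 2 * (1 - δ / 2) + 2 * (R * ‖v‖) + R ^ 2 := by
      have u1 := mul_nonneg hδ0.le (sq_nonneg R)
      have u2 := mul_nonneg hδ0.le (mul_nonneg n1 R0)
      linarith
    have t6 : (‖v‖ + R) * R = R * ‖v‖ + R ^ 2 := by ring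
    linarith
  refine ⟨?_, ?_⟩
  · rw [e1]; exact q _ _ hcc.2 hws.2
  · rw [e2]
    have := q (-cosAngle v w σ) (-⟪w, (σ : R3)⟫) (by linarith) (by linarith)
    linarith

/-- collisions for which energy is strictly spread -/
def Good (R R1 δ : ℝ) (p : R3 × (R3 × S2)) : Prop :=
  ‖p.2.1‖ ≤ R ∧ R1 ≤ ‖p.1‖ ∧ δ ≤ 1 - cosAngle p.1 p.2.1 p.2.2 ^ 2

open Classical in
/-- strict gain -/
def La (R R1 δ a : ℝ) (p : R3 × (R3 × S2)) : ℝ≥0∞ :=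
  if Good R R1 δ p ∧ ‖p.1‖ ^ 2 / 4 < a ∧ a ≤ ‖p.1‖ ^ 2 / 2 then ENNReal.ofReal (δ / 8 * ‖p.1‖ ^ 2) else 0

/-- Povzner remainder -/
def Ga (a : ℝ) (p : R3 × (R3 × S2)) : ℝ≥0∞ :=
  if a < ‖p.1‖ ^ 2 + ‖p.2.1‖ ^ 2 then ENNReal.ofReal (min (‖p.1‖ ^ 2) (‖p.2.1‖ ^ 2)) else 0

lemma chi_nonneg {a : ℝ} (ha : 0 ≤ a) (v : R3) : 0 ≤ chi a v := le_min (by positivity) ha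

lemma povzner {R R1 δ : ℝ} (hδ0 : 0 < δ) (hδ1 : δ ≤ 1) (hR : R ≤ δ / 32 * R1) {a : ℝ} (ha : 0 ≤ a)
    (p : R3 × (R3 × S2)) :
    ENNReal.ofReal (chi a p.1) + ENNReal.ofReal (chi a p.2.1) + La R R1 δ a p ≤
      ENNReal.ofReal (chi a (vo p)) + ENNReal.ofReal (chi a (vs p)) + Ga a p := by
  have hE : ‖vo p‖ ^ 2 + ‖vs p‖ ^ 2 = ‖p.1‖ ^ 2 + ‖p.2.1‖ ^ 2 := energy_cons _ _ _
  rw [← ENNReal.ofReal_add (chi_nonneg ha _) (chi_nonneg ha _),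
    ← ENNReal.ofReal_add (chi_nonneg ha _) (chi_nonneg ha _)]
  unfold La
  split_ifs with h
  · obtain ⟨⟨h1, h2, h3⟩, h4, h5⟩ := h
    have hv : R ≤ δ / 32 * ‖p.1‖ := hR.trans (by gcongr)
    obtain ⟨k1, k2⟩ := vOut_sq_le hδ0 hδ1 h1 hv h3
    refine le_trans ?_ le_self_add
    rw [← ENNReal.ofReal_add (add_nonneg (chi_nonneg ha _) (chi_nonneg ha _)) (by positivity)]
    apply ENNReal.ofReal_le_ofReal
    refine ptwB (sq_nonneg _) (sq_nonneg _) ?_ (by linarith) k1 k2 hE h4 h5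
    have : ‖p.2.1‖ ≤ 1 / 32 * ‖p.1‖ := h1.trans (hv.trans (by nlinarith [norm_nonneg p.1]))
    nlinarith [norm_nonneg p.2.1, norm_nonneg p.1]
  · rw [add_zero]
    have := ptwA (sq_nonneg ‖p.1‖) (sq_nonneg ‖p.2.1‖) (sq_nonneg ‖vo p‖) (sq_nonneg ‖vs p‖) ha hE
    have g : Ga a p = ENNReal.ofReal (if a < ‖p.1‖ ^ 2 + ‖p.2.1‖ ^ 2 then min (‖p.1‖ ^ 2) (‖p.2.1‖ ^ 2) else 0) := by
      unfold Ga; split_ifs <;> simp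
    rw [g, ← ENNReal.ofReal_add (add_nonneg (chi_nonneg ha _) (chi_nonneg ha _))
      (by split_ifs <;> positivity)]
    exact ENNReal.ofReal_le_ofReal this

/-- dyadic weights -/
def wt (r : ℝ) (n : ℕ) : ℝ≥0∞ := ENNReal.ofReal (((2:ℝ) ^ n) ^ r)

/-- truncated dyadic sum -/
def Wsum (r X : ℝ) : ℝ≥0∞ := ∑' n, if (2:ℝ) ^ n < X then wt r n else 0

lemma wt_eq (r : ℝ) (n : ℕ) : wt r n = (ENNReal.ofReal (2 ^ r)) ^ n := by
  unfold wt
  rw [← ENNReal.ofReal_pow (by positivity)]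
  congr 1
  rw [← Real.rpow_natCast, ← Real.rpow_natCast, ← Real.rpow_mul (by norm_num), ← Real.rpow_mul (by norm_num)]
  congr 1; ring

lemma wt_sum {r : ℝ} (hr : r < 0) : ∑' n, wt r n < ∞ := by
  simp_rw [wt_eq]
  rw [ENNReal.tsum_geometric, ENNReal.inv_lt_top, tsub_pos_iff_lt, ENNReal.ofReal_lt_one]
  exact Real.rpow_lt_one_of_one_lt_of_neg (by norm_num) hr

lemma Wsum_neg (r X : ℝ) : Wsum r X ≤ ∑' n, wt r n :=
  ENNReal.tsum_le_tsum fun n => by split_ifs <;> simp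

lemma Wsum_pos {r : ℝ} (hr : 0 < r) : ∃ C : ℝ, 0 ≤ C ∧ ∀ X, 0 ≤ X → Wsum r X ≤ ENNReal.ofReal (C * X ^ r) := by
  have hq : 1 < (2:ℝ) ^ r := Real.one_lt_rpow (by norm_num) hr
  set q := (2:ℝ) ^ r with hqd
  have hq1 : 0 < q - 1 := by linarith
  refine ⟨q / (q - 1), by positivity, fun X hX => ?_⟩
  rcases lt_or_ge X 1 with h | h
  · have : Wsum r X = 0 := by
      unfold Wsum
      rw [ENNReal.tsum_eq_zero]
      intro n
      rw [if_neg]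
      have : (1:ℝ) ≤ 2 ^ n := one_le_pow₀ (by norm_num)
      linarith
    rw [this]; exact bot_le
  · obtain ⟨N, h1, h2⟩ := exists_nat_pow_near h (by norm_num : (1:ℝ) < 2)
    have : Wsum r X = ∑ n ∈ Finset.range (N + 1), if (2:ℝ) ^ n < X then wt r n else 0 := by
      unfold Wsum
      apply tsum_eq_sum
      intro n hn
      rw [if_neg]
      simp only [Finset.mem_range, not_lt] at hn
      have : (2:ℝ) ^ (N + 1) ≤ 2 ^ n := pow_le_pow_right₀ (by norm_num) hn
      linarith
    rw [this]
    calc _ ≤ ∑ n ∈ Finset.range (N + 1), ENNReal.ofReal (q ^ n) := by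
          apply Finset.sum_le_sum
          intro n _
          rw [wt_eq, ← ENNReal.ofReal_pow (by positivity)]
          split_ifs
          · exact le_rfl
          · exact bot_le
      _ = ENNReal.ofReal (∑ n ∈ Finset.range (N + 1), q ^ n) := by
          rw [ENNReal.ofReal_sum_of_nonneg]; intro i _; positivity
      _ ≤ _ := by
          apply ENNReal.ofReal_le_ofReal
          rw [geom_sum_eq hq.ne', div_mul_eq_mul_div]
          apply div_le_div_of_nonneg_right _ hq1.le
          have : q ^ N ≤ X ^ r := by
            rw [hqd, ← Real.rpow_natCast, ← Real.rpow_mul (by norm_num), mul_comm,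
              Real.rpow_mul (by norm_num), Real.rpow_natCast]
            exact Real.rpow_le_rpow (by positivity) h1 hr.le
          rw [pow_succ]
          nlinarith

lemma exists_dyadic {x : ℝ} (hx : 2 ≤ x) : ∃ n : ℕ, x / 4 < (2:ℝ) ^ n ∧ (2:ℝ) ^ n ≤ x / 2 := by
  obtain ⟨N, h1, h2⟩ := exists_nat_pow_near (by linarith : 1 ≤ x / 2) (by norm_num : (1:ℝ) < 2)
  exact ⟨N, by rw [pow_succ] at h2; linarith, h1⟩

lemma dyadic_rpow (r : ℝ) : ∃ c : ℝ, 0 < c ∧ ∀ x a : ℝ, 0 < x → x / 4 < a → a ≤ x / 2 → c * x ^ r ≤ a ^ r := by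
  rcases le_total 0 r with h | h
  · refine ⟨(1 / 4) ^ r, by positivity, fun x a hx h1 h2 => ?_⟩
    rw [← Real.mul_rpow (by norm_num) hx.le]
    exact Real.rpow_le_rpow (by positivity) (by linarith) h
  · refine ⟨1, one_pos, fun x a hx h1 h2 => ?_⟩
    rw [one_mul]
    exact Real.rpow_le_rpow_of_nonpos (by linarith) (by linarith) h

/-- summed strict gain -/
def Lsum (R R1 δ r : ℝ) (p : R3 × (R3 × S2)) : ℝ≥0∞ := ∑' n, wt r n * La R R1 δ (2 ^ n) p

/-- summed remainder -/
def Gsum (r : ℝ) (p : R3 × (R3 × S2)) : ℝ≥0∞ := ∑' n, wt r n * Ga (2 ^ n) p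

lemma sq_rpow (x : ℝ) (hx : 0 ≤ x) (r : ℝ) : (x ^ 2) ^ r = x ^ (2 * r) := by
  rw [← Real.rpow_natCast, ← Real.rpow_mul hx]; norm_num

open Classical in
lemma Lsum_lower {R R1 δ : ℝ} (hδ0 : 0 < δ) (hR1 : 2 ≤ R1) (r : ℝ) : ∃ c : ℝ, 0 < c ∧ ∀ p,
    (if Good R R1 δ p then ENNReal.ofReal (c * ‖p.1‖ ^ (2 * r + 2)) else 0) ≤ Lsum R R1 δ r p := by
  obtain ⟨c, hc, h⟩ := dyadic_rpow r
  refine ⟨c * (δ / 8), by positivity, fun p => ?_⟩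
  split_ifs with hp
  · have hv : 2 ≤ ‖p.1‖ := hR1.trans hp.2.1
    obtain ⟨n, h1, h2⟩ := exists_dyadic (x := ‖p.1‖ ^ 2) (by nlinarith)
    refine le_trans ?_ (ENNReal.le_tsum n)
    rw [La, if_pos ⟨hp, h1, h2⟩, wt, ← ENNReal.ofReal_mul (by positivity)]
    apply ENNReal.ofReal_le_ofReal
    have := h _ _ (by nlinarith) h1 h2
    rw [sq_rpow _ (norm_nonneg _)] at this
    rw [Real.rpow_add (by linarith)]
    norm_num
    calc _ = (c * ‖p.1‖ ^ (2 * r)) * (δ / 8 * ‖p.1‖ ^ 2) := by ring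
      _ ≤ _ := by gcongr
  · exact bot_le

lemma Gsum_eq (r : ℝ) (p : R3 × (R3 × S2)) : Gsum r p =
    Wsum r (‖p.1‖ ^ 2 + ‖p.2.1‖ ^ 2) * ENNReal.ofReal (min (‖p.1‖ ^ 2) (‖p.2.1‖ ^ 2)) := by
  unfold Gsum Wsum
  rw [← ENNReal.tsum_mul_right]
  congr 1; ext n
  unfold Ga
  split_ifs <;> simp

/-- convex moment function -/
def Psi (r : ℝ) (v : R3) : ℝ≥0∞ := ∑' n, wt r n * ENNReal.ofReal (‖v‖ ^ 2 - 2 ^ n)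

lemma Psi_upper {r : ℝ} (hr : 0 < r) : ∃ C : ℝ, 0 ≤ C ∧ ∀ v, Psi r v ≤ ENNReal.ofReal (C * ‖v‖ ^ (2 * r + 2)) := by
  obtain ⟨C, hC, h⟩ := Wsum_pos hr
  refine ⟨C, hC, fun v => ?_⟩
  calc Psi r v ≤ ∑' n, (if (2:ℝ) ^ n < ‖v‖ ^ 2 then wt r n else 0) * ENNReal.ofReal (‖v‖ ^ 2) := by
        apply ENNReal.tsum_le_tsum
        intro n
        split_ifs with h
        · gcongr
          have : (0:ℝ) ≤ 2 ^ n := by positivity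
          linarith
        · rw [ENNReal.ofReal_of_nonpos (by linarith)]; simp
    _ = Wsum r (‖v‖ ^ 2) * ENNReal.ofReal (‖v‖ ^ 2) := by rw [ENNReal.tsum_mul_right]; rfl
    _ ≤ ENNReal.ofReal (C * (‖v‖ ^ 2) ^ r) * ENNReal.ofReal (‖v‖ ^ 2) := by
        gcongr; exact h _ (by positivity)
    _ = _ := by
        rw [← ENNReal.ofReal_mul (by positivity), sq_rpow _ (norm_nonneg _)]
        congr 1
        rw [Real.rpow_add_of_nonneg (norm_nonneg _) (by linarith) (by norm_num)]
        norm_num; ring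

lemma Psi_lower {r : ℝ} (hr : 0 < r) : ∃ C : ℝ, 0 ≤ C ∧ ∀ v,
    ENNReal.ofReal (‖v‖ ^ (2 * r + 2)) ≤ ENNReal.ofReal C * (Psi r v + 1) := by
  obtain ⟨c, hc, h⟩ := dyadic_rpow r
  refine ⟨2 / c + 2 ^ (2 * r + 2), by positivity, fun v => ?_⟩
  rcases le_total (‖v‖) 2 with hv | hv
  · calc _ ≤ ENNReal.ofReal (2 / c + 2 ^ (2 * r + 2)) * 1 := by
          rw [mul_one]
          apply ENNReal.ofReal_le_ofReal
          have : ‖v‖ ^ (2 * r + 2) ≤ 2 ^ (2 * r + 2) := Real.rpow_le_rpow (norm_nonneg _) hv (by linarith)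
          have : 0 < 2 / c := by positivity
          linarith
      _ ≤ _ := by gcongr; exact le_add_self
  · obtain ⟨n, h1, h2⟩ := exists_dyadic (x := ‖v‖ ^ 2) (by nlinarith)
    have := h _ _ (by nlinarith) h1 h2
    rw [sq_rpow _ (norm_nonneg _)] at this
    calc _ ≤ ENNReal.ofReal (2 / c) * (wt r n * ENNReal.ofReal (‖v‖ ^ 2 - 2 ^ n)) := by
          rw [wt, ← ENNReal.ofReal_mul (by positivity), ← ENNReal.ofReal_mul (by positivity)]
          apply ENNReal.ofReal_le_ofReal
          rw [Real.rpow_add (by linarith)]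
          norm_num
          calc _ = 2 / c * ((c * ‖v‖ ^ (2 * r)) * (‖v‖ ^ 2 / 2)) := by field_simp
            _ ≤ _ := by gcongr; linarith
      _ ≤ _ := by
          gcongr
          · have : (0:ℝ) ≤ 2 ^ (2 * r + 2) := by positivity
            linarith
          · exact le_trans (ENNReal.le_tsum n) le_self_add

lemma hasFDerivAt_nrm {p : R3} (hp : p ≠ 0) :
    HasFDerivAt (fun x : R3 => ‖x‖) (‖p‖⁻¹ • innerSL ℝ p) p := by
  have h := (hasStrictFDerivAt_norm_sq p).hasFDerivAt
  have h2 := h.sqrt (by simpa using hp)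
  have e : (fun x : R3 => √(‖x‖ ^ 2)) = fun x => ‖x‖ := by
    funext x; exact Real.sqrt_sq (norm_nonneg _)
  rw [e] at h2
  have h0 : ‖p‖ ≠ 0 := by simpa using hp
  have e3 : (‖p‖⁻¹ • innerSL ℝ p : R3 →L[ℝ] ℝ) = (1 / (2 * √(‖p‖ ^ 2))) • 2 • innerSL ℝ p := by
    rw [Real.sqrt_sq (norm_nonneg _)]
    ext1 x
    simp
    field_simp
  rw [e3]; exact h2

/-- change of variables in the post-collisional velocity -/
def phiM (v : R3) (ω : S2) (p : R3) : R3 := v + (2⁻¹ : ℝ) • (p - ‖p‖ • (ω : R3))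

/-- derivative of `phiM` -/
def phiD (ω : S2) (p : R3) : R3 →L[ℝ] R3 :=
  (2⁻¹ : ℝ) • (ContinuousLinearMap.id ℝ R3 - (‖p‖⁻¹ • innerSL ℝ p).smulRight (ω : R3))

lemma phiM_deriv (v : R3) (ω : S2) {p : R3} (hp : p ≠ 0) : HasFDerivAt (phiM v ω) (phiD ω p) p := by
  unfold phiM phiD
  exact (((hasFDerivAt_id p).sub ((hasFDerivAt_nrm hp).smul_const (ω : R3))).const_smul (2⁻¹ : ℝ)).const_add v

lemma phiD_det (ω : S2) (p : R3) : (phiD ω p).det = 1 / 8 * (1 - ‖p‖⁻¹ * ⟪p, (ω : R3)⟫) := by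
  have e : ((phiD ω p : R3 →L[ℝ] R3) : R3 →ₗ[ℝ] R3) = (2⁻¹ : ℝ) •
      LinearMap.transvection ((-(‖p‖⁻¹ • innerSL ℝ p) : R3 →L[ℝ] ℝ) : R3 →ₗ[ℝ] ℝ) (ω : R3) := by
    ext1 x
    simp [phiD, LinearMap.transvection.apply, sub_eq_add_neg]
  rw [ContinuousLinearMap.det, e, LinearMap.det_smul, LinearMap.transvection.det]
  simp
  ring

lemma phiM_inj (v : R3) (ω : S2) : InjOn (phiM v ω) {p : R3 | p ≠ 0 ∧ ⟪p, (ω : R3)⟫ < ‖p‖} := by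
  rintro p ⟨hp, hpw⟩ q ⟨hq, hqw⟩ h
  have h1 : p - ‖p‖ • (ω : R3) = q - ‖q‖ • (ω : R3) := by
    have := add_left_cancel h
    exact smul_right_injective R3 (by norm_num : (2⁻¹ : ℝ) ≠ 0) this
  have hσ := norm_S2 ω
  have iσ : ⟪(ω : R3), (ω : R3)⟫ = 1 := by rw [real_inner_self_eq_norm_sq, hσ]; norm_num
  have a1 : ∀ p : R3, ‖p - ‖p‖ • (ω : R3)‖ ^ 2 = 2 * ‖p‖ * (‖p‖ - ⟪p, (ω : R3)⟫) := by
    intro p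
    rw [norm_sub_sq_real, norm_smul, inner_smul_right, hσ]; norm_num; ring
  have a2 : ∀ p : R3, ⟪p - ‖p‖ • (ω : R3), (ω : R3)⟫ = ⟪p, (ω : R3)⟫ - ‖p‖ := by
    intro p
    rw [inner_sub_left, inner_smul_left, iσ]; simp
  have b1 : ‖p - ‖p‖ • (ω : R3)‖ ^ 2 = ‖q - ‖q‖ • (ω : R3)‖ ^ 2 := by rw [h1]
  have b2 : ⟪p - ‖p‖ • (ω : R3), (ω : R3)⟫ = ⟪q - ‖q‖ • (ω : R3), (ω : R3)⟫ := by rw [h1]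
  rw [a1, a1] at b1
  rw [a2, a2] at b2
  have : ‖p‖ = ‖q‖ := by
    have hne : ‖p‖ - ⟪p, (ω : R3)⟫ ≠ 0 := by linarith
    apply mul_right_cancel₀ hne
    have : ‖p‖ - ⟪p, (ω : R3)⟫ = ‖q‖ - ⟪q, (ω : R3)⟫ := by linarith
    rw [← this] at b1
    linarith
  rw [this] at h1
  exact sub_left_injective h1

/-- region of non-grazing directions -/
def Sreg (δ : ℝ) (ω : S2) : Set R3 := {p : R3 | p ≠ 0 ∧ δ ≤ 1 - (‖p‖⁻¹ * ⟪p, (ω : R3)⟫) ^ 2}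

lemma measurable_Sreg (δ : ℝ) (ω : S2) : MeasurableSet (Sreg δ ω) := by
  apply MeasurableSet.inter
  · exact (measurableSet_singleton (0:R3)).compl
  · have h : Measurable (fun p : R3 => 1 - (‖p‖⁻¹ * ⟪p, (ω : R3)⟫) ^ 2) := by fun_prop
    exact measurableSet_le measurable_const h

lemma jac_bound {δ : ℝ} (hδ : 0 < δ) (v : R3) (ω : S2) (k : R3 → ℝ≥0∞) :
    ∫⁻ p in Sreg δ ω, k (phiM v ω p) ≤ ENNReal.ofReal (16 / δ) * ∫⁻ y, k y := by
  have hc : ∀ p ∈ Sreg δ ω, ‖p‖⁻¹ * ⟪p, (ω : R3)⟫ ≤ 1 - δ / 2 := by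
    rintro p ⟨hp, h⟩
    nlinarith [sq_nonneg (1 - ‖p‖⁻¹ * ⟪p, (ω : R3)⟫)]
  have hinj : InjOn (phiM v ω) (Sreg δ ω) := by
    refine (phiM_inj v ω).mono ?_
    intro p hp
    refine ⟨hp.1, ?_⟩
    have := hc p hp
    have hpos : 0 < ‖p‖ := norm_pos_iff.2 hp.1
    have h2 : ‖p‖⁻¹ * ⟪p, (ω : R3)⟫ < 1 := by linarith
    rwa [inv_mul_lt_iff₀ hpos, mul_one] at h2
  have := lintegral_image_eq_lintegral_abs_det_fderiv_mul (volume : Measure R3) (measurable_Sreg δ ω)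
    (fun p hp => (phiM_deriv v ω hp.1).hasFDerivWithinAt) hinj k
  calc _ ≤ ∫⁻ p in Sreg δ ω, ENNReal.ofReal (16 / δ) * (ENNReal.ofReal |(phiD ω p).det| * k (phiM v ω p)) := by
        refine setLIntegral_mono' (measurable_Sreg δ ω) fun p hp => ?_
        rw [← mul_assoc, ← ENNReal.ofReal_mul (by positivity)]
        conv_lhs => rw [← one_mul (k _)]
        gcongr
        rw [ENNReal.one_le_ofReal, phiD_det]
        have := hc p hp
        rw [abs_of_nonneg (by linarith)]
        rw [div_mul_eq_mul_div, le_div_iff₀ hδ]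
        linarith
    _ = ENNReal.ofReal (16 / δ) * ∫⁻ y in phiM v ω '' Sreg δ ω, k y := by
        rw [lintegral_const_mul' _ _ ENNReal.ofReal_ne_top, this]
    _ ≤ _ := by gcongr; exact Measure.restrict_le_self

lemma jac_bound_neg {δ : ℝ} (hδ : 0 < δ) (v : R3) (ω : S2) (k : R3 → ℝ≥0∞) :
    ∫⁻ p in Sreg δ ω, k (phiM v ω (-p)) ≤ ENNReal.ofReal (16 / δ) * ∫⁻ y, k y := by
  refine le_trans (le_of_eq ?_) (jac_bound hδ v ω k)
  rw [← lintegral_indicator (measurable_Sreg δ ω), ← lintegral_indicator (measurable_Sreg δ ω)]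
  rw [← lintegral_neg_eq_self]
  congr 1; ext p
  have : -p ∈ Sreg δ ω ↔ p ∈ Sreg δ ω := by
    simp only [Sreg, mem_ofPred_eq, norm_neg, inner_neg_left, mul_neg, neg_sq, ne_eq, neg_eq_zero]
  by_cases h : p ∈ Sreg δ ω
  · rw [indicator_of_mem (this.2 h), indicator_of_mem h, neg_neg]
  · rw [indicator_of_notMem (fun hh => h (this.1 hh)), indicator_of_notMem h]

lemma cap_geom {v : R3} {R η r : ℝ} (hv : v ≠ 0) (hη : R ^ 2 ≤ η * ‖v‖ ^ 2) (ω : S2)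
    (h : ‖v - r • (ω : R3)‖ ≤ R) : 1 - ⟪(nrm v : R3), (ω : R3)⟫ ^ 2 ≤ η := by
  have hσ := norm_S2 ω
  have hpos : 0 < ‖v‖ := norm_pos_iff.2 hv
  have h2 : ‖v - r • (ω : R3)‖ ^ 2 ≤ R ^ 2 := pow_le_pow_left₀ (norm_nonneg _) h 2
  rw [norm_sub_sq_real, norm_smul, inner_smul_right, hσ, mul_one, Real.norm_eq_abs, sq_abs] at h2
  rw [nrm_coe hv, inner_smul_left, conj_trivial]
  have : ‖v‖ ^ 2 - ⟪v, (ω : R3)⟫ ^ 2 ≤ η * ‖v‖ ^ 2 := by nlinarith [sq_nonneg (r - ⟪v, (ω : R3)⟫)]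
  have e : 1 - (‖v‖⁻¹ * ⟪v, (ω : R3)⟫) ^ 2 = (‖v‖ ^ 2 - ⟪v, (ω : R3)⟫ ^ 2) / ‖v‖ ^ 2 := by field_simp
  rw [e, div_le_iff₀ (by positivity)]
  exact this

lemma S_form {F : R3 × S2 → ℝ≥0∞} (hF : Measurable F) (v : R3) :
    ∫⁻ w, ∫⁻ σ, F (w, σ) ∂sphMeasure =
      ∫⁻ ω : S2, (∫⁻ p : R3, F (v - ‖p‖ • (ω : R3), nrm p)) ∂sphMeasure := by
  rw [← lintegral_sub_left_eq_self _ v]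
  have hF' : Measurable (fun q : R3 × S2 => F (v - q.1, q.2)) := hF.comp (by fun_prop)
  rw [← lintegral_prod (fun q : R3 × S2 => F (v - q.1, q.2)) hF'.aemeasurable,
    ← Smap_preserving.lintegral_comp hF']
  exact lintegral_prod_symm _ (hF'.comp measurable_Smap).aemeasurable

lemma cos_S {v : R3} {ω : S2} {p : R3} (hp : p ≠ 0) :
    cosAngle v (v - ‖p‖ • (ω : R3)) (nrm p) = ‖p‖⁻¹ * ⟪p, (ω : R3)⟫ := by
  have : ‖p‖ ≠ 0 := by simpa using hp
  rw [cosAngle, sub_sub_cancel, norm_smul, norm_S2, nrm_coe hp, inner_smul_left, inner_smul_left,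
    inner_smul_right, real_inner_comm]
  simp only [norm_norm, mul_one, conj_trivial]
  field_simp

lemma vOut_S {v : R3} {ω : S2} {p : R3} (hp : p ≠ 0) :
    vOut v (v - ‖p‖ • (ω : R3)) (nrm p) = phiM v ω p := by
  have : ‖p‖ ≠ 0 := by simpa using hp
  rw [vOut, sub_sub_cancel, norm_smul, norm_S2, nrm_coe hp, phiM, smul_smul]
  simp only [norm_norm, mul_one]
  rw [show ‖p‖ / 2 * ‖p‖⁻¹ = 2⁻¹ by field_simp]
  module

lemma vOutStar_S {v : R3} {ω : S2} {p : R3} (hp : p ≠ 0) :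
    vOutStar v (v - ‖p‖ • (ω : R3)) (nrm p) = phiM v ω (-p) := by
  have : ‖p‖ ≠ 0 := by simpa using hp
  rw [vOutStar, sub_sub_cancel, norm_smul, norm_S2, nrm_coe hp, phiM, smul_smul]
  simp only [norm_norm, mul_one, norm_neg]
  rw [show ‖p‖ / 2 * ‖p‖⁻¹ = 2⁻¹ by field_simp]
  module

open Classical in
lemma Jbound {v : R3} {R δ η : ℝ} (hδ : 0 < δ) (hRv : R < ‖v‖) (hη : R ^ 2 ≤ η * ‖v‖ ^ 2)
    {k : R3 → ℝ≥0∞} (hk : Measurable k) :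
    (∫⁻ w, ∫⁻ σ, (if ‖w‖ ≤ R ∧ δ ≤ 1 - cosAngle v w σ ^ 2 then k (vOut v w σ) else 0) ∂sphMeasure ≤
      zon ({c : ℝ | 1 - c ^ 2 ≤ η}.indicator 1) * (ENNReal.ofReal (16 / δ) * ∫⁻ y, k y)) ∧
    (∫⁻ w, ∫⁻ σ, (if ‖w‖ ≤ R ∧ δ ≤ 1 - cosAngle v w σ ^ 2 then k (vOutStar v w σ) else 0) ∂sphMeasure ≤
      zon ({c : ℝ | 1 - c ^ 2 ≤ η}.indicator 1) * (ENNReal.ofReal (16 / δ) * ∫⁻ y, k y)) := by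
  have hv : v ≠ 0 ∨ R < 0 := by
    by_contra! hcon
    rw [hcon.1] at hRv
    simp at hRv; linarith [hcon.2]
  have hset : MeasurableSet {q : R3 × S2 | ‖q.1‖ ≤ R ∧ δ ≤ 1 - cosAngle v q.1 q.2 ^ 2} := by
    have mc : Measurable (fun q : R3 × S2 => cosAngle v q.1 q.2) := by
      unfold cosAngle; fun_prop
    refine MeasurableSet.inter (measurableSet_le (measurable_norm.comp measurable_fst) measurable_const) ?_
    have h : Measurable (fun q : R3 × S2 => 1 - cosAngle v q.1 q.2 ^ 2) := by fun_prop
    exact measurableSet_le measurable_const h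
  have mcap : Measurable ({c : ℝ | 1 - c ^ 2 ≤ η}.indicator (1 : ℝ → ℝ≥0∞)) := by
    have h : Measurable (fun c : ℝ => 1 - c ^ 2) := by fun_prop
    exact measurable_one.indicator (measurableSet_le h measurable_const)
  have main : ∀ (G : R3 × S2 → R3) (T : S2 → R3 → R3), Measurable G →
      (∀ (ω : S2) (p : R3), p ≠ 0 → G (v - ‖p‖ • (ω : R3), nrm p) = T ω p) →
      (∀ ω, ∫⁻ p in Sreg δ ω, k (T ω p) ≤ ENNReal.ofReal (16 / δ) * ∫⁻ y, k y) →
      (∫⁻ w, ∫⁻ σ, (if ‖w‖ ≤ R ∧ δ ≤ 1 - cosAngle v w σ ^ 2 then k (G (w, σ)) else 0) ∂sphMeasure ≤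
      zon ({c : ℝ | 1 - c ^ 2 ≤ η}.indicator 1) * (ENNReal.ofReal (16 / δ) * ∫⁻ y, k y)) := by
    intro G T hG hGT hT
    have mF : Measurable (fun q : R3 × S2 => if ‖q.1‖ ≤ R ∧ δ ≤ 1 - cosAngle v q.1 q.2 ^ 2 then k (G q) else 0) :=
      Measurable.ite hset (hk.comp hG) measurable_const
    rw [S_form mF v]
    have b : ∀ ω : S2, (∫⁻ p : R3, (if ‖v - ‖p‖ • (ω : R3)‖ ≤ R ∧
        δ ≤ 1 - cosAngle v (v - ‖p‖ • (ω : R3)) (nrm p) ^ 2 then k (G (v - ‖p‖ • (ω : R3), nrm p)) else 0)) ≤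
        {c : ℝ | 1 - c ^ 2 ≤ η}.indicator 1 ⟪(nrm v : R3), (ω : R3)⟫ * (ENNReal.ofReal (16 / δ) * ∫⁻ y, k y) := by
      intro ω
      calc _ ≤ ∫⁻ p : R3, {c : ℝ | 1 - c ^ 2 ≤ η}.indicator 1 ⟪(nrm v : R3), (ω : R3)⟫ *
            (Sreg δ ω).indicator (fun p => k (T ω p)) p := by
            refine lintegral_mono fun p => ?_
            split_ifs with h
            · have hR0 : 0 ≤ R := (norm_nonneg _).trans h.1
              have hv0 : v ≠ 0 := hv.resolve_right (by linarith)
              have hp : p ≠ 0 := by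
                rintro rfl
                have := h.1
                simp at this; linarith
              have hcap := cap_geom hv0 hη ω h.1
              have h2 := h.2
              rw [cos_S hp] at h2
              rw [indicator_of_mem (show _ ∈ {c : ℝ | 1 - c ^ 2 ≤ η} from hcap),
                indicator_of_mem (show p ∈ Sreg δ ω from ⟨hp, h2⟩), hGT ω p hp]
              simp
            · exact bot_le
        _ = {c : ℝ | 1 - c ^ 2 ≤ η}.indicator 1 ⟪(nrm v : R3), (ω : R3)⟫ * ∫⁻ p in Sreg δ ω, k (T ω p) := by
            rw [lintegral_const_mul' _ _ (by rw [indicator]; split_ifs <;> simp),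
              lintegral_indicator (measurable_Sreg δ ω)]
        _ ≤ _ := by gcongr; exact hT ω
    refine (lintegral_mono b).trans ?_
    have m2 : Measurable (fun ω : S2 => {c : ℝ | 1 - c ^ 2 ≤ η}.indicator (1 : ℝ → ℝ≥0∞) ⟪(nrm v : R3), (ω : R3)⟫) :=
      mcap.comp (by fun_prop)
    rw [lintegral_mul_const _ m2, zonal (nrm v) _ mcap]
  constructor
  · exact main (fun q => vOut v q.1 q.2) (fun ω p => phiM v ω p) (by unfold vOut; fun_prop)
      (fun ω p hp => vOut_S hp) (fun ω => jac_bound hδ v ω k)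
  · exact main (fun q => vOutStar v q.1 q.2) (fun ω p => phiM v ω (-p)) (by unfold vOutStar; fun_prop)
      (fun ω p hp => vOutStar_S hp) (fun ω => jac_bound_neg hδ v ω k)

/-- Loss frequency integrand -/
def Lw (h : R3 → ℝ) (v w : R3) (σ : S2) : ℝ := h w * (1 - h (vOut v w σ)) * (1 - h (vOutStar v w σ))

lemma mass_ball {h : R3 → ℝ} (hh : Measurable h) {m E : ℝ≥0∞} (hm : m < ∞) {R : ℝ} (hR : 0 < R)
    (hRE : ENNReal.ofReal ((R ^ 2)⁻¹) * E ≤ m / 2) (h1 : Mq 0 h = m) (h2 : Mq 2 h ≤ E) :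
    m / 2 ≤ ∫⁻ w in {w : R3 | ‖w‖ ≤ R}, ENNReal.ofReal (h w) := by
  have hs : MeasurableSet {w : R3 | ‖w‖ ≤ R} := measurableSet_le measurable_norm measurable_const
  have e : m = (∫⁻ w in {w : R3 | ‖w‖ ≤ R}, ENNReal.ofReal (h w)) +
      ∫⁻ w in {w : R3 | ‖w‖ ≤ R}ᶜ, ENNReal.ofReal (h w) := by
    rw [lintegral_add_compl _ hs, ← h1]; simp [Mq]
  have t : ∫⁻ w in {w : R3 | ‖w‖ ≤ R}ᶜ, ENNReal.ofReal (h w) ≤ m / 2 := by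
    calc _ ≤ ∫⁻ w in {w : R3 | ‖w‖ ≤ R}ᶜ, ENNReal.ofReal ((R ^ 2)⁻¹) *
          (ENNReal.ofReal (h w) * ENNReal.ofReal (‖w‖ ^ (2:ℝ))) := by
          refine setLIntegral_mono' hs.compl fun w hw => ?_
          have hw' : R < ‖w‖ := by simpa using hw
          rw [mul_left_comm, ← ENNReal.ofReal_mul (by positivity)]
          conv_lhs => rw [← mul_one (ENNReal.ofReal (h w))]
          gcongr
          rw [ENNReal.one_le_ofReal, inv_mul_eq_div, le_div_iff₀ (by positivity), one_mul]
          norm_num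
          exact pow_le_pow_left₀ hR.le hw'.le 2
      _ = ENNReal.ofReal ((R ^ 2)⁻¹) * ∫⁻ w in {w : R3 | ‖w‖ ≤ R}ᶜ,
          (ENNReal.ofReal (h w) * ENNReal.ofReal (‖w‖ ^ (2:ℝ))) := by
          rw [lintegral_const_mul' _ _ ENNReal.ofReal_ne_top]
      _ ≤ ENNReal.ofReal ((R ^ 2)⁻¹) * Mq 2 h := by
          unfold Mq; gcongr; exact Measure.restrict_le_self
      _ ≤ _ := by refine le_trans ?_ hRE; gcongr
  have hm2 : m / 2 ≠ ∞ := (ENNReal.div_lt_top hm.ne (by simp)).ne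
  refine (ENNReal.add_le_add_iff_right hm2).1 ?_
  rw [ENNReal.add_halves]
  calc m = _ := e
    _ ≤ _ := by gcongr

open Classical in
lemma coercive1 {b : ℝ → ℝ} (hb : GradCutoff b) {h : R3 → ℝ} (hh : Measurable h)
    (h0 : ∀ v, 0 ≤ h v) (h1 : ∀ v, h v ≤ 1) {m E : ℝ≥0∞} (hm : m < ∞) {R δ N η : ℝ} (hR : 0 < R)
    (hRE : ENNReal.ofReal ((R ^ 2)⁻¹) * E ≤ m / 2) (hhm : Mq 0 h = m) (hhE : Mq 2 h ≤ E)
    (hδ : 0 < δ) (hN : 0 ≤ N) 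
    (hcap : ENNReal.ofReal (32 * N / δ) * zon ({c : ℝ | 1 - c ^ 2 ≤ η}.indicator 1) ≤ zon (btr b δ N) / 4)
    {v : R3} (hRv : R < ‖v‖) (hη : R ^ 2 ≤ η * ‖v‖ ^ 2) :
    zon (btr b δ N) * m / 4 ≤ ∫⁻ w in {w : R3 | ‖w‖ ≤ R}, ∫⁻ σ, btr b δ N (cosAngle v w σ) *
      ENNReal.ofReal (Lw h v w σ) ∂sphMeasure := by
  have hs : MeasurableSet {w : R3 | ‖w‖ ≤ R} := measurableSet_le measurable_norm measurable_const
  have mc : Measurable (fun q : R3 × S2 => cosAngle v q.1 q.2) := by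
    unfold cosAngle; fun_prop
  have mo : Measurable (fun q : R3 × S2 => vOut v q.1 q.2) := by unfold vOut; fun_prop
  have ms : Measurable (fun q : R3 × S2 => vOutStar v q.1 q.2) := by unfold vOutStar; fun_prop
  have mbt := measurable_btr hb.measurable δ N
  have mF1 : Measurable (fun q : R3 × S2 => btr b δ N (cosAngle v q.1 q.2) *
      ENNReal.ofReal (Lw h v q.1 q.2)) := by
    have a1 := mbt.comp mc
    have a2 := hh.comp mo
    have a3 := hh.comp ms
    have a4 := hh.comp (measurable_fst : Measurable (Prod.fst : R3 × S2 → R3))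
    simp only [Function.comp_def] at a1 a2 a3 a4
    unfold Lw
    exact a1.mul ((a4.mul (measurable_const.sub a2)).mul (measurable_const.sub a3)).ennreal_ofReal
  have hset : MeasurableSet {q : R3 × S2 | ‖q.1‖ ≤ R ∧ δ ≤ 1 - cosAngle v q.1 q.2 ^ 2} := by
    refine MeasurableSet.inter (measurableSet_le (measurable_norm.comp measurable_fst) measurable_const) ?_
    exact measurableSet_le measurable_const (measurable_const.sub (mc.pow_const 2))
  have mi0 : Measurable (fun q : R3 × S2 => if ‖q.1‖ ≤ R ∧ δ ≤ 1 - cosAngle v q.1 q.2 ^ 2 then ENNReal.ofReal (h (vOut v q.1 q.2)) else 0) := by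
    have a2 := hh.comp mo
    simp only [Function.comp_def] at a2
    exact Measurable.ite hset a2.ennreal_ofReal measurable_const
  obtain ⟨J1, J2⟩ := Jbound hδ hRv hη hh.ennreal_ofReal
  have hk : ∫⁻ y, ENNReal.ofReal (h y) = m := by rw [← hhm]; simp [Mq]
  rw [hk] at J1 J2
  set I := ∫⁻ w in {w : R3 | ‖w‖ ≤ R}, ∫⁻ σ, btr b δ N (cosAngle v w σ) *
      ENNReal.ofReal (Lw h v w σ) ∂sphMeasure with hI
  set Z := zon (btr b δ N) with hZ
  set cp := zon ({c : ℝ | 1 - c ^ 2 ≤ η}.indicator 1) with hcp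
  have hZt : Z < ∞ := by
    refine lt_of_le_of_lt (zon_mono fun c => ?_) (zon_b_lt_top hb)
    unfold btr
    split_ifs
    · exact ENNReal.ofReal_le_ofReal (min_le_left _ _)
    · exact bot_le
  have A : Z * (m / 2) ≤ I + Z / 4 * m := by
    calc Z * (m / 2) ≤ Z * ∫⁻ w in {w : R3 | ‖w‖ ≤ R}, ENNReal.ofReal (h w) := by
          gcongr; exact mass_ball hh hm hR hRE hhm hhE
      _ = ∫⁻ w in {w : R3 | ‖w‖ ≤ R}, Z * ENNReal.ofReal (h w) := by
          rw [lintegral_const_mul _ hh.ennreal_ofReal]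
      _ = ∫⁻ w in {w : R3 | ‖w‖ ≤ R}, ∫⁻ σ, btr b δ N (cosAngle v w σ) * ENNReal.ofReal (h w) ∂sphMeasure := by
          refine setLIntegral_congr_fun hs fun w hw => ?_
          have hvw : v ≠ w := by
            rintro rfl
            exact absurd hRv (not_lt.2 hw)
          have hsw : Measurable fun σ : S2 => (w, σ) := measurable_const.prodMk measurable_id
          have mb1 := mbt.comp (mc.comp hsw)
          simp only [Function.comp_def] at mb1
          show Z * ENNReal.ofReal (h w) = ∫⁻ σ, btr b δ N (cosAngle v w σ) * ENNReal.ofReal (h w) ∂sphMeasure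
          rw [lintegral_mul_const _ mb1, angular mbt hvw]
      _ ≤ ∫⁻ w in {w : R3 | ‖w‖ ≤ R}, ((∫⁻ σ, btr b δ N (cosAngle v w σ) *
          ENNReal.ofReal (Lw h v w σ) ∂sphMeasure) + ENNReal.ofReal N * 
          ((∫⁻ σ, (if ‖w‖ ≤ R ∧ δ ≤ 1 - cosAngle v w σ ^ 2 then ENNReal.ofReal (h (vOut v w σ)) else 0) ∂sphMeasure) +
          ∫⁻ σ, (if ‖w‖ ≤ R ∧ δ ≤ 1 - cosAngle v w σ ^ 2 then ENNReal.ofReal (h (vOutStar v w σ)) else 0) ∂sphMeasure)) := by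
          refine setLIntegral_mono' hs fun w hw => ?_
          have hsw : Measurable fun σ : S2 => (w, σ) := measurable_const.prodMk measurable_id
          have mi := mi0.comp hsw
          have m1 := mF1.comp hsw
          simp only [Function.comp_def] at mi m1
          rw [← lintegral_add_left mi, ← lintegral_const_mul' _ _ ENNReal.ofReal_ne_top,
            ← lintegral_add_left m1]
          refine lintegral_mono fun σ => ?_
          by_cases hc : δ ≤ 1 - cosAngle v w σ ^ 2
          · rw [if_pos ⟨hw, hc⟩, if_pos ⟨hw, hc⟩]
            have hbN : btr b δ N (cosAngle v w σ) ≤ ENNReal.ofReal N := by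
              unfold btr; rw [if_pos hc]; exact ENNReal.ofReal_le_ofReal (min_le_right _ _)
            have i1 := h0 w
            have i2 := h1 w
            have i3 := h0 (vOut v w σ)
            have i4 := h0 (vOutStar v w σ)
            have i5 := h1 (vOut v w σ)
            have i6 := h1 (vOutStar v w σ)
            have hL : 0 ≤ Lw h v w σ := by
              unfold Lw
              exact mul_nonneg (mul_nonneg i1 (by linarith)) (by linarith)
            calc _ ≤ btr b δ N (cosAngle v w σ) * (ENNReal.ofReal (Lw h v w σ) +
                  (ENNReal.ofReal (h (vOut v w σ)) + ENNReal.ofReal (h (vOutStar v w σ)))) := by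
                  gcongr
                  rw [← ENNReal.ofReal_add i3 i4, ← ENNReal.ofReal_add hL (by linarith)]
                  apply ENNReal.ofReal_le_ofReal
                  unfold Lw
                  nlinarith [mul_nonneg i1 (mul_nonneg i3 i4), mul_nonneg (sub_nonneg.2 i2) i3,
                    mul_nonneg (sub_nonneg.2 i2) i4]
              _ ≤ _ := by rw [mul_add]; gcongr
          · have : btr b δ N (cosAngle v w σ) = 0 := by unfold btr; rw [if_neg hc]
            rw [this]; simp
      _ ≤ I + ENNReal.ofReal N * (cp * (ENNReal.ofReal (16 / δ) * m) + cp * (ENNReal.ofReal (16 / δ) * m)) := by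
          rw [lintegral_add_left mF1.lintegral_prod_right', lintegral_const_mul' _ _ ENNReal.ofReal_ne_top]
          rw [lintegral_add_left mi0.lintegral_prod_right']
          gcongr
          · exact le_trans (lintegral_mono' Measure.restrict_le_self le_rfl) J1
          · exact le_trans (lintegral_mono' Measure.restrict_le_self le_rfl) J2
      _ = I + (ENNReal.ofReal (32 * N / δ) * cp) * m := by
          congr 1
          have : ENNReal.ofReal (32 * N / δ) = ENNReal.ofReal N * (ENNReal.ofReal (16 / δ) + ENNReal.ofReal (16 / δ)) := by
            rw [← ENNReal.ofReal_add (by positivity) (by positivity), ← ENNReal.ofReal_mul hN]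
            congr 1; ring
          rw [this]; ring
      _ ≤ _ := by gcongr
  have hfin : Z / 4 * m ≠ ∞ := ENNReal.mul_ne_top (ENNReal.div_lt_top hZt.ne (by simp)).ne hm.ne
  refine (ENNReal.add_le_add_iff_right hfin).1 (le_trans (le_of_eq ?_) A)
  rw [div_eq_mul_inv, div_eq_mul_inv, div_eq_mul_inv]
  have : (2:ℝ≥0∞)⁻¹ = 4⁻¹ + 4⁻¹ := by
    rw [← ENNReal.toReal_eq_toReal_iff' (by simp) (by simp), ENNReal.toReal_add (by simp) (by simp)]
    norm_num
  rw [this]; ring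

lemma FL_eq_Lw (h : R3 → ℝ) (v w : R3) (σ : S2) : FL h (v, w, σ) = h v * Lw h v w σ := by
  unfold FL Lw vo vs; ring

lemma coercive_const {b : ℝ → ℝ} (hb : GradCutoff b) {m E : ℝ≥0∞} (hm0 : m ≠ 0) (hm : m < ∞) (hE : E < ∞) :
    ∃ R R1 δ N : ℝ, 0 < R ∧ 0 < δ ∧ δ ≤ 1 ∧ R ≤ δ / 32 * R1 ∧ 2 ≤ R1 ∧ 2 * R ≤ R1 ∧
      0 < zon (btr b δ N) ∧ zon (btr b δ N) < ∞ ∧ ∀ h : R3 → ℝ, Measurable h → (∀ v, 0 ≤ h v) → (∀ v, h v ≤ 1) →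
      Mq 0 h = m → Mq 2 h ≤ E → ∀ v : R3, R1 ≤ ‖v‖ →
      zon (btr b δ N) * m / 4 ≤ ∫⁻ w in {w : R3 | ‖w‖ ≤ R}, ∫⁻ σ, btr b δ N (cosAngle v w σ) *
        ENNReal.ofReal (Lw h v w σ) ∂sphMeasure := by
  obtain ⟨δ, N, hδ0, hδ1, hN, hZ⟩ := exists_btr hb
  have hZt : zon (btr b δ N) < ∞ := by
    refine lt_of_le_of_lt (zon_mono fun c => ?_) (zon_b_lt_top hb)
    unfold btr
    split_ifs
    · exact ENNReal.ofReal_le_ofReal (min_le_left _ _)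
    · exact bot_le
  obtain ⟨η, hη, hcap⟩ := zon_cap (zon (btr b δ N) / 4 / ENNReal.ofReal (32 * N / δ))
    (ENNReal.div_pos (ENNReal.div_pos hZ.ne' (by simp)).ne' ENNReal.ofReal_ne_top)
  have hm' : 0 < m.toReal := ENNReal.toReal_pos hm0 hm.ne
  set R2 : ℝ := 2 * E.toReal / m.toReal + 1 with hR2
  have hR2p : 0 < R2 := by positivity
  set R := √R2 with hRd
  have hR : 0 < R := Real.sqrt_pos.2 hR2p
  have hRs : R ^ 2 = R2 := Real.sq_sqrt hR2p.le
  have hsη : 0 < √η := Real.sqrt_pos.2 hη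
  have p1 : 0 < 32 * R / δ := by positivity
  have p2 : 0 < R / √η := by positivity
  refine ⟨R, 2 + 2 * R + 32 * R / δ + R / √η, δ, N, hR, hδ0, hδ1, ?_, by linarith, by linarith, hZ, hZt, ?_⟩
  · have : δ / 32 * (32 * R / δ) = R := by field_simp
    have h2 : 0 ≤ δ / 32 * (2 + 2 * R + R / √η) := by positivity
    nlinarith
  · intro h hh h0 h1 hhm hhE v hv
    refine coercive1 (η := η) hb hh h0 h1 hm hR ?_ hhm hhE hδ0 hN ?_ (by linarith) ?_
    · rw [hRs, ← ENNReal.ofReal_toReal hE.ne, ← ENNReal.ofReal_toReal hm.ne,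
        show (2:ℝ≥0∞) = ENNReal.ofReal 2 by simp, ← ENNReal.ofReal_div_of_pos (by norm_num),
        ← ENNReal.ofReal_mul (by positivity)]
      apply ENNReal.ofReal_le_ofReal
      rw [inv_mul_eq_div, div_le_iff₀ hR2p, hR2]
      have : m.toReal / 2 * (2 * E.toReal / m.toReal + 1) = E.toReal + m.toReal / 2 := by field_simp
      rw [this]; linarith
    · calc _ ≤ ENNReal.ofReal (32 * N / δ) * (zon (btr b δ N) / 4 / ENNReal.ofReal (32 * N / δ)) := by gcongr
        _ ≤ _ := ENNReal.mul_div_le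
    · have h3 : R ≤ √η * ‖v‖ := by
        have : R / √η ≤ ‖v‖ := by linarith
        rwa [div_le_iff₀ hsη, mul_comm] at this
      calc R ^ 2 ≤ (√η * ‖v‖) ^ 2 := pow_le_pow_left₀ hR.le h3 2
        _ = _ := by rw [mul_pow, Real.sq_sqrt hη.le]

lemma measurableSet_Good (R R1 δ : ℝ) : MeasurableSet {p : R3 × (R3 × S2) | Good R R1 δ p} := by
  have mc := measurable_cosAngle
  have m1 : Measurable fun p : R3 × (R3 × S2) => ‖p.2.1‖ := by fun_prop
  have m2 : Measurable fun p : R3 × (R3 × S2) => ‖p.1‖ := by fun_prop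
  have m3 : Measurable fun p : R3 × (R3 × S2) => 1 - cosAngle p.1 p.2.1 p.2.2 ^ 2 :=
    measurable_const.sub (mc.pow_const 2)
  exact (measurableSet_le m1 measurable_const).inter ((measurableSet_le measurable_const m2).inter
    (measurableSet_le measurable_const m3))

open Classical in
lemma coercive {γ : ℝ} (hγ : 0 < γ) {b : ℝ → ℝ} (hb : GradCutoff b) {m E : ℝ≥0∞} (hm0 : m ≠ 0) (hm : m < ∞) (hE : E < ∞) :
    ∃ R R1 δ c : ℝ, 0 < δ ∧ δ ≤ 1 ∧ R ≤ δ / 32 * R1 ∧ 2 ≤ R1 ∧ 0 < c ∧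
      ∀ h : R3 → ℝ, Measurable h → (∀ v, 0 ≤ h v) → (∀ v, h v ≤ 1) →
      Mq 0 h = m → Mq 2 h ≤ E → ∀ φ : R3 → ℝ≥0∞, Measurable φ →
      ∫⁻ v, ENNReal.ofReal (h v) * (φ v * (if R1 ≤ ‖v‖ then ENNReal.ofReal (c * ‖v‖ ^ γ) else 0)) ≤
      Kg γ b h (fun p => if Good R R1 δ p then φ p.1 else 0) := by
  obtain ⟨R, R1, δ, N, hR, hδ0, hδ1, hR1, hR12, hRR, hZ, hZt, H⟩ := coercive_const hb hm0 hm hE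
  set Z := zon (btr b δ N)
  have hq : Z * m / 4 ≠ ∞ := (ENNReal.div_lt_top (ENNReal.mul_lt_top hZt hm).ne (by simp)).ne
  have hq0 : Z * m / 4 ≠ 0 := (ENNReal.div_pos (mul_ne_zero hZ.ne' hm0) (by simp)).ne'
  have hqp := ENNReal.toReal_pos hq0 hq
  refine ⟨R, R1, δ, (Z * m / 4).toReal / 2 ^ γ, hδ0, hδ1, hR1, hR12, by positivity, ?_⟩
  intro h hh h0 h1 hhm hhE φ hφ
  have mF : Measurable (fun p : R3 × (R3 × S2) => BE γ b p * ENNReal.ofReal (FL h p) *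
      (if Good R R1 δ p then φ p.1 else 0)) :=
    ((measurable_BE γ hb).mul (measurable_FL hh).ennreal_ofReal).mul
      (Measurable.ite (measurableSet_Good R R1 δ) (hφ.comp measurable_fst) measurable_const)
  unfold Kg Pm
  have : SigmaFinite sphMeasure := IsFiniteMeasure.toSigmaFinite _
  rw [lintegral_prod _ mF.aemeasurable]
  refine lintegral_mono fun v => ?_
  by_cases hv : R1 ≤ ‖v‖
  swap
  · rw [if_neg hv]; simp
  rw [if_pos hv]
  have mFv := mF.comp (measurable_const.prodMk measurable_id : Measurable fun q : R3 × S2 => (v, q))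
  simp only [Function.comp_def] at mFv
  rw [lintegral_prod _ mFv.aemeasurable]
  have hs : MeasurableSet {w : R3 | ‖w‖ ≤ R} := measurableSet_le measurable_norm measurable_const
  set K := ENNReal.ofReal (h v) * (φ v * ENNReal.ofReal ((‖v‖ / 2) ^ γ)) with hK
  calc _ = K * (Z * m / 4) := by
        rw [hK, mul_assoc, mul_assoc]
        congr 2
        conv_rhs => rw [← ENNReal.ofReal_toReal hq]
        rw [← ENNReal.ofReal_mul (by positivity), Real.div_rpow (norm_nonneg v) (by norm_num)]
        congr 1; ring
    _ ≤ K * ∫⁻ w in {w : R3 | ‖w‖ ≤ R}, ∫⁻ σ, btr b δ N (cosAngle v w σ) *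
        ENNReal.ofReal (Lw h v w σ) ∂sphMeasure := by gcongr; exact H h hh h0 h1 hhm hhE v hv
    _ ≤ ∫⁻ w in {w : R3 | ‖w‖ ≤ R}, K * ∫⁻ σ, btr b δ N (cosAngle v w σ) *
        ENNReal.ofReal (Lw h v w σ) ∂sphMeasure := lintegral_const_mul_le _ _
    _ ≤ ∫⁻ w in {w : R3 | ‖w‖ ≤ R}, ∫⁻ σ, BE γ b (v, w, σ) * ENNReal.ofReal (FL h (v, w, σ)) *
          (if Good R R1 δ (v, w, σ) then φ v else 0) ∂sphMeasure := by
        refine setLIntegral_mono' hs fun w hw => ?_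
        refine le_trans (lintegral_const_mul_le _ _) (lintegral_mono fun σ => ?_)
        show K * (btr b δ N (cosAngle v w σ) * ENNReal.ofReal (Lw h v w σ)) ≤ _
        by_cases hc : δ ≤ 1 - cosAngle v w σ ^ 2
        · have hw' : ‖w‖ ≤ R := hw
          have hg : Good R R1 δ (v, w, σ) := ⟨hw, hv, hc⟩
          rw [if_pos hg]
          have hB : ENNReal.ofReal ((‖v‖ / 2) ^ γ) * btr b δ N (cosAngle v w σ) ≤ BE γ b (v, w, σ) := by
            unfold btr BE Bker
            rw [if_pos hc, ← ENNReal.ofReal_mul (by positivity)]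
            apply ENNReal.ofReal_le_ofReal
            have h3 : ‖v‖ / 2 ≤ ‖v - w‖ := by
              have := norm_sub_norm_le v w
              linarith
            have hbn := hb.nonneg (cosAngle v w σ)
            calc _ ≤ (‖v‖ / 2) ^ γ * b (cosAngle v w σ) := by
                  gcongr; exact min_le_left _ _
              _ ≤ ‖v - w‖ ^ γ * b (cosAngle v w σ) := by
                  gcongr
          rw [FL_eq_Lw, ENNReal.ofReal_mul (h0 v)]
          calc _ = (ENNReal.ofReal ((‖v‖ / 2) ^ γ) * btr b δ N (cosAngle v w σ)) *
                (ENNReal.ofReal (h v) * ENNReal.ofReal (Lw h v w σ)) * φ v := by rw [hK]; ring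
            _ ≤ _ := by gcongr
        · have : btr b δ N (cosAngle v w σ) = 0 := by unfold btr; rw [if_neg hc]
          rw [this]; simp
    _ ≤ _ := lintegral_mono' Measure.restrict_le_self le_rfl

lemma gain_gen {γ : ℝ} {b : ℝ → ℝ} (hb : GradCutoff b)
    {h : R3 → ℝ} (hh : Measurable h) (h0 : ∀ v, 0 ≤ h v) (h1 : ∀ v, h v ≤ 1)
    {φ : R3 → R3 → ℝ≥0∞} (hφ : Measurable (fun q : R3 × R3 => φ q.1 q.2))
    {α β : R3 → ℝ≥0∞} (hα : Measurable α) (hβ : Measurable β) {K : ℝ≥0∞}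
    (hK : ∀ v w, ENNReal.ofReal (‖v - w‖ ^ γ) * φ v w ≤ K * (α v * β w + β v * α w)) :
    Kg γ b h (fun p => φ p.1 p.2.1) ≤ zon (fun c => ENNReal.ofReal (b c)) * (2 * K) *
      ((∫⁻ v, ENNReal.ofReal (h v) * α v) * ∫⁻ v, ENNReal.ofReal (h v) * β v) := by
  have mh := hh.ennreal_ofReal
  have mα := mh.mul hα
  have mβ := mh.mul hβ
  simp only [Pi.mul_def] at mα mβ
  unfold Kg
  refine le_trans (K_upper hb hh h0 h1 hφ) ?_
  rw [mul_assoc (zon _)]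
  gcongr
  set A := ∫⁻ v, ENNReal.ofReal (h v) * α v
  set B := ∫⁻ v, ENNReal.ofReal (h v) * β v
  calc _ ≤ ∫⁻ v, ∫⁻ w, (K * (ENNReal.ofReal (h v) * α v) * (ENNReal.ofReal (h w) * β w) +
        K * (ENNReal.ofReal (h v) * β v) * (ENNReal.ofReal (h w) * α w)) := by
        refine lintegral_mono fun v => lintegral_mono fun w => ?_
        calc _ = ENNReal.ofReal (h v) * ENNReal.ofReal (h w) * (ENNReal.ofReal (‖v - w‖ ^ γ) * φ v w) := by ring
          _ ≤ ENNReal.ofReal (h v) * ENNReal.ofReal (h w) * (K * (α v * β w + β v * α w)) :=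
            mul_le_mul_right (hK v w) _
          _ = _ := by ring
    _ = ∫⁻ v, (K * (ENNReal.ofReal (h v) * α v) * B + K * (ENNReal.ofReal (h v) * β v) * A) := by
        refine lintegral_congr fun v => ?_
        rw [lintegral_add_left (mβ.const_mul _), lintegral_const_mul _ mβ, lintegral_const_mul _ mα]
    _ = _ := by
        rw [lintegral_add_left ((mα.const_mul _).mul_const _), lintegral_mul_const _ (mα.const_mul _),
          lintegral_mul_const _ (mβ.const_mul _), lintegral_const_mul _ mα, lintegral_const_mul _ mβ]
        ring

lemma ptw_gain {γ q : ℝ} (hγ : 0 < γ) {x y z : ℝ} (hx : 0 ≤ x) (hy : 0 ≤ y) (hz0 : 0 ≤ z) (hz : z ≤ x + y) (hq : 0 ≤ q) :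
    z ^ γ * (x ^ 2 + y ^ 2) ^ q * min (x ^ 2) (y ^ 2) ≤
      2 ^ γ * 2 ^ q * (x ^ (2 * q + γ) * y ^ 2 + y ^ (2 * q + γ) * x ^ 2) := by
  wlog hxy : y ≤ x generalizing x y
  · have := this hy hx (by linarith) (by linarith)
    rw [min_comm, add_comm (x ^ 2)]
    linarith
  have e : x ^ (2 * q + γ) = (x ^ 2) ^ q * x ^ γ := by
    rw [sq_rpow _ hx, ← Real.rpow_add_of_nonneg hx (by positivity) hγ.le]
  have a1 : z ^ γ ≤ 2 ^ γ * x ^ γ := by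
    rw [← Real.mul_rpow (by norm_num) hx]
    exact Real.rpow_le_rpow hz0 (by linarith) hγ.le
  have a2 : (x ^ 2 + y ^ 2) ^ q ≤ 2 ^ q * (x ^ 2) ^ q := by
    rw [← Real.mul_rpow (by norm_num) (by positivity)]
    exact Real.rpow_le_rpow (by positivity) (by nlinarith) hq
  calc _ ≤ (2 ^ γ * x ^ γ) * (2 ^ q * (x ^ 2) ^ q) * y ^ 2 := by
        gcongr; exact min_le_right _ _
    _ = 2 ^ γ * 2 ^ q * (x ^ (2 * q + γ) * y ^ 2) := by rw [e]; ring
    _ ≤ _ := by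
      have : 0 ≤ y ^ (2 * q + γ) * x ^ 2 := by positivity
      gcongr; linarith

lemma ptw_gain0 {γ : ℝ} (hγ : 0 < γ) (hγ2 : γ ≤ 2) {x y z : ℝ} (hx : 0 ≤ x) (hy : 0 ≤ y) (hz0 : 0 ≤ z) (hz : z ≤ x + y) :
    z ^ γ * min (x ^ 2) (y ^ 2) ≤ 4 * ((1 + x ^ 2) * (1 + y ^ 2)) := by
  wlog hxy : y ≤ x generalizing x y
  · have := this hy hx (by linarith) (by linarith)
    rw [min_comm]
    linarith
  have a1 : z ^ γ ≤ 4 * (1 + x ^ 2) := by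
    calc z ^ γ ≤ (2 * x) ^ γ := Real.rpow_le_rpow hz0 (by linarith) hγ.le
      _ ≤ 1 + (2 * x) ^ 2 := by
        rcases le_total (2 * x) 1 with h | h
        · have := Real.rpow_le_one (by positivity) h hγ.le
          nlinarith
        · have := Real.rpow_le_rpow_of_exponent_le h hγ2
          norm_num at this
          nlinarith
      _ ≤ _ := by nlinarith
  calc _ ≤ (4 * (1 + x ^ 2)) * (1 + y ^ 2) := by
        gcongr; exact (min_le_right _ _).trans (by linarith)
    _ = _ := by ring

lemma measurable_Wsum (r : ℝ) : Measurable (Wsum r) := by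
  unfold Wsum
  refine Measurable.tsum fun n => ?_
  exact Measurable.ite (measurableSet_lt measurable_const measurable_id) measurable_const measurable_const

/-- Gain estimate below the energy level. -/
lemma gain_neg {γ : ℝ} (hγ : 0 < γ) (hγ2 : γ ≤ 2) {b : ℝ → ℝ} (hb : GradCutoff b) {r : ℝ} (hr : r < 0)
    {m E : ℝ≥0∞} (hm : m < ∞) (hE : E < ∞) : ∃ K : ℝ≥0∞, K < ∞ ∧ 
    ∀ h : R3 → ℝ, Measurable h → (∀ v, 0 ≤ h v) → (∀ v, h v ≤ 1) → Mq 0 h = m → Mq 2 h = E →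
      Kg γ b h (Gsum r) ≤ K := by
  set S := ∑' n, wt r n with hS
  have hSt : S < ∞ := wt_sum hr
  refine ⟨zon (fun c => ENNReal.ofReal (b c)) * (2 * (S * ENNReal.ofReal 4)) * ((m + E) * (m + E)), ?_, ?_⟩
  · have h1 := zon_b_lt_top hb
    have h2 : m + E < ∞ := ENNReal.add_lt_top.2 ⟨hm, hE⟩
    exact ENNReal.mul_lt_top (ENNReal.mul_lt_top h1 (ENNReal.mul_lt_top (by simp)
      (ENNReal.mul_lt_top hSt ENNReal.ofReal_lt_top))) (ENNReal.mul_lt_top h2 h2)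
  · intro h hh h0 h1 hhm hhE
    have hα : Measurable fun v : R3 => ENNReal.ofReal (1 + ‖v‖ ^ 2) := by fun_prop
    have hφ : Measurable fun q : R3 × R3 => S * ENNReal.ofReal (min (‖q.1‖ ^ 2) (‖q.2‖ ^ 2)) := by fun_prop
    have := gain_gen (γ := γ) (φ := fun v w => S * ENNReal.ofReal (min (‖v‖ ^ 2) (‖w‖ ^ 2))) 
      hb hh h0 h1 hφ hα hα (K := S * ENNReal.ofReal 4) ?_
    · rw [lint_one_add hh, hhm, hhE] at this
      refine le_trans (Kg_mono _ _ _ fun p => ?_) this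
      rw [Gsum_eq]
      gcongr
      exact Wsum_neg _ _
    · intro v w
      have := ptw_gain0 hγ hγ2 (norm_nonneg v) (norm_nonneg w) (norm_nonneg (v - w)) (norm_sub_le v w)
      have e : ENNReal.ofReal (‖v - w‖ ^ γ) * ENNReal.ofReal (min (‖v‖ ^ 2) (‖w‖ ^ 2)) ≤
        ENNReal.ofReal 4 * (ENNReal.ofReal (1 + ‖v‖ ^ 2) * ENNReal.ofReal (1 + ‖w‖ ^ 2)) := by
        rw [← ENNReal.ofReal_mul (by positivity), ← ENNReal.ofReal_mul (by positivity),
          ← ENNReal.ofReal_mul (by positivity)]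
        exact ENNReal.ofReal_le_ofReal this
      calc _ = S * (ENNReal.ofReal (‖v - w‖ ^ γ) * ENNReal.ofReal (min (‖v‖ ^ 2) (‖w‖ ^ 2))) := by ring
        _ ≤ S * (ENNReal.ofReal 4 * (ENNReal.ofReal (1 + ‖v‖ ^ 2) * ENNReal.ofReal (1 + ‖w‖ ^ 2))) := by gcongr
        _ = (S * ENNReal.ofReal 4) * (ENNReal.ofReal (1 + ‖v‖ ^ 2) * ENNReal.ofReal (1 + ‖w‖ ^ 2)) := by ring
        _ ≤ _ := by gcongr; exact le_self_add

/-- Gain estimate above the energy level. -/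
lemma gain_pos {γ : ℝ} (hγ : 0 < γ) {b : ℝ → ℝ} (hb : GradCutoff b) {r : ℝ} (hr : 0 < r)
    {E : ℝ≥0∞} (hE : E < ∞) : ∃ K : ℝ≥0∞, K < ∞ ∧ 
    ∀ h : R3 → ℝ, Measurable h → (∀ v, 0 ≤ h v) → (∀ v, h v ≤ 1) → Mq 2 h = E →
      Kg γ b h (Gsum r) ≤ K * Mq (2 * r + γ) h := by
  obtain ⟨C, hC, hW⟩ := Wsum_pos hr
  set D : ℝ := C * (2 ^ γ * 2 ^ r) with hD
  have hD0 : 0 ≤ D := by positivity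
  refine ⟨zon (fun c => ENNReal.ofReal (b c)) * (2 * ENNReal.ofReal D) * E, ?_, ?_⟩
  · have h1 := zon_b_lt_top hb
    exact ENNReal.mul_lt_top (ENNReal.mul_lt_top h1 (ENNReal.mul_lt_top (by simp)
      ENNReal.ofReal_lt_top)) hE
  · intro h hh h0 h1 hhE
    have hα : Measurable fun v : R3 => ENNReal.ofReal (‖v‖ ^ (2:ℝ)) := by fun_prop
    have hβ : Measurable fun v : R3 => ENNReal.ofReal (‖v‖ ^ (2 * r + γ)) := by fun_prop
    have hφ : Measurable fun q : R3 × R3 => ENNReal.ofReal (C * (‖q.1‖ ^ 2 + ‖q.2‖ ^ 2) ^ r) *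
      ENNReal.ofReal (min (‖q.1‖ ^ 2) (‖q.2‖ ^ 2)) := by fun_prop
    have := gain_gen (γ := γ) (φ := fun v w => ENNReal.ofReal (C * (‖v‖ ^ 2 + ‖w‖ ^ 2) ^ r) *
      ENNReal.ofReal (min (‖v‖ ^ 2) (‖w‖ ^ 2))) hb hh h0 h1 hφ hα hβ (K := ENNReal.ofReal D) ?_
    · change _ ≤ _ * (Mq 2 h * Mq (2 * r + γ) h) at this
      rw [hhE, ← mul_assoc] at this
      refine le_trans (Kg_mono _ _ _ fun p => ?_) this
      rw [Gsum_eq]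
      gcongr
      exact hW _ (by positivity)
    · intro v w
      have := ptw_gain hγ (norm_nonneg v) (norm_nonneg w) (norm_nonneg (v - w)) (norm_sub_le v w) hr.le
      rw [← ENNReal.ofReal_mul (by positivity), ← ENNReal.ofReal_mul (by positivity),
          ← ENNReal.ofReal_mul (by positivity), ← ENNReal.ofReal_mul (by positivity),
          ← ENNReal.ofReal_add (by positivity) (by positivity), ← ENNReal.ofReal_mul (by positivity)]
      apply ENNReal.ofReal_le_ofReal
      rw [hD]
      norm_num
      calc _ = C * (‖v - w‖ ^ γ * (‖v‖ ^ 2 + ‖w‖ ^ 2) ^ r * min (‖v‖ ^ 2) (‖w‖ ^ 2)) := by ring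
        _ ≤ C * (2 ^ γ * 2 ^ r * (‖v‖ ^ (2 * r + γ) * ‖w‖ ^ 2 + ‖w‖ ^ (2 * r + γ) * ‖v‖ ^ 2)) := by gcongr
        _ = _ := by ring

open Classical in
/-- Loss estimate. -/
lemma loss_lower {γ : ℝ} (hγ : 0 < γ) {b : ℝ → ℝ} (hb : GradCutoff b) {m E : ℝ≥0∞} (hm0 : m ≠ 0) (hm : m < ∞) (hE : E < ∞) :
    ∃ R R1 δ : ℝ, 0 < δ ∧ δ ≤ 1 ∧ R ≤ δ / 32 * R1 ∧ ∀ r, 0 < 2 * r + 2 → ∃ c : ℝ, 0 < c ∧ ∃ C : ℝ≥0∞, C < ∞ ∧ 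
      ∀ h : R3 → ℝ, Measurable h → (∀ v, 0 ≤ h v) → (∀ v, h v ≤ 1) →
      Mq 0 h = m → Mq 2 h = E → 
      ENNReal.ofReal c * Mq (2 * r + 2 + γ) h ≤ Kg γ b h (Lsum R R1 δ r) + C := by
  obtain ⟨R, R1, δ, c, hδ0, hδ1, hR, hR1, hc, H⟩ := coercive hγ hb hm0 hm hE
  refine ⟨R, R1, δ, hδ0, hδ1, hR, fun r hr => ?_⟩
  obtain ⟨c', hc', H'⟩ := Lsum_lower (R := R) hδ0 hR1 r
  refine ⟨c' * c, by positivity, ENNReal.ofReal (c' * c * R1 ^ (2 * r + 2 + γ)) * m,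
    ENNReal.mul_lt_top ENNReal.ofReal_lt_top hm, fun h hh h0 h1 hhm hhE => ?_⟩
  have mφ : Measurable fun v : R3 => ENNReal.ofReal (c' * ‖v‖ ^ (2 * r + 2)) := by fun_prop
  have h3 := (H h hh h0 h1 hhm hhE.le _ mφ).trans (Kg_mono γ b h H')
  refine le_trans ?_ (add_le_add_left h3 _)
  have e : ENNReal.ofReal (c' * c * R1 ^ (2 * r + 2 + γ)) * m =
    ∫⁻ v, ENNReal.ofReal (h v) * ENNReal.ofReal (c' * c * R1 ^ (2 * r + 2 + γ)) := by
    rw [lintegral_mul_const _ hh.ennreal_ofReal, mul_comm, ← hhm]; simp [Mq]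
  rw [e, ← lintegral_add_right _ (hh.ennreal_ofReal.mul_const _)]
  unfold Mq
  rw [← lintegral_const_mul' _ _ ENNReal.ofReal_ne_top]
  refine lintegral_mono fun v => ?_
  rw [mul_left_comm, ← mul_add]
  gcongr
  rw [← ENNReal.ofReal_mul (by positivity)]
  split_ifs with hv
  · refine le_trans ?_ le_self_add
    rw [← ENNReal.ofReal_mul (by positivity)]
    apply ENNReal.ofReal_le_ofReal
    rw [Real.rpow_add_of_nonneg (norm_nonneg v) hr.le hγ.le]
    apply le_of_eq; ring
  · refine le_trans ?_ le_add_self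
    apply ENNReal.ofReal_le_ofReal
    push Not at hv
    gcongr

lemma measurable_La (R R1 δ a : ℝ) : Measurable (La R R1 δ a) := by
  unfold La
  have m2 : Measurable fun p : R3 × (R3 × S2) => ‖p.1‖ ^ 2 / 4 := by fun_prop
  have m3 : Measurable fun p : R3 × (R3 × S2) => ‖p.1‖ ^ 2 / 2 := by fun_prop
  refine Measurable.ite ((measurableSet_Good R R1 δ).inter ((measurableSet_lt m2 measurable_const).inter
    (measurableSet_le measurable_const m3))) ?_ measurable_const
  fun_prop

lemma measurable_Ga (a : ℝ) : Measurable (Ga a) := by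
  unfold Ga
  have m2 : Measurable fun p : R3 × (R3 × S2) => ‖p.1‖ ^ 2 + ‖p.2.1‖ ^ 2 := by fun_prop
  refine Measurable.ite (measurableSet_lt measurable_const m2) ?_ measurable_const
  fun_prop

lemma int_tsum {γ : ℝ} {b : ℝ → ℝ} {f g : ℝ → R3 → ℝ} {m E : ℝ≥0∞} (H : BRep γ b f g m E)
    {ψ : ℕ → R3 × (R3 × S2) → ℝ≥0∞} (hψ : ∀ n, Measurable (ψ n)) (c : ℕ → ℝ≥0∞) (s : Set ℝ) :
    ∫⁻ τ in s, Kg γ b (g τ) (fun p => ∑' n, c n * ψ n p) = ∑' n, c n * ∫⁻ τ in s, Kg γ b (g τ) (ψ n) := by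
  have e : ∀ n, Measurable fun τ => Kg γ b (g τ) (ψ n) := fun n => measurable_Kg H.hb H.hg (hψ n)
  simp_rw [Kg_tsum H.hb (H.gτ _) hψ]
  rw [lintegral_tsum (fun n => ((e n).const_mul _).aemeasurable)]
  congr 1; ext n
  rw [lintegral_const_mul _ (e n)]

/-- moment functional -/
def YY (r : ℝ) (h : R3 → ℝ) : ℝ≥0∞ := 2 * ∫⁻ v, ENNReal.ofReal (h v) * Psi r v

lemma YY_eq (r : ℝ) {h : R3 → ℝ} (hh : Measurable h) :
    YY r h = ∑' n, wt r n * (2 * ∫⁻ v, ENNReal.ofReal (h v) * ENNReal.ofReal (‖v‖ ^ 2 - 2 ^ n)) := by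
  unfold YY Psi
  have e : ∀ n : ℕ, Measurable fun v => ENNReal.ofReal (h v) * ENNReal.ofReal (‖v‖ ^ 2 - 2 ^ n) := by
    intro n; fun_prop
  rw [← lintegral_const_mul' _ _ (by simp)]
  simp_rw [← lintegral_const_mul' _ _ (by simp : (2:ℝ≥0∞) ≠ ∞)]
  have e2 : ∀ n, wt r n ≠ ∞ := fun n => ENNReal.ofReal_ne_top
  simp_rw [← lintegral_const_mul' _ _ (e2 _)]
  rw [← lintegral_tsum (fun n => (((e n).const_mul _).const_mul _).aemeasurable)]
  congr 1; ext v
  rw [← ENNReal.tsum_mul_left, ← ENNReal.tsum_mul_left]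
  congr 1; ext n; ring

lemma sumY {γ : ℝ} {b : ℝ → ℝ} {f g : ℝ → R3 → ℝ} {m E : ℝ≥0∞} (H : BRep γ b f g m E)
    {R R1 δ : ℝ} (hδ0 : 0 < δ) (hδ1 : δ ≤ 1) (hR : R ≤ δ / 32 * R1) (r : ℝ)
    {t0 t : ℝ} (ht0 : 0 ≤ t0) (ht : t0 ≤ t) :
    YY r (f t) + (∫⁻ τ in Ioc t0 t, Kg γ b (g τ) (Lsum R R1 δ r)) ≤
    YY r (f t0) + (∫⁻ τ in Ioc t0 t, Kg γ b (g τ) (Gsum r)) := by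
  rw [YY_eq r (H.fmeas t), YY_eq r (H.fmeas t0)]
  unfold Lsum Gsum
  rw [int_tsum H (fun n => measurable_La R R1 δ (2 ^ n)), int_tsum H (fun n => measurable_Ga (2 ^ n)),
    ← ENNReal.tsum_add, ← ENNReal.tsum_add]
  refine ENNReal.tsum_le_tsum fun n => ?_
  rw [← mul_add, ← mul_add]
  refine mul_le_mul_right ?_ _
  exact weak2 H ht0 ht (a := 2 ^ n) (by positivity) (povzner hδ0 hδ1 hR (by positivity))

lemma sumA {γ : ℝ} {b : ℝ → ℝ} {f g : ℝ → R3 → ℝ} {m E : ℝ≥0∞} (H : BRep γ b f g m E)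
    {R R1 δ : ℝ} (hδ0 : 0 < δ) (hδ1 : δ ≤ 1) (hR : R ≤ δ / 32 * R1) (r : ℝ)
    {t : ℝ} (ht : 0 ≤ t) :
    (∫⁻ τ in Ioc 0 t, Kg γ b (g τ) (Lsum R R1 δ r)) ≤
    (∑' n, wt r n) * (2 * E) + (∫⁻ τ in Ioc 0 t, Kg γ b (g τ) (Gsum r)) := by
  unfold Lsum Gsum
  rw [int_tsum H (fun n => measurable_La R R1 δ (2 ^ n)), int_tsum H (fun n => measurable_Ga (2 ^ n)),
    ← ENNReal.tsum_mul_right, ← ENNReal.tsum_add]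
  refine ENNReal.tsum_le_tsum fun n => ?_
  rw [← mul_add]
  gcongr
  refine le_trans (le_trans le_add_self
    (weak1 H le_rfl ht (by positivity) (povzner hδ0 hδ1 hR (by positivity)))) ?_
  gcongr
  rw [← H.fE t ht]
  unfold Mq
  refine lintegral_mono fun v => ?_
  gcongr
  norm_num
  exact min_le_left _ _

lemma mom_neg {γ : ℝ} {b : ℝ → ℝ} {f g : ℝ → R3 → ℝ} {m E : ℝ≥0∞} (H : BRep γ b f g m E) (hm0 : m ≠ 0)
    {r : ℝ} (hr : r < 0) (hr2 : 0 < 2 * r + 2) {t : ℝ} (ht : 0 ≤ t) :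
    ∫⁻ τ in Ioc 0 t, Mq (2 * r + 2 + γ) (g τ) < ∞ := by
  obtain ⟨R, R1, δ, hδ0, hδ1, hR, HL⟩ := loss_lower H.γ0 H.hb hm0 H.mlt H.Elt
  obtain ⟨c, hc, C, hC, HL⟩ := HL r hr2
  obtain ⟨K, hK, HG⟩ := gain_neg H.γ0 H.γ2 H.hb hr H.mlt H.Elt
  have h1 := sumA H hδ0 hδ1 hR r ht
  have h2 : ∫⁻ τ in Ioc 0 t, Kg γ b (g τ) (Gsum r) ≤ ∫⁻ τ in Ioc 0 t, K :=
    lintegral_mono fun τ => HG (g τ) (H.gτ τ) (H.hg0 τ) (H.hg1 τ) (H.gm τ) (H.gE τ)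
  have h3 : ENNReal.ofReal c * ∫⁻ τ in Ioc 0 t, Mq (2 * r + 2 + γ) (g τ) ≤
      (∫⁻ τ in Ioc 0 t, Kg γ b (g τ) (Lsum R R1 δ r)) + ∫⁻ τ in Ioc 0 t, C := by
    rw [← lintegral_const_mul' _ _ ENNReal.ofReal_ne_top, ← lintegral_add_right _ measurable_const]
    exact lintegral_mono fun τ => HL (g τ) (H.gτ τ) (H.hg0 τ) (H.hg1 τ) (H.gm τ) (H.gE τ)
  have h4 : ENNReal.ofReal c * ∫⁻ τ in Ioc 0 t, Mq (2 * r + 2 + γ) (g τ) < ∞ := by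
    refine lt_of_le_of_lt (h3.trans (add_le_add_left (h1.trans (add_le_add_right h2 _)) _)) ?_
    simp only [lintegral_const, Measure.restrict_apply, MeasurableSet.univ, univ_inter, Real.volume_Ioc]
    refine ENNReal.add_lt_top.2 ⟨ENNReal.add_lt_top.2 ⟨?_, ?_⟩, ?_⟩
    · exact ENNReal.mul_lt_top (wt_sum hr) (ENNReal.mul_lt_top (by simp) H.Elt)
    · exact ENNReal.mul_lt_top hK ENNReal.ofReal_lt_top
    · exact ENNReal.mul_lt_top hC ENNReal.ofReal_lt_top
  by_contra hcon
  rw [not_lt, top_le_iff] at hcon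
  rw [hcon, ENNReal.mul_top (by simpa using hc)] at h4
  exact lt_irrefl _ h4

lemma mom_pos {γ : ℝ} {b : ℝ → ℝ} {f g : ℝ → R3 → ℝ} {m E : ℝ≥0∞} (H : BRep γ b f g m E) (hm0 : m ≠ 0)
    {r : ℝ} (hr : 0 < r) : ∃ c : ℝ, 0 < c ∧ ∃ C : ℝ≥0∞, C < ∞ ∧ ∃ K : ℝ≥0∞, K < ∞ ∧
    ∀ t0 t, 0 ≤ t0 → t0 ≤ t → 
    YY r (f t) + ENNReal.ofReal c * (∫⁻ τ in Ioc t0 t, Mq (2 * r + 2 + γ) (g τ)) ≤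
    YY r (f t0) + K * (∫⁻ τ in Ioc t0 t, Mq (2 * r + γ) (g τ)) + C * ENNReal.ofReal (t - t0) := by
  obtain ⟨R, R1, δ, hδ0, hδ1, hR, HL⟩ := loss_lower H.γ0 H.hb hm0 H.mlt H.Elt
  obtain ⟨c, hc, C, hC, HL⟩ := HL r (by linarith)
  obtain ⟨K, hK, HG⟩ := gain_pos H.γ0 H.hb hr H.Elt
  refine ⟨c, hc, C, hC, K, hK, fun t0 t ht0 ht => ?_⟩
  have h1 := sumY H hδ0 hδ1 hR r ht0 ht
  have h2 : ∫⁻ τ in Ioc t0 t, Kg γ b (g τ) (Gsum r) ≤ K * ∫⁻ τ in Ioc t0 t, Mq (2 * r + γ) (g τ) := by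
    rw [← lintegral_const_mul' _ _ hK.ne]
    exact lintegral_mono fun τ => HG (g τ) (H.gτ τ) (H.hg0 τ) (H.hg1 τ) (H.gE τ)
  have h3 : ENNReal.ofReal c * ∫⁻ τ in Ioc t0 t, Mq (2 * r + 2 + γ) (g τ) ≤
      (∫⁻ τ in Ioc t0 t, Kg γ b (g τ) (Lsum R R1 δ r)) + C * ENNReal.ofReal (t - t0) := by
    have : C * ENNReal.ofReal (t - t0) = ∫⁻ τ in Ioc t0 t, C := by simp
    rw [this, ← lintegral_const_mul' _ _ ENNReal.ofReal_ne_top, ← lintegral_add_right _ measurable_const]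
    exact lintegral_mono fun τ => HL (g τ) (H.gτ τ) (H.hg0 τ) (H.hg1 τ) (H.gm τ) (H.gE τ)
  calc _ ≤ YY r (f t) + ((∫⁻ τ in Ioc t0 t, Kg γ b (g τ) (Lsum R R1 δ r)) + C * ENNReal.ofReal (t - t0)) := by
        gcongr
    _ = (YY r (f t) + (∫⁻ τ in Ioc t0 t, Kg γ b (g τ) (Lsum R R1 δ r))) + C * ENNReal.ofReal (t - t0) := by ring
    _ ≤ (YY r (f t0) + (∫⁻ τ in Ioc t0 t, Kg γ b (g τ) (Gsum r))) + C * ENNReal.ofReal (t - t0) := by gcongr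
    _ ≤ _ := by gcongr

lemma measurable_Psi (r : ℝ) : Measurable (Psi r) := by
  unfold Psi
  refine Measurable.tsum fun n => ?_
  fun_prop

lemma YY_upper {r : ℝ} (hr : 0 < r) : ∃ C : ℝ≥0∞, C < ∞ ∧ ∀ h : R3 → ℝ, YY r h ≤ C * Mq (2 * r + 2) h := by
  obtain ⟨C, hC, H⟩ := Psi_upper hr
  refine ⟨2 * ENNReal.ofReal C, ENNReal.mul_lt_top (by simp) ENNReal.ofReal_lt_top, fun h => ?_⟩
  unfold YY Mq
  rw [mul_assoc, ← lintegral_const_mul' _ _ ENNReal.ofReal_ne_top]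
  refine mul_le_mul_right (lintegral_mono fun v => ?_) _
  rw [mul_left_comm, ← ENNReal.ofReal_mul hC]
  gcongr
  exact H v

lemma YY_lower {r : ℝ} (hr : 0 < r) : ∃ C : ℝ, 0 < C ∧ ∀ h : R3 → ℝ, Measurable h → 
    Mq (2 * r + 2) h ≤ ENNReal.ofReal C * (YY r h + Mq 0 h) := by
  obtain ⟨C, hC, H⟩ := Psi_lower hr
  refine ⟨C + 1, by positivity, fun h hh => ?_⟩
  calc Mq (2 * r + 2) h ≤ ENNReal.ofReal (C + 1) * ((∫⁻ v, ENNReal.ofReal (h v) * Psi r v) + Mq 0 h) := by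
        unfold Mq
        have mp := hh.ennreal_ofReal.mul (measurable_Psi r)
        simp only [Pi.mul_def] at mp
        rw [← lintegral_add_left mp,
          ← lintegral_const_mul' _ _ ENNReal.ofReal_ne_top]
        refine lintegral_mono fun v => ?_
        rw [Real.rpow_zero, ENNReal.ofReal_one, ← mul_add, mul_left_comm]
        gcongr
        refine (H v).trans ?_
        gcongr; linarith
    _ ≤ _ := by
        gcongr
        unfold YY
        rw [two_mul]; exact le_self_add

lemma Mq_le {h : R3 → ℝ} (hh : Measurable h) {p q : ℝ} (hp : 0 ≤ p) (hpq : p ≤ q) :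
    Mq p h ≤ Mq 0 h + Mq q h := by
  unfold Mq
  rw [← lintegral_add_left (by fun_prop)]
  refine lintegral_mono fun v => ?_
  rw [← mul_add, ← ENNReal.ofReal_add (by positivity) (by positivity)]
  gcongr
  rw [Real.rpow_zero]
  rcases le_total ‖v‖ 1 with h | h
  · have := Real.rpow_le_one (norm_nonneg v) h hp
    have : 0 ≤ ‖v‖ ^ q := by positivity
    linarith
  · have := Real.rpow_le_rpow_of_exponent_le h hpq
    linarith

lemma Mq_lt_top_of_le {h : R3 → ℝ} (hh : Measurable h) {p q : ℝ} (hp : 0 ≤ p) (hpq : p ≤ q)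
    (h0 : Mq 0 h < ∞) (hq : Mq q h < ∞) : Mq p h < ∞ :=
  lt_of_le_of_lt (Mq_le hh hp hpq) (ENNReal.add_lt_top.2 ⟨h0, hq⟩)

lemma int_Mq_le {γ : ℝ} {b : ℝ → ℝ} {f g : ℝ → R3 → ℝ} {m E : ℝ≥0∞} (H : BRep γ b f g m E)
    {p q : ℝ} (hp : 0 ≤ p) (hpq : p ≤ q) {t0 t : ℝ} (h : ∫⁻ τ in Ioc t0 t, Mq q (g τ) < ∞) :
    ∫⁻ τ in Ioc t0 t, Mq p (g τ) < ∞ := by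
  refine lt_of_le_of_lt (lintegral_mono fun τ => Mq_le (H.gτ τ) hp hpq) ?_
  rw [lintegral_add_right _ (measurable_Mq H.hg q)]
  refine ENNReal.add_lt_top.2 ⟨?_, h⟩
  simp_rw [H.gm]
  simp only [lintegral_const, Measure.restrict_apply, MeasurableSet.univ, univ_inter, Real.volume_Ioc]
  exact ENNReal.mul_lt_top H.mlt ENNReal.ofReal_lt_top

lemma exists_finite {γ : ℝ} {b : ℝ → ℝ} {f g : ℝ → R3 → ℝ} {m E : ℝ≥0∞} (H : BRep γ b f g m E)
    {q : ℝ} {t0 t : ℝ} (h0 : 0 ≤ t0) (ht : t0 < t) (h : ∫⁻ τ in Ioc t0 t, Mq q (g τ) < ∞) :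
    ∃ t1, t0 < t1 ∧ t1 ≤ t ∧ Mq q (f t1) < ∞ := by
  have a1 := ae_lt_top (measurable_Mq H.hg q) h.ne
  have a2 : ∀ᵐ τ ∂(volume.restrict (Ioc t0 t)), f τ =ᵐ[volume] g τ :=
    ae_restrict_of_ae_restrict_of_subset (fun x hx => lt_of_le_of_lt h0 hx.1) H.fg
  have a3 : ∀ᵐ τ ∂(volume.restrict (Ioc t0 t)), τ ∈ Ioc t0 t := ae_restrict_mem measurableSet_Ioc
  have hne : (ae (volume.restrict (Ioc t0 t))).NeBot := by
    rw [ae_neBot]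
    intro hc
    have := congrArg (fun μ => μ univ) hc
    simp [ht] at this
    linarith
  obtain ⟨τ, h1, h2, h3⟩ := (a1.and (a2.and a3)).exists
  exact ⟨τ, h3.1, h3.2, by rw [Mq_congr h2]; exact h1⟩

lemma ladder_step {γ : ℝ} {b : ℝ → ℝ} {f g : ℝ → R3 → ℝ} {m E : ℝ≥0∞} (H : BRep γ b f g m E) (hm0 : m ≠ 0)
    {r : ℝ} (hr : 0 < r) {t0 t : ℝ} (h0 : 0 ≤ t0) (ht : t0 ≤ t) (hM : Mq (2 * r + 2) (f t0) < ∞)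
    (hI : ∫⁻ τ in Ioc t0 t, Mq (2 * r + γ) (g τ) < ∞) :
    ∫⁻ τ in Ioc t0 t, Mq (2 * r + 2 + γ) (g τ) < ∞ := by
  obtain ⟨c, hc, C, hC, K, hK, h⟩ := mom_pos H hm0 hr
  obtain ⟨C', hC', hY⟩ := YY_upper hr
  have h1 := le_trans le_add_self (h t0 t h0 ht)
  have h2 : YY r (f t0) < ∞ := lt_of_le_of_lt (hY _) (ENNReal.mul_lt_top hC' hM)
  have h4 : ENNReal.ofReal c * ∫⁻ τ in Ioc t0 t, Mq (2 * r + 2 + γ) (g τ) < ∞ := by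
    refine lt_of_le_of_lt h1 ?_
    exact ENNReal.add_lt_top.2 ⟨ENNReal.add_lt_top.2 ⟨h2, ENNReal.mul_lt_top hK hI⟩,
      ENNReal.mul_lt_top hC ENNReal.ofReal_lt_top⟩
  by_contra hcon
  rw [not_lt, top_le_iff] at hcon
  rw [hcon, ENNReal.mul_top (by simpa using hc)] at h4
  exact lt_irrefl _ h4

lemma ladder_nat {γ : ℝ} {b : ℝ → ℝ} {f g : ℝ → R3 → ℝ} {m E : ℝ≥0∞} (H : BRep γ b f g m E) (hm0 : m ≠ 0)
    (n : ℕ) : ∀ {r : ℝ}, 0 < r → r < 1 + n / 2 → ∀ {t0 t : ℝ}, 0 ≤ t0 → t0 ≤ t → 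
    Mq (2 * r + 2) (f t0) < ∞ → ∫⁻ τ in Ioc t0 t, Mq (2 * r + 2 + γ) (g τ) < ∞ := by
  have hγ := H.γ0
  have base : ∀ {r : ℝ}, 0 < r → r < 1 → ∀ {t0 t : ℝ}, 0 ≤ t0 → t0 ≤ t → 
    Mq (2 * r + 2) (f t0) < ∞ → ∫⁻ τ in Ioc t0 t, Mq (2 * r + 2 + γ) (g τ) < ∞ := by
    intro r hr hr1 t0 t h0 ht hM
    refine ladder_step H hm0 hr h0 ht hM ?_
    have h1 := mom_neg H hm0 (r := r - 1) (by linarith) (by linarith) (h0.trans ht)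
    rw [show 2 * (r - 1) + 2 + γ = 2 * r + γ by ring] at h1
    exact lt_of_le_of_lt (lintegral_mono_set (Ioc_subset_Ioc_left h0)) h1
  induction n with
  | zero =>
    intro r hr hr1
    exact base hr (by simpa using hr1)
  | succ n ih =>
    intro r hr hr1 t0 t h0 ht hM
    rcases lt_or_ge r 1 with h | h
    · exact base hr h h0 ht hM
    · refine ladder_step H hm0 hr h0 ht hM ?_
      have h1 := ih (r := r - 1 / 2) (by linarith) (by push_cast at hr1; linarith) h0 ht
        (Mq_lt_top_of_le (H.fmeas t0) (by linarith) (by linarith) (by rw [H.fm t0 h0]; exact H.mlt) hM)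
      exact int_Mq_le H (by positivity) (by linarith) h1

lemma ladder {γ : ℝ} {b : ℝ → ℝ} {f g : ℝ → R3 → ℝ} {m E : ℝ≥0∞} (H : BRep γ b f g m E) (hm0 : m ≠ 0)
    {r : ℝ} (hr : 0 < r) {t0 t : ℝ} (h0 : 0 ≤ t0) (ht : t0 ≤ t)
    (hM : Mq (2 * r + 2) (f t0) < ∞) : ∫⁻ τ in Ioc t0 t, Mq (2 * r + 2 + γ) (g τ) < ∞ := by
  obtain ⟨n, hn⟩ := exists_nat_gt (2 * r)
  exact ladder_nat H hm0 n hr (by linarith) h0 ht hM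

lemma creation_finite {γ : ℝ} {b : ℝ → ℝ} {f g : ℝ → R3 → ℝ} {m E : ℝ≥0∞} (H : BRep γ b f g m E) (hm0 : m ≠ 0)
    (n : ℕ) : ∀ ε : ℝ, 0 < ε → ∃ t1, 0 < t1 ∧ t1 ≤ ε ∧ Mq (2 + γ / 2 + n * γ) (f t1) < ∞ := by
  have hγ := H.γ0
  have hγ2 := H.γ2
  induction n with
  | zero =>
    intro ε hε
    have h1 := mom_neg H hm0 (r := - γ / 4) (by linarith) (by linarith) hε.le
    rw [show 2 * (- γ / 4) + 2 + γ = 2 + γ / 2 + (0:ℕ) * γ by push_cast; ring] at h1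
    exact exists_finite H le_rfl hε h1
  | succ n ih =>
    intro ε hε
    obtain ⟨t1, h1, h2, h3⟩ := ih (ε / 2) (by linarith)
    have hr : 0 < γ / 4 + n * γ / 2 := by positivity
    have h4 := ladder H hm0 (r := γ / 4 + n * γ / 2) (t0 := t1) (t := ε) hr h1.le (by linarith) (by
      rw [show 2 * (γ / 4 + n * γ / 2) + 2 = 2 + γ / 2 + n * γ by ring]; exact h3)
    rw [show 2 * (γ / 4 + n * γ / 2) + 2 + γ = 2 + γ / 2 + (n + 1 : ℕ) * γ by push_cast; ring] at h4
    obtain ⟨t2, h5, h6, h7⟩ := exists_finite H h1.le (by linarith) h4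
    exact ⟨t2, by linarith, h6, h7⟩

lemma creation_finite' {γ : ℝ} {b : ℝ → ℝ} {f g : ℝ → R3 → ℝ} {m E : ℝ≥0∞} (H : BRep γ b f g m E) (hm0 : m ≠ 0)
    {q : ℝ} (hq : 0 ≤ q) {ε : ℝ} (hε : 0 < ε) : ∃ t1, 0 < t1 ∧ t1 ≤ ε ∧ Mq q (f t1) < ∞ := by
  have hγ := H.γ0
  obtain ⟨n, hn⟩ := exists_nat_gt (q / γ)
  obtain ⟨t1, h1, h2, h3⟩ := creation_finite H hm0 n ε hε
  rw [div_lt_iff₀ hγ] at hn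
  exact ⟨t1, h1, h2, Mq_lt_top_of_le (H.fmeas t1) hq (by linarith) (by rw [H.fm t1 h1.le]; exact H.mlt) h3⟩

lemma interp {h : R3 → ℝ} (hh : Measurable h) {q : ℝ} (hq : 0 ≤ q) {K ε : ℝ} (hK : 0 ≤ K) (hε : 0 < ε) :
    ENNReal.ofReal K * Mq q h ≤ ENNReal.ofReal ε * Mq (q + 2) h + ENNReal.ofReal (K * (√(K / ε)) ^ q) * Mq 0 h := by
  unfold Mq
  rw [← lintegral_const_mul' _ _ ENNReal.ofReal_ne_top, ← lintegral_const_mul' _ _ ENNReal.ofReal_ne_top,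
    ← lintegral_const_mul' _ _ ENNReal.ofReal_ne_top, ← lintegral_add_left (by fun_prop)]
  refine lintegral_mono fun v => ?_
  rw [mul_left_comm, mul_left_comm (ENNReal.ofReal ε), mul_left_comm (ENNReal.ofReal (K * _)), ← mul_add]
  gcongr
  rw [← ENNReal.ofReal_mul (by positivity), ← ENNReal.ofReal_mul (by positivity),
    ← ENNReal.ofReal_mul (by positivity), ← ENNReal.ofReal_add (by positivity) (by positivity)]
  apply ENNReal.ofReal_le_ofReal
  rw [Real.rpow_zero, mul_one]
  rcases le_total ‖v‖ (√(K / ε)) with h | h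
  · have : ‖v‖ ^ q ≤ (√(K / ε)) ^ q := Real.rpow_le_rpow (norm_nonneg v) h hq
    have h3 : 0 ≤ ε * ‖v‖ ^ (q + 2) := by positivity
    nlinarith
  · have h1 : K / ε ≤ ‖v‖ ^ 2 := by
      rw [← Real.sq_sqrt (by positivity : 0 ≤ K / ε)]
      exact pow_le_pow_left₀ (Real.sqrt_nonneg _) h 2
    rw [div_le_iff₀ hε] at h1
    have h2 : ‖v‖ ^ (q + 2) = ‖v‖ ^ q * ‖v‖ ^ 2 := by
      rw [Real.rpow_add_of_nonneg (norm_nonneg v) hq (by norm_num)]; norm_num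
    have h3 : 0 ≤ K * √(K / ε) ^ q := by positivity
    have h4 : 0 ≤ ‖v‖ ^ q := by positivity
    rw [h2]
    nlinarith

lemma absorbed {γ : ℝ} {b : ℝ → ℝ} {f g : ℝ → R3 → ℝ} {m E : ℝ≥0∞} (H : BRep γ b f g m E) (hm0 : m ≠ 0)
    {r : ℝ} (hr : 0 < r) : ∃ c : ℝ, 0 < c ∧ ∃ C : ℝ≥0∞, C < ∞ ∧ 
    ∀ t0 t, 0 ≤ t0 → t0 ≤ t → 
    YY r (f t) + ENNReal.ofReal c * (∫⁻ τ in Ioc t0 t, Mq (2 * r + 2 + γ) (g τ)) ≤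
    YY r (f t0) + C * ENNReal.ofReal (t - t0) := by
  have hγ := H.γ0
  obtain ⟨c, hc, C, hC, K, hK, h⟩ := mom_pos H hm0 hr
  obtain ⟨C', hC', hY⟩ := YY_lower hr
  set D := ENNReal.ofReal (K.toReal * (√(K.toReal / (c / 2))) ^ (2 * r + γ)) * m with hD
  have hDt : D < ∞ := ENNReal.mul_lt_top ENNReal.ofReal_lt_top H.mlt
  refine ⟨c / 2, by positivity, C + D, ENNReal.add_lt_top.2 ⟨hC, hDt⟩, fun t0 t h0 ht => ?_⟩
  rcases eq_or_ne (YY r (f t0)) ∞ with hi | hi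
  · rw [hi]; simp
  have hM : Mq (2 * r + 2) (f t0) < ∞ := by
    refine lt_of_le_of_lt (hY _ (H.fmeas t0)) (ENNReal.mul_lt_top ENNReal.ofReal_lt_top 
      (ENNReal.add_lt_top.2 ⟨hi.lt_top, ?_⟩))
    rw [H.fm t0 h0]; exact H.mlt
  have hI := ladder H hm0 hr h0 ht hM
  set I := ∫⁻ τ in Ioc t0 t, Mq (2 * r + 2 + γ) (g τ) with hId
  have h1 : K * (∫⁻ τ in Ioc t0 t, Mq (2 * r + γ) (g τ)) ≤ ENNReal.ofReal (c / 2) * I + D * ENNReal.ofReal (t - t0) := by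
    have : D * ENNReal.ofReal (t - t0) = ∫⁻ τ in Ioc t0 t, D := by simp
    rw [this, hId, ← lintegral_const_mul' _ _ ENNReal.ofReal_ne_top, ← lintegral_const_mul' _ _ hK.ne,
      ← lintegral_add_right _ measurable_const]
    refine lintegral_mono fun τ => ?_
    have := interp (H.gτ τ) (q := 2 * r + γ) (by positivity) (K := K.toReal) (by positivity) (half_pos hc)
    rw [ENNReal.ofReal_toReal hK.ne, H.gm, show 2 * r + γ + 2 = 2 * r + 2 + γ by ring] at this
    exact this
  have hfin : ENNReal.ofReal (c / 2) * I ≠ ∞ := ENNReal.mul_ne_top ENNReal.ofReal_ne_top hI.ne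
  refine (ENNReal.add_le_add_iff_right hfin).1 ?_
  have e : ENNReal.ofReal c = ENNReal.ofReal (c / 2) + ENNReal.ofReal (c / 2) := by
    rw [← ENNReal.ofReal_add (by positivity) (by positivity)]; congr 1; ring
  calc _ = YY r (f t) + ENNReal.ofReal c * I := by rw [e]; ring
    _ ≤ _ := h t0 t h0 ht
    _ ≤ YY r (f t0) + (ENNReal.ofReal (c / 2) * I + D * ENNReal.ofReal (t - t0)) + C * ENNReal.ofReal (t - t0) := by gcongr
    _ = _ := by ring

lemma YY_congr {f g : R3 → ℝ} (h : f =ᵐ[volume] g) (r : ℝ) : YY r f = YY r g := by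
  unfold YY
  congr 1
  apply lintegral_congr_ae
  filter_upwards [h] with v hv
  rw [hv]

lemma Mq_low {h : R3 → ℝ} (hh : Measurable h) {r γ l : ℝ} (hr : 0 < r) (hγ : 0 < γ) (hl : 0 < l) :
    ENNReal.ofReal (l ^ γ) * Mq (2 * r + 2) h ≤ Mq (2 * r + 2 + γ) h + ENNReal.ofReal (l ^ (2 * r + γ)) * Mq 2 h := by
  have hm : Measurable (fun v : R3 => ENNReal.ofReal (l ^ (2 * r + γ)) * (ENNReal.ofReal (h v) * ENNReal.ofReal (‖v‖ ^ (2:ℝ)))) := by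
    fun_prop
  · unfold Mq
    rw [← lintegral_const_mul' _ _ ENNReal.ofReal_ne_top, ← lintegral_const_mul' _ _ ENNReal.ofReal_ne_top,
      ← lintegral_add_right _ hm]
    refine lintegral_mono fun v => ?_
    rw [mul_left_comm, mul_left_comm (ENNReal.ofReal (l ^ (2 * r + γ))), ← mul_add]
    gcongr
    rw [← ENNReal.ofReal_mul (by positivity), ← ENNReal.ofReal_mul (by positivity),
      ← ENNReal.ofReal_add (by positivity) (by positivity)]
    apply ENNReal.ofReal_le_ofReal
    have hv := norm_nonneg v
    rcases le_total l ‖v‖ with h | h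
    · rw [Real.rpow_add_of_nonneg hv (by positivity) hγ.le]
      have : l ^ γ ≤ ‖v‖ ^ γ := Real.rpow_le_rpow hl.le h hγ.le
      have h1 : 0 ≤ ‖v‖ ^ (2 * r + 2) := by positivity
      have h2 : 0 ≤ l ^ (2 * r + γ) * ‖v‖ ^ (2:ℝ) := by positivity
      nlinarith
    · rw [Real.rpow_add hl, Real.rpow_add_of_nonneg hv (by positivity : 0 ≤ 2 * r) (by norm_num : (0:ℝ) ≤ 2)]
      have : ‖v‖ ^ (2 * r) ≤ l ^ (2 * r) := Real.rpow_le_rpow hv h (by positivity)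
      have h1 : 0 ≤ ‖v‖ ^ (2 * r + 2 + γ) := by positivity
      have h2 : 0 ≤ l ^ γ * ‖v‖ ^ (2:ℝ) := by positivity
      nlinarith


lemma contr {γ : ℝ} {b : ℝ → ℝ} {f g : ℝ → R3 → ℝ} {m E : ℝ≥0∞} (H : BRep γ b f g m E) (hm0 : m ≠ 0)
    {r : ℝ} (hr : 0 < r) {K : ℝ} (hK : 0 < K) : ∃ D : ℝ≥0∞, D < ∞ ∧ ∀ σ h : ℝ, 0 ≤ σ → 0 < h → h ≤ 1 →
    ENNReal.ofReal (1 + K) * YY r (f (σ + h)) ≤ YY r (f σ) + D * ENNReal.ofReal (h ^ (-(2 * r / γ))) := by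
  have hγ := H.γ0
  obtain ⟨c, hc, C, hC, hA⟩ := absorbed H hm0 hr
  obtain ⟨Cu, hCu, hU⟩ := YY_upper hr
  set cu := Cu.toReal + 1 with hcu
  have hcu0 : 0 < cu := by positivity
  have hU' : ∀ h, YY r h ≤ ENNReal.ofReal cu * Mq (2 * r + 2) h := fun h => (hU h).trans (by
    gcongr; rw [← ENNReal.ofReal_toReal hCu.ne]; apply ENNReal.ofReal_le_ofReal; linarith)
  set a := c / cu with ha
  have ha0 : 0 < a := by positivity
  set P := (K / a) ^ ((2 * r + γ) / γ) with hP
  refine ⟨C + ENNReal.ofReal (c * P) * E + ENNReal.ofReal K * C, ?_, fun σ h hσ hh hh1 => ?_⟩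
  · exact ENNReal.add_lt_top.2 ⟨ENNReal.add_lt_top.2 ⟨hC, ENNReal.mul_lt_top ENNReal.ofReal_lt_top H.Elt⟩,
      ENNReal.mul_lt_top ENNReal.ofReal_lt_top hC⟩
  set l := (K / (a * h)) ^ (1 / γ) with hl
  have hl0 : 0 < l := by positivity
  have hlγ : l ^ γ = K / (a * h) := by
    rw [hl, ← Real.rpow_mul (by positivity), one_div, inv_mul_cancel₀ hγ.ne', Real.rpow_one]
  have hh2 : h ^ (-(2 * r / γ)) = h ^ (-((2 * r + γ) / γ)) * h := by
    conv_rhs => rw [← Real.rpow_one h]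
    rw [Real.rpow_one, ← Real.rpow_add_one hh.ne']
    congr 1; field_simp; ring
  have hl2 : l ^ (2 * r + γ) * h = P * h ^ (-(2 * r / γ)) := by
    rw [hl, ← Real.rpow_mul (by positivity), hP, hh2, ← mul_assoc]
    congr 1
    rw [show K / (a * h) = (K / a) * h⁻¹ by field_simp, Real.mul_rpow (by positivity) (by positivity),
      Real.inv_rpow hh.le, Real.rpow_neg hh.le, show 1 / γ * (2 * r + γ) = (2 * r + γ) / γ by ring]
  have hone : 1 ≤ ENNReal.ofReal (h ^ (-(2 * r / γ))) := by
    rw [ENNReal.one_le_ofReal]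
    exact Real.one_le_rpow_of_pos_of_le_one_of_nonpos hh hh1 (by
      rw [neg_nonpos]; positivity)
  set t := σ + h with ht
  set y := YY r (f t)
  set A := ENNReal.ofReal (a * l ^ γ) with hAd
  have hAh : A * ENNReal.ofReal h = ENNReal.ofReal K := by
    rw [hAd, ← ENNReal.ofReal_mul (by positivity), hlγ]; congr 1; field_simp
  set I := ∫⁻ τ in Ioc σ t, Mq (2 * r + 2 + γ) (g τ) with hId
  have hth : t - σ = h := by rw [ht]; ring
  have s1 : ENNReal.ofReal h * y ≤ (∫⁻ τ in Ioc σ t, YY r (g τ)) + C * ENNReal.ofReal h := by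
    have e1 : ENNReal.ofReal h * y = ∫⁻ τ in Ioc σ t, y := by simp [hth, mul_comm]
    have e2 : C * ENNReal.ofReal h = ∫⁻ τ in Ioc σ t, C := by simp [hth]
    rw [e1, e2, ← lintegral_add_right _ measurable_const]
    apply lintegral_mono_ae
    have a2 : ∀ᵐ τ ∂(volume.restrict (Ioc σ t)), f τ =ᵐ[volume] g τ :=
      ae_restrict_of_ae_restrict_of_subset (fun x hx => lt_of_le_of_lt hσ hx.1) H.fg
    filter_upwards [a2, ae_restrict_mem measurableSet_Ioc] with τ h1 h2
    rw [← YY_congr h1]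
    have h3 := le_trans le_self_add (hA τ t (by linarith [h2.1]) h2.2)
    refine h3.trans ?_
    gcongr
    calc C * ENNReal.ofReal (t - τ) ≤ C * 1 := by
          gcongr
          rw [ENNReal.ofReal_le_one]
          linarith [h2.1]
      _ = C := mul_one _
  have s2 : A * (∫⁻ τ in Ioc σ t, YY r (g τ)) ≤ ENNReal.ofReal c * I + 
      ENNReal.ofReal (c * l ^ (2 * r + γ)) * E * ENNReal.ofReal h := by
    have e2 : ENNReal.ofReal (c * l ^ (2 * r + γ)) * E * ENNReal.ofReal h =
      ∫⁻ τ in Ioc σ t, ENNReal.ofReal (c * l ^ (2 * r + γ)) * E := by simp [hth]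
    rw [e2, hId, ← lintegral_const_mul' _ _ ENNReal.ofReal_ne_top, ← lintegral_const_mul' _ _ ENNReal.ofReal_ne_top,
      ← lintegral_add_right _ measurable_const]
    refine lintegral_mono fun τ => ?_
    have hlow := Mq_low (H.gτ τ) hr hγ hl0
    rw [H.gE] at hlow
    calc A * YY r (g τ) ≤ A * (ENNReal.ofReal cu * Mq (2 * r + 2) (g τ)) := by gcongr; exact hU' _
      _ = ENNReal.ofReal c * (ENNReal.ofReal (l ^ γ) * Mq (2 * r + 2) (g τ)) := by
        rw [← mul_assoc, ← mul_assoc, hAd, ← ENNReal.ofReal_mul (by positivity), ← ENNReal.ofReal_mul (by positivity)]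
        congr 2; rw [ha]; field_simp
      _ ≤ ENNReal.ofReal c * (Mq (2 * r + 2 + γ) (g τ) + ENNReal.ofReal (l ^ (2 * r + γ)) * E) := by gcongr
      _ = _ := by rw [mul_add, ← mul_assoc, ← ENNReal.ofReal_mul hc.le]
  have s3 := hA σ t hσ (by linarith)
  rw [hth, ← hId] at s3
  calc ENNReal.ofReal (1 + K) * y = y + A * (ENNReal.ofReal h * y) := by
        rw [← mul_assoc, hAh, ENNReal.ofReal_add (by norm_num) hK.le, ENNReal.ofReal_one]; ring
    _ ≤ y + A * ((∫⁻ τ in Ioc σ t, YY r (g τ)) + C * ENNReal.ofReal h) := by gcongr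
    _ = y + A * (∫⁻ τ in Ioc σ t, YY r (g τ)) + ENNReal.ofReal K * C := by rw [← hAh]; ring
    _ ≤ y + (ENNReal.ofReal c * I + ENNReal.ofReal (c * l ^ (2 * r + γ)) * E * ENNReal.ofReal h) + ENNReal.ofReal K * C := by
        gcongr
    _ = (y + ENNReal.ofReal c * I) + ENNReal.ofReal (c * l ^ (2 * r + γ)) * ENNReal.ofReal h * E + ENNReal.ofReal K * C := by ring
    _ ≤ (YY r (f σ) + C * ENNReal.ofReal h) + ENNReal.ofReal (c * l ^ (2 * r + γ)) * ENNReal.ofReal h * E + ENNReal.ofReal K * C := by gcongr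
    _ ≤ (YY r (f σ) + C * ENNReal.ofReal (h ^ (-(2 * r / γ)))) + ENNReal.ofReal (c * P) * ENNReal.ofReal (h ^ (-(2 * r / γ))) * E
        + ENNReal.ofReal K * C * ENNReal.ofReal (h ^ (-(2 * r / γ))) := by
        have q1 : ENNReal.ofReal h ≤ ENNReal.ofReal (h ^ (-(2 * r / γ))) :=
          le_trans (by rw [ENNReal.ofReal_le_one]; exact hh1) hone
        have q2 : ENNReal.ofReal (c * l ^ (2 * r + γ)) * ENNReal.ofReal h = 
            ENNReal.ofReal (c * P) * ENNReal.ofReal (h ^ (-(2 * r / γ))) := by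
          rw [← ENNReal.ofReal_mul (by positivity), ← ENNReal.ofReal_mul (by positivity), mul_assoc, hl2, mul_assoc]
        have q3 : ENNReal.ofReal K * C ≤ ENNReal.ofReal K * C * ENNReal.ofReal (h ^ (-(2 * r / γ))) :=
          le_mul_of_one_le_right bot_le hone
        rw [q2]
        exact add_le_add (add_le_add (add_le_add le_rfl (mul_le_mul_right q1 _)) le_rfl) q3
    _ = _ := by ring

lemma YY_fin {γ : ℝ} {b : ℝ → ℝ} {f g : ℝ → R3 → ℝ} {m E : ℝ≥0∞} (H : BRep γ b f g m E) (hm0 : m ≠ 0)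
    {r : ℝ} (hr : 0 < r) {t : ℝ} (ht : 0 < t) : YY r (f t) < ∞ := by
  obtain ⟨c, hc, C, hC, hA⟩ := absorbed H hm0 hr
  obtain ⟨Cu, hCu, hU⟩ := YY_upper hr
  obtain ⟨t1, h1, h2, h3⟩ := creation_finite' H hm0 (q := 2 * r + 2) (by linarith) ht
  refine lt_of_le_of_lt (le_trans le_self_add (hA t1 t h1.le h2)) (ENNReal.add_lt_top.2 ⟨?_, ?_⟩)
  · exact lt_of_le_of_lt (hU _) (ENNReal.mul_lt_top hCu h3)
  · exact ENNReal.mul_lt_top hC ENNReal.ofReal_lt_top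

lemma YY_decay {γ : ℝ} {b : ℝ → ℝ} {f g : ℝ → R3 → ℝ} {m E : ℝ≥0∞} (H : BRep γ b f g m E) (hm0 : m ≠ 0)
    {r : ℝ} (hr : 0 < r) : ∃ D : ℝ≥0∞, D < ∞ ∧ ∀ t0 τ : ℝ, 0 < t0 → 0 < τ → τ ≤ 1 →
    ENNReal.ofReal (τ ^ (2 * r / γ)) * YY r (f (t0 + τ)) ≤ D := by
  have hγ := H.γ0
  obtain ⟨c, hc, C, hC, hA⟩ := absorbed H hm0 hr
  set κ := 2 * r / γ with hκ
  have hκ0 : 0 < κ := by positivity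
  have h2κ : 1 < (2:ℝ) ^ κ := Real.one_lt_rpow (by norm_num) hκ0
  obtain ⟨D, hD, hc⟩ := contr H hm0 hr (K := 2 * 2 ^ κ - 1) (by linarith)
  rw [add_sub_cancel] at hc
  refine ⟨D, hD, fun t0 τ ht0 hτ hτ1 => ?_⟩
  set B := YY r (f t0) + C with hB
  have hBt : B ≠ ∞ := (ENNReal.add_lt_top.2 ⟨YY_fin H hm0 hr ht0, hC⟩).ne
  have key : ∀ n : ℕ, ∀ τ : ℝ, 0 < τ → τ ≤ 1 →
      ENNReal.ofReal (τ ^ κ) * YY r (f (t0 + τ)) ≤ (2⁻¹ : ℝ≥0∞) ^ n * B + D := by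
    intro n
    induction n with
    | zero =>
      intro τ hτ hτ1
      have h1 := le_trans le_self_add (hA t0 (t0 + τ) ht0.le (by linarith))
      rw [add_sub_cancel_left] at h1
      have h2 : ENNReal.ofReal (τ ^ κ) ≤ 1 := by
        rw [ENNReal.ofReal_le_one]; exact Real.rpow_le_one hτ.le hτ1 hκ0.le
      have h3 : ENNReal.ofReal τ ≤ 1 := by rw [ENNReal.ofReal_le_one]; exact hτ1
      calc _ ≤ 1 * (YY r (f t0) + C * 1) := by gcongr; exact h1.trans (by gcongr)
        _ = B := by rw [hB]; ring
        _ ≤ _ := by simp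
    | succ n ih =>
      intro τ hτ hτ1
      have h1 := ih (τ / 2) (by linarith) (by linarith)
      have h2 := hc (t0 + τ / 2) (τ / 2) (by linarith) (by linarith) (by linarith)
      rw [show t0 + τ / 2 + τ / 2 = t0 + τ by ring] at h2
      have e1 : ENNReal.ofReal ((τ / 2) ^ κ) * ENNReal.ofReal (2 * 2 ^ κ) = 2 * ENNReal.ofReal (τ ^ κ) := by
        rw [← ENNReal.ofReal_mul (by positivity), show (2:ℝ≥0∞) = ENNReal.ofReal 2 by simp,
          ← ENNReal.ofReal_mul (by norm_num), Real.div_rpow hτ.le (by norm_num)]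
        congr 1; field_simp
      have e2 : ENNReal.ofReal ((τ / 2) ^ κ) * ENNReal.ofReal ((τ / 2) ^ (-κ)) = 1 := by
        rw [← ENNReal.ofReal_mul (by positivity), ← Real.rpow_add (by positivity)]; simp
      have h3 : 2 * (ENNReal.ofReal (τ ^ κ) * YY r (f (t0 + τ))) ≤ 2 * ((2⁻¹ : ℝ≥0∞) ^ (n + 1) * B + D) := by
        calc _ = ENNReal.ofReal ((τ / 2) ^ κ) * (ENNReal.ofReal (2 * 2 ^ κ) * YY r (f (t0 + τ))) := by
              rw [← mul_assoc, ← mul_assoc, e1]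
          _ ≤ ENNReal.ofReal ((τ / 2) ^ κ) * (YY r (f (t0 + τ / 2)) + D * ENNReal.ofReal ((τ / 2) ^ (-κ))) := by gcongr
          _ = ENNReal.ofReal ((τ / 2) ^ κ) * YY r (f (t0 + τ / 2)) + D * (ENNReal.ofReal ((τ / 2) ^ κ) * ENNReal.ofReal ((τ / 2) ^ (-κ))) := by ring
          _ ≤ ((2⁻¹ : ℝ≥0∞) ^ n * B + D) + D * 1 := by rw [e2]; gcongr
          _ = (2 * 2⁻¹) * ((2⁻¹ : ℝ≥0∞) ^ n * B) + 2 * D := by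
              rw [ENNReal.mul_inv_cancel (by simp) (by simp)]; ring
          _ = _ := by ring
      exact (ENNReal.mul_le_mul_iff_right (by simp) (by simp)).1 h3
  have lim : Filter.Tendsto (fun n : ℕ => (2⁻¹ : ℝ≥0∞) ^ n * B + D) Filter.atTop (nhds (0 * B + D)) := by
    refine Filter.Tendsto.add ?_ tendsto_const_nhds
    exact ENNReal.Tendsto.mul_const (ENNReal.tendsto_pow_atTop_nhds_zero_of_lt_one (by
      rw [ENNReal.inv_lt_one]; norm_num)) (Or.inr hBt)
  rw [zero_mul, zero_add] at lim
  exact ge_of_tendsto' lim fun n => key n τ hτ hτ1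

lemma YY_bound {γ : ℝ} {b : ℝ → ℝ} {f g : ℝ → R3 → ℝ} {m E : ℝ≥0∞} (H : BRep γ b f g m E) (hm0 : m ≠ 0)
    {r : ℝ} (hr : 0 < r) : ∃ D : ℝ≥0∞, D < ∞ ∧ ∀ t : ℝ, 0 < t →
    YY r (f t) ≤ D * ENNReal.ofReal (max (t ^ (-(2 * r / γ))) 1) := by
  have hγ := H.γ0
  obtain ⟨D, hD, h⟩ := YY_decay H hm0 hr
  set κ := 2 * r / γ with hκ
  have hκ0 : 0 < κ := by positivity
  have h2κ : 1 < (2:ℝ) ^ κ := Real.one_lt_rpow (by norm_num) hκ0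
  refine ⟨D * ENNReal.ofReal (2 ^ κ), ENNReal.mul_lt_top hD ENNReal.ofReal_lt_top, fun t ht => ?_⟩
  rw [mul_assoc, ← ENNReal.ofReal_mul (by positivity)]
  have gen : ∀ t0 τ : ℝ, 0 < t0 → 0 < τ → τ ≤ 1 → YY r (f (t0 + τ)) ≤ D * ENNReal.ofReal (τ ^ (-κ)) := by
    intro t0 τ h0 h1 h2
    have h3 := h t0 τ h0 h1 h2
    have e2 : ENNReal.ofReal (τ ^ (-κ)) * ENNReal.ofReal (τ ^ κ) = 1 := by
      rw [← ENNReal.ofReal_mul (by positivity), ← Real.rpow_add (by positivity)]; simp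
    calc YY r (f (t0 + τ)) = ENNReal.ofReal (τ ^ (-κ)) * (ENNReal.ofReal (τ ^ κ) * YY r (f (t0 + τ))) := by
          rw [← mul_assoc, e2, one_mul]
      _ ≤ ENNReal.ofReal (τ ^ (-κ)) * D := by gcongr
      _ = _ := mul_comm _ _
  rcases le_total t 2 with h2 | h2
  · have h3 := gen (t / 2) (t / 2) (by linarith) (by linarith) (by linarith)
    rw [add_halves] at h3
    refine h3.trans ?_
    gcongr
    calc (t / 2) ^ (-κ) = 2 ^ κ * t ^ (-κ) := by
          rw [Real.div_rpow ht.le (by norm_num), Real.rpow_neg (by norm_num : (0:ℝ) ≤ 2)]; field_simp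
      _ ≤ _ := by gcongr; exact le_max_left _ _
  · have h3 := gen (t - 1) 1 (by linarith) one_pos le_rfl
    rw [sub_add_cancel, Real.one_rpow] at h3
    refine h3.trans ?_
    gcongr
    calc (1:ℝ) = 1 * 1 := by norm_num
      _ ≤ _ := by gcongr; exact le_max_right _ _

lemma integral_eq_Mq {h : R3 → ℝ} (hm : Measurable h) (h0 : ∀ v, 0 ≤ h v) (s : ℝ) :
    ∫ v, h v * ‖v‖ ^ s = (Mq s h).toReal := by
  rw [integral_eq_lintegral_of_nonneg_ae (ae_of_all _ fun v => mul_nonneg (h0 v) (by positivity))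
    (hm.mul (measurable_norm.pow_const s)).aestronglyMeasurable]
  unfold Mq
  congr 2; ext v
  rw [ENNReal.ofReal_mul (h0 v)]

lemma Mq_eq_zero {h : R3 → ℝ} (hm : Measurable h) (h0 : Mq 0 h = 0) (s : ℝ) : Mq s h = 0 := by
  unfold Mq at h0 ⊢
  simp only [Real.rpow_zero, ENNReal.ofReal_one, mul_one] at h0
  rw [lintegral_eq_zero_iff hm.ennreal_ofReal] at h0
  rw [← lintegral_zero]
  apply lintegral_congr_ae
  filter_upwards [h0] with v hv
  simp only [Pi.zero_apply] at hv
  rw [hv, zero_mul]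

lemma creation_Mq {γ : ℝ} {b : ℝ → ℝ} {f g : ℝ → R3 → ℝ} {m E : ℝ≥0∞} (H : BRep γ b f g m E)
    {s : ℝ} (hs : 2 ≤ s) : ∃ D : ℝ≥0∞, D < ∞ ∧ ∀ t : ℝ, 0 < t →
    Mq s (f t) ≤ D * ENNReal.ofReal (max (t ^ ((2 - s) / γ)) 1) := by
  have hone : ∀ t : ℝ, 1 ≤ ENNReal.ofReal (max (t ^ ((2 - s) / γ)) 1) := by
    intro t; rw [ENNReal.one_le_ofReal]; exact le_max_right _ _
  by_cases hm0 : m = 0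
  · refine ⟨0, by simp, fun t ht => ?_⟩
    rw [Mq_eq_zero (H.fmeas t) (by rw [H.fm t ht.le, hm0]) s]
    exact bot_le
  rcases eq_or_lt_of_le hs with h2 | h2
  · refine ⟨E, H.Elt, fun t ht => ?_⟩
    subst h2
    rw [H.fE t ht.le]
    exact le_mul_of_one_le_right bot_le (hone t)
  · obtain ⟨r, rfl⟩ : ∃ r, s = 2 * r + 2 := ⟨(s - 2) / 2, by ring⟩
    have hr : 0 < r := by linarith
    obtain ⟨D, hD, hB⟩ := YY_bound H hm0 hr
    obtain ⟨C, hC, hL⟩ := YY_lower hr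
    have e : (2 - (2 * r + 2)) / γ = -(2 * r / γ) := by ring
    rw [e] at hone ⊢
    refine ⟨ENNReal.ofReal C * (D + m), ENNReal.mul_lt_top ENNReal.ofReal_lt_top
      (ENNReal.add_lt_top.2 ⟨hD, H.mlt⟩), fun t ht => ?_⟩
    have h1 := hL (f t) (H.fmeas t)
    rw [H.fm t ht.le] at h1
    refine h1.trans ?_
    rw [mul_assoc, add_mul]
    exact mul_le_mul_right (add_le_add (hB t ht) (le_mul_of_one_le_right bot_le (hone t))) _

lemma propagation_Mq {γ : ℝ} {b : ℝ → ℝ} {f g : ℝ → R3 → ℝ} {m E : ℝ≥0∞} (H : BRep γ b f g m E)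
    {s : ℝ} (hs : 2 < s) (h0 : Mq s (f 0) < ∞) : ∃ D : ℝ≥0∞, D < ∞ ∧ ∀ t : ℝ, 0 ≤ t →
    Mq s (f t) ≤ D := by
  have hγ := H.γ0
  by_cases hm0 : m = 0
  · refine ⟨0, by simp, fun t ht => ?_⟩
    rw [Mq_eq_zero (H.fmeas t) (by rw [H.fm t ht, hm0]) s]
  obtain ⟨r, rfl⟩ : ∃ r, s = 2 * r + 2 := ⟨(s - 2) / 2, by ring⟩
  have hr : 0 < r := by linarith
  obtain ⟨D, hD, hB⟩ := creation_Mq H hs.le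
  obtain ⟨Cl, hCl, hL⟩ := YY_lower hr
  obtain ⟨Cu, hCu, hU⟩ := YY_upper hr
  obtain ⟨c, hc, C, hC, hA⟩ := absorbed H hm0 hr
  refine ⟨max D (ENNReal.ofReal Cl * ((Cu * Mq (2 * r + 2) (f 0) + C) + m)), ?_, fun t ht => ?_⟩
  · refine max_lt hD (ENNReal.mul_lt_top ENNReal.ofReal_lt_top (ENNReal.add_lt_top.2
      ⟨ENNReal.add_lt_top.2 ⟨ENNReal.mul_lt_top hCu h0, hC⟩, H.mlt⟩))
  rcases le_total 1 t with h1 | h1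
  · refine le_trans ?_ (le_max_left _ _)
    have h2 := hB t (by linarith)
    have h3 : t ^ ((2 - (2 * r + 2)) / γ) ≤ 1 := by
      apply Real.rpow_le_one_of_one_le_of_nonpos h1
      apply div_nonpos_of_nonpos_of_nonneg _ hγ.le
      linarith
    rw [max_eq_right h3] at h2
    simpa using h2
  · refine le_trans ?_ (le_max_right _ _)
    have h2 := hL (f t) (H.fmeas t)
    rw [H.fm t ht] at h2
    refine h2.trans (mul_le_mul_right (add_le_add ?_ le_rfl) _)
    refine (le_trans le_self_add (hA 0 t le_rfl ht)).trans (add_le_add (hU _) ?_)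
    have h3 : ENNReal.ofReal (t - 0) ≤ 1 := by rw [ENNReal.ofReal_le_one]; linarith
    calc C * ENNReal.ofReal (t - 0) ≤ C * 1 := mul_le_mul_right h3 _
      _ = C := mul_one _

lemma Mq_init {γ : ℝ} {b : ℝ → ℝ} {f₀ : R3 → ℝ} {f : ℝ → R3 → ℝ} (hf : IsFDSolution γ b f₀ f)
    {s : ℝ} (hs : 2 < s) (h : MemL1s s f₀) : Mq s (f 0) < ∞ := by
  obtain ⟨Z, hZ, hm⟩ := hf.mild
  have h1 : f 0 =ᵐ[volume] f₀ := by
    have : ∀ᵐ v : R3, v ∉ Z := measure_eq_zero_iff_ae_notMem.1 hZ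
    filter_upwards [this] with v hv
    have := hm 0 le_rfl v hv
    simpa using this
  rw [Mq_congr h1]
  refine lt_of_le_of_lt ?_ h.hasFiniteIntegral
  unfold Mq
  refine lintegral_mono fun v => ?_
  have p : 0 ≤ |f₀ v| * (1 + ‖v‖ ^ 2) ^ (s / 2) := by positivity
  rw [Real.enorm_of_nonneg p, ENNReal.ofReal_mul (abs_nonneg _)]
  refine mul_le_mul' (ENNReal.ofReal_le_ofReal (le_abs_self _)) (ENNReal.ofReal_le_ofReal ?_)
  calc ‖v‖ ^ s = (‖v‖ ^ 2) ^ (s / 2) := by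
        rw [← Real.rpow_natCast, ← Real.rpow_mul (norm_nonneg _)]; congr 1; push_cast; ring
    _ ≤ _ := by
        apply Real.rpow_le_rpow (by positivity) (by linarith) (by linarith)

/-- Creation and propagation of `L¹` polynomial moments for the
Boltzmann–Fermi–Dirac equation with `0 < γ ≤ 2` and angular cutoff. -/
theorem L1_polynomial_moments_BFD
    (γ : ℝ) (hγ₀ : 0 < γ) (hγ₂ : γ ≤ 2) (b : ℝ → ℝ) (hb : GradCutoff b)
    (f₀ : R3 → ℝ) (hf₀meas : Measurable f₀)
    (hf₀bd : ∀ᵐ v : R3 ∂volume, 0 ≤ f₀ v ∧ f₀ v ≤ 1) (hf₀L12 : MemL1s 2 f₀)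
    (f : ℝ → R3 → ℝ) (hf : IsFDSolution γ b f₀ f) :
    (∀ s : ℝ, 2 ≤ s → ∃ C : ℝ, 0 ≤ C ∧ ∀ t : ℝ, 0 < t →
      (∫ v : R3, f t v * ‖v‖ ^ s) ≤ C * max (t ^ ((2 - s) / γ)) 1) ∧
    (∀ s : ℝ, 2 < s → MemL1s s f₀ → ∃ C : ℝ, 0 ≤ C ∧ ∀ t : ℝ, 0 ≤ t →
      (∫ v : R3, f t v * ‖v‖ ^ s) ≤ C) := by
  obtain ⟨g, H⟩ := BRep.mk' hγ₀ hγ₂ hb hf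
  constructor
  · intro s hs
    obtain ⟨D, hD, h⟩ := creation_Mq H hs
    refine ⟨D.toReal, ENNReal.toReal_nonneg, fun t ht => ?_⟩
    rw [integral_eq_Mq (hf.measurable t) (hf.nonneg t ht.le)]
    have h1 := ENNReal.toReal_mono (ENNReal.mul_lt_top hD ENNReal.ofReal_lt_top).ne (h t ht)
    rwa [ENNReal.toReal_mul, ENNReal.toReal_ofReal (le_trans zero_le_one (le_max_right _ _))] at h1
  · intro s hs hs0
    obtain ⟨D, hD, h⟩ := propagation_Mq H hs (Mq_init hf hs hs0)
    refine ⟨D.toReal, ENNReal.toReal_nonneg, fun t ht => ?_⟩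
    rw [integral_eq_Mq (hf.measurable t) (hf.nonneg t ht)]
    exact ENNReal.toReal_mono hD.ne (h t ht)
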